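/- Let Q_{12}, Q_{21} ∈ W^n_1[0,1] for some n ≥ 2. Assume J_{32} = J_{13} = J_{42} = 0, J_{14} ≠ 0, and Q_{12}^{(j_0)}(0) Q_{21}^{(j_1)}(1) ≠ 0 for some j_0, j_1 ∈ {0,1,…,n−2} with j_0 + j_1 ≤ n−2. Then the system of root functions of the boundary value problem is complete in L²([0,1];ℂ²). -/

import Mathlib

open MeasureTheory Set Filter

noncomputable section

/-- The unit interval `[0,1]` as a subset of `ℝ`. -/
def I01 : Set ℝ := Set.Icc 0 1

/-- Lebesgue measure restricted to `[0,1]`. -/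
def mu01 : MeasureTheory.Measure ℝ := MeasureTheory.volume.restrict I01

/-- `f ∈ W^n_1[0,1]`: the derivatives of `f` up to order `n-1` exist and are continuous on
`[0,1]`, and the `(n-1)`-st derivative is absolutely continuous, i.e. an indefinite integral
of an integrable function (its a.e.-derivative `f⁽ⁿ⁾ ∈ L¹[0,1]`). -/
def MemW1 (n : ℕ) (f : ℝ → ℂ) : Prop :=
  ContDiffOn ℝ (n - 1 : ℕ) f I01 ∧
  ∃ g : ℝ → ℂ, MeasureTheory.IntegrableOn g I01 ∧
    ∀ x ∈ I01, iteratedDerivWithin (n - 1) f I01 x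
      = iteratedDerivWithin (n - 1) f I01 0 + ∫ t in (0:ℝ)..x, g t

/-- `Jdet a j k` is the minor `J_{(j+1)(k+1)} = a_{1,j} a_{2,k} - a_{1,k} a_{2,j}` of the
boundary coefficient matrix (`0`-based indices). -/
def Jdet (a : Fin 2 → Fin 4 → ℂ) (j k : Fin 4) : ℂ := a 0 j * a 1 k - a 0 k * a 1 j

/-- `y` satisfies the two-point boundary conditions `U_j(y) = 0`, `j = 1, 2`. -/
def SatisfiesBC (a : Fin 2 → Fin 4 → ℂ) (y : ℝ → ℂ × ℂ) : Prop :=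
  ∀ j : Fin 2, a j 0 * (y 0).1 + a j 1 * (y 0).2 + a j 2 * (y 1).1 + a j 3 * (y 1).2 = 0

/-- `y` is absolutely continuous on `[0,1]` (an indefinite integral of an integrable `g`,
which is then its a.e. derivative) and satisfies `-i B⁻¹ y' + Q y = rhs` a.e. on `[0,1]`. -/
def SolvesDirac (b₁ b₂ : ℝ) (Q12 Q21 : ℝ → ℂ) (y rhs : ℝ → ℂ × ℂ) : Prop :=
  ∃ g : ℝ → ℂ × ℂ, MeasureTheory.IntegrableOn g I01 ∧
    (∀ x ∈ I01, y x = y 0 + ∫ t in (0:ℝ)..x, g t) ∧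
    (∀ᵐ x ∂mu01,
      (-Complex.I) * (b₁ : ℂ)⁻¹ * (g x).1 + Q12 x * (y x).2 = (rhs x).1 ∧
      (-Complex.I) * (b₂ : ℂ)⁻¹ * (g x).2 + Q21 x * (y x).1 = (rhs x).2)

/-- `y` is a root function of the boundary value problem: a member of a chain
`ch 0, …, ch m` of absolutely continuous functions satisfying the boundary conditions,
with `ch 0 ≠ 0`, `L (ch 0) = λ • ch 0` a.e. and `L (ch j) = λ • ch j + ch (j-1)` a.e. -/
def IsRootFunction (b₁ b₂ : ℝ) (Q12 Q21 : ℝ → ℂ) (a : Fin 2 → Fin 4 → ℂ)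
    (y : ℝ → ℂ × ℂ) : Prop :=
  ∃ (lam : ℂ) (m : ℕ) (ch : ℕ → ℝ → ℂ × ℂ),
    (∀ j ≤ m, SatisfiesBC a (ch j)) ∧
    (∃ x ∈ I01, ch 0 x ≠ 0) ∧
    SolvesDirac b₁ b₂ Q12 Q21 (ch 0) (fun x => lam • ch 0 x) ∧
    (∀ j, 1 ≤ j → j ≤ m →
      SolvesDirac b₁ b₂ Q12 Q21 (ch j) (fun x => lam • ch j x + ch (j - 1) x)) ∧
    ∃ j ≤ m, y = ch j

/-- Completeness of the system of root functions in `L²([0,1]; ℂ²)`: the closed linear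
span of (the `L²`-classes of) all root functions is the whole space. -/
def RootSystemComplete (b₁ b₂ : ℝ) (Q12 Q21 : ℝ → ℂ) (a : Fin 2 → Fin 4 → ℂ) : Prop :=
  (Submodule.span ℂ {g : MeasureTheory.Lp (ℂ × ℂ) 2 mu01 |
    ∃ y : ℝ → ℂ × ℂ, IsRootFunction b₁ b₂ Q12 Q21 a y ∧
      (g : ℝ → ℂ × ℂ) =ᵐ[mu01] y}).topologicalClosure = ⊤

open Metric Topology

/-! ### Entire functions of exponential type -/

theorem log_norm_le_circleAverage {f : ℂ → ℂ} (hf : Differentiable ℂ f) {c : ℂ} (hc : f c ≠ 0)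
    {r : ℝ} (hr : 0 < r) :
    Real.log ‖f c‖ ≤ Real.circleAverage (fun w => Real.log ‖f w‖) c r := by
  have hA : AnalyticOnNhd ℂ f (closedBall c |r|) := fun z _ => hf.analyticAt z
  rw [hA.circleAverage_log_norm hr.ne' hc]
  refine le_add_of_nonneg_left (finsum_nonneg fun u => ?_)
  by_cases hu : u ∈ closedBall c |r|
  · refine mul_nonneg ?_ ?_
    · have := MeromorphicOn.AnalyticOnNhd.divisor_nonneg hA
      exact_mod_cast this u
    · by_cases huc : ‖c - u‖ = 0
      · simp [huc]
      · apply Real.log_nonneg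
        rw [← div_eq_mul_inv, le_div_iff₀ (lt_of_le_of_ne (norm_nonneg _) (Ne.symm huc)), one_mul]
        rw [mem_closedBall, dist_comm, dist_eq_norm, abs_of_pos hr] at hu
        exact hu
  · simp [hu]

theorem ofReal_circleAverage_eq_lintegral {g : ℂ → ℝ} {c : ℂ} {r : ℝ}
    (hg : CircleIntegrable g c r) (h0 : ∀ θ, 0 ≤ g (circleMap c r θ)) :
    ENNReal.ofReal (2 * Real.pi * Real.circleAverage g c r)
      = ∫⁻ θ in Ioo (-Real.pi) Real.pi, ENNReal.ofReal (g (circleMap c r θ)) := by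
  have hper : Function.Periodic (fun θ => g (circleMap c r θ)) (2 * Real.pi) := fun θ => by
    simp [circleMap]
    congr 2
    congr 1
    rw [add_mul, Complex.exp_add, Complex.exp_two_pi_mul_I, mul_one]
  have h1 : 2 * Real.pi * Real.circleAverage g c r
      = ∫ θ in Ioc (-Real.pi) Real.pi, g (circleMap c r θ) := by
    rw [Real.circleAverage_def, smul_eq_mul, mul_inv_cancel_left₀ Real.two_pi_pos.ne',
      ← intervalIntegral.integral_of_le (by linarith [Real.pi_pos])]
    have := hper.intervalIntegral_add_eq 0 (-Real.pi)
    rw [zero_add] at this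
    rw [this]
    congr 1
    ring
  have hgInt : IntervalIntegrable (fun θ => g (circleMap c r θ)) volume (-Real.pi) Real.pi := by
    have := hper.intervalIntegrable Real.two_pi_pos.ne' (t := 0) (by rw [zero_add]; exact hg)
    exact this _ _
  rw [intervalIntegrable_iff_integrableOn_Ioc_of_le (by linarith [Real.pi_pos])] at hgInt
  rw [h1, ofReal_integral_eq_lintegral_ofReal hgInt (ae_of_all _ h0),
    restrict_Ioo_eq_restrict_Ioc]

theorem lintegral_ball_eq_polar {G : ℂ → ENNReal} (hG : Measurable G) (c : ℂ) (s : ℝ) :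
    ∫⁻ w in ball c s, G w = ∫⁻ r in Ioo 0 s, ENNReal.ofReal r *
      ∫⁻ θ in Ioo (-Real.pi) Real.pi, G (circleMap c r θ) := by
  have h1 : ∫⁻ w in ball c s, G w = ∫⁻ w, (ball (0:ℂ) s).indicator (fun w => G (c + w)) w := by
    rw [← lintegral_indicator measurableSet_ball, ← lintegral_add_left_eq_self _ c]
    congr 1
    ext w
    simp [indicator]
  rw [h1, ← Complex.lintegral_comp_polarCoord_symm]
  have h2 : polarCoord.target = Ioi (0:ℝ) ×ˢ Ioo (-Real.pi) Real.pi := rfl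
  have hmeas : Measurable fun p : ℝ × ℝ => ENNReal.ofReal p.1 •
      (ball (0:ℂ) s).indicator (fun w => G (c + w)) (Complex.polarCoord.symm p) := by
    have hm : Measurable fun p : ℝ × ℝ => Complex.polarCoord.symm p := by
      simp only [Complex.polarCoord_symm_apply]
      fun_prop
    refine Measurable.smul (f := fun p : ℝ × ℝ => ENNReal.ofReal p.1) (by fun_prop) ?_
    exact (Measurable.indicator (hG.comp (measurable_const_add c)) measurableSet_ball).comp hm
  rw [h2, Measure.volume_eq_prod, ← Measure.prod_restrict, lintegral_prod _ hmeas.aemeasurable]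
  rw [← lintegral_indicator measurableSet_Ioi, ← lintegral_indicator measurableSet_Ioo]
  congr 1
  ext r
  by_cases hr : 0 < r
  · by_cases hs : r < s
    · rw [indicator_of_mem (by simpa using hr), indicator_of_mem (by simp [hr, hs])]
      rw [← lintegral_const_mul]
      · refine lintegral_congr fun θ => ?_
        rw [indicator_of_mem]
        · rw [smul_eq_mul]
          congr 2
          rw [circleMap, Complex.polarCoord_symm_apply]
          rw [Complex.exp_mul_I]
          push_cast
          ring
        · rw [mem_ball_zero_iff, Complex.norm_polarCoord_symm, abs_of_pos hr]
          exact hs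
      · exact hG.comp (measurable_circleMap _ _)
    · rw [indicator_of_mem (by simpa using hr), indicator_of_notMem (by simp [hs])]
      rw [lintegral_eq_zero_iff']
      · refine ae_of_all _ fun θ => ?_
        beta_reduce
        rw [indicator_of_notMem]
        · simp
        · rw [mem_ball_zero_iff, Complex.norm_polarCoord_symm, abs_of_pos hr]
          exact hs
      · exact (hmeas.comp measurable_prodMk_left).aemeasurable
  · rw [indicator_of_notMem (by simpa using hr), indicator_of_notMem (by simp [hr])]

theorem lintegral_Ioo_ofReal_mul {s : ℝ} (hs : 0 ≤ s) (K : ℝ) :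
    ∫⁻ r in Ioo 0 s, ENNReal.ofReal r * ENNReal.ofReal (2 * Real.pi * K)
      = ENNReal.ofReal (Real.pi * s ^ 2 * K) := by
  rw [lintegral_mul_const _ (by fun_prop), ← ofReal_integral_eq_lintegral_ofReal]
  · rw [← integral_Ioc_eq_integral_Ioo, ← intervalIntegral.integral_of_le hs, integral_id,
      ← ENNReal.ofReal_mul (by nlinarith)]
    congr 1
    ring
  · exact (continuous_id.integrableOn_Icc (a := 0) (b := s)).mono_set Ioo_subset_Icc_self
  · filter_upwards [ae_restrict_mem measurableSet_Ioo] with r hr using hr.1.le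

theorem circleAverage_comparison {g : ℂ → ℝ} (hg : Measurable g) {z z₀ : ℂ} {R a K : ℝ}
    (hR : 0 < R) (hz : dist z z₀ ≤ R) (h0 : ∀ w ∈ ball z₀ (2 * R), 0 ≤ g w)
    (hci : ∀ c r, CircleIntegrable g c r) (hK : 0 ≤ K)
    (hlow : ∀ r ∈ Ioo 0 R, a ≤ Real.circleAverage g z r)
    (hup : ∀ r ∈ Ioo 0 (2 * R), Real.circleAverage g z₀ r ≤ K) : a ≤ 4 * K := by
  have hm : Measurable fun w => ENNReal.ofReal (g w) := by fun_prop
  have hsub : ball z R ⊆ ball z₀ (2 * R) := ball_subset_ball' (by linarith)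
  have hcm : ∀ (c : ℂ) (s r : ℝ), r ∈ Ioo 0 s → ∀ θ, circleMap c r θ ∈ ball c s := by
    intro c s r hr θ
    rw [mem_ball, dist_eq_norm, circleMap_sub_center, norm_circleMap_zero, abs_of_pos hr.1]
    exact hr.2
  have h1 : ENNReal.ofReal (Real.pi * R ^ 2 * a) ≤ ∫⁻ w in ball z R, ENNReal.ofReal (g w) := by
    rw [lintegral_ball_eq_polar hm, ← lintegral_Ioo_ofReal_mul hR.le]
    refine setLIntegral_mono' measurableSet_Ioo fun r hr => ?_
    rw [← ofReal_circleAverage_eq_lintegral (hci z r)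
      (fun θ => h0 _ (hsub (hcm z R r hr θ)))]
    gcongr
    exact hlow r hr
  have h2 : ∫⁻ w in ball z₀ (2 * R), ENNReal.ofReal (g w)
      ≤ ENNReal.ofReal (Real.pi * (2 * R) ^ 2 * K) := by
    rw [lintegral_ball_eq_polar hm, ← lintegral_Ioo_ofReal_mul (by linarith)]
    refine setLIntegral_mono' measurableSet_Ioo fun r hr => ?_
    rw [← ofReal_circleAverage_eq_lintegral (hci z₀ r)
      (fun θ => h0 _ (hcm z₀ _ r hr θ))]
    gcongr
    exact hup r hr
  have h3 := (h1.trans (lintegral_mono_set hsub)).trans h2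
  rw [ENNReal.ofReal_le_ofReal_iff (by positivity)] at h3
  have : 0 < Real.pi * R ^ 2 := by positivity
  nlinarith

/-- If `F = H * D` with `F` and `D` of exponential type, then so is `H`. -/
theorem exists_exponentialType_quotient {F D H : ℂ → ℂ} (hH : Differentiable ℂ H)
    (hD : Differentiable ℂ D) (hFD : ∀ z, F z = H z * D z) {z₀ : ℂ} (hz₀ : D z₀ ≠ 0) {C : ℝ}
    (hC : 1 ≤ C) (hF : ∀ z, ‖F z‖ ≤ C * Real.exp (C * ‖z‖))
    (hDb : ∀ z, ‖D z‖ ≤ C * Real.exp (C * ‖z‖)) :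
    ∃ C', ∀ z, ‖H z‖ ≤ C' * Real.exp (C' * ‖z‖) := by
  set ℓ : ℝ := |Real.log ‖D z₀‖| with hℓ
  have hFe : Differentiable ℂ F := by
    have : F = fun z => H z * D z := funext hFD
    rw [this]; exact hH.mul hD
  have key : ∀ z, ‖H z‖ ≤ Real.exp (4 * (Real.log C + 3 * C * (‖z‖ + ‖z₀‖ + 1) + ℓ)) := by
    intro z
    by_cases hHz : H z = 0
    · simp [hHz, Real.exp_nonneg]
    set R : ℝ := ‖z‖ + ‖z₀‖ + 1 with hR
    have hRpos : 0 < R := by positivity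
    set L : ℝ := Real.log C + 3 * C * R with hL
    have hL0 : 0 ≤ L := by
      have := Real.log_nonneg hC
      positivity
    have hlogle : ∀ f : ℂ → ℂ, (∀ z, ‖f z‖ ≤ C * Real.exp (C * ‖z‖)) → ∀ w ∈ ball z₀ (2 * R),
        Real.log ‖f w‖ ≤ L := by
      intro f hf w hw
      by_cases hfw : f w = 0
      · simpa [hfw] using hL0
      have hw' : ‖w‖ ≤ 3 * R := by
        have h1 : ‖w - z₀‖ < 2 * R := by simpa [dist_eq_norm] using hw
        have h2 : ‖w‖ ≤ ‖w - z₀‖ + ‖z₀‖ := by simpa using norm_add_le (w - z₀) z₀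
        have : 0 ≤ ‖z‖ := norm_nonneg _
        linarith
      calc Real.log ‖f w‖ ≤ Real.log (C * Real.exp (C * ‖w‖)) :=
            Real.log_le_log (norm_pos_iff.2 hfw) (hf w)
        _ = Real.log C + C * ‖w‖ := by
            rw [Real.log_mul (by positivity) (Real.exp_pos _).ne', Real.log_exp]
        _ ≤ L := by rw [hL]; nlinarith
    have hci : ∀ f : ℂ → ℂ, Differentiable ℂ f → ∀ c r,
        CircleIntegrable (fun w => Real.log ‖f w‖) c r := fun f hf c r =>
      MeromorphicOn.circleIntegrable_log_norm fun x _ => (hf.analyticAt x).meromorphicAt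
    have hconst : ∀ c r, CircleIntegrable (fun _ : ℂ => L) c r :=
      fun c r => circleIntegrable_const L c r
    set g : ℂ → ℝ := fun w => L - Real.log ‖D w‖ with hg
    have hgci : ∀ c r, CircleIntegrable g c r := fun c r => (hconst c r).sub (hci D hD c r)
    have hgm : Measurable g := by
      have := hD.continuous.measurable
      fun_prop
    have hav : ∀ c r, Real.circleAverage g c r
        = L - Real.circleAverage (fun w => Real.log ‖D w‖) c r := by
      intro c r
      have := Real.circleAverage_fun_sub (hconst c r) (hci D hD c r)
      rw [Real.circleAverage_const] at this
      exact this
    have hzz : dist z z₀ ≤ R := by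
      rw [dist_eq_norm]
      have := norm_sub_le z z₀
      linarith
    have hmain := circleAverage_comparison hgm (a := Real.log ‖H z‖) (K := L + ℓ) hRpos hzz
      (fun w hw => sub_nonneg.2 (hlogle D hDb w hw)) hgci (by positivity)
      (fun r hr => ?_) (fun r hr => ?_)
    · rw [← Real.exp_log (norm_pos_iff.2 hHz)]
      exact Real.exp_le_exp.2 hmain
    · refine (log_norm_le_circleAverage hH hHz hr.1).trans ?_
      have hcod : (fun w => Real.log ‖H w‖) =ᶠ[codiscreteWithin (sphere z |r|)]
          fun w => Real.log ‖F w‖ - Real.log ‖D w‖ := by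
        have h1 : D ⁻¹' {0}ᶜ ∈ codiscrete ℂ :=
          AnalyticOnNhd.preimage_zero_mem_codiscrete (fun w _ => hD.analyticAt w) hz₀
        have h2 : H ⁻¹' {0}ᶜ ∈ codiscrete ℂ :=
          AnalyticOnNhd.preimage_zero_mem_codiscrete (fun w _ => hH.analyticAt w) hHz
        have h3 := codiscreteWithin_mono (subset_univ (sphere z |r|)) (inter_mem h1 h2)
        filter_upwards [h3] with w hw
        have hw1 : D w ≠ 0 := by simpa using hw.1
        have hw2 : H w ≠ 0 := by simpa using hw.2
        rw [hFD, norm_mul, Real.log_mul (by simpa using hw2) (by simpa using hw1)]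
        ring
      rw [Real.circleAverage_congr_codiscreteWithin hcod hr.1.ne']
      refine Real.circleAverage_mono ((hci F hFe z r).sub (hci D hD z r)) (hgci z r) ?_
      intro w hw
      have : w ∈ ball z₀ (2 * R) := by
        rw [mem_sphere, abs_of_pos hr.1] at hw
        rw [mem_ball]
        have := dist_triangle w z z₀
        linarith [hr.2]
      simp only [hg]
      linarith [hlogle F hF w this]
    · rw [hav]
      have := log_norm_le_circleAverage hD hz₀ hr.1
      have h3 := neg_abs_le (Real.log ‖D z₀‖)
      linarith
  refine ⟨max (Real.exp (4 * (Real.log C + 3 * C * (‖z₀‖ + 1) + ℓ))) (12 * C), fun z => ?_⟩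
  calc ‖H z‖ ≤ _ := key z
    _ = Real.exp (4 * (Real.log C + 3 * C * (‖z₀‖ + 1) + ℓ)) * Real.exp (12 * C * ‖z‖) := by
      rw [← Real.exp_add]; congr 1; ring
    _ ≤ _ := by gcongr <;> first | exact le_max_left _ _ | exact le_max_right _ _

theorem norm_le_of_bounded_on_axes {f : ℂ → ℂ} (hf : Differentiable ℂ f) {A C : ℝ}
    (hexp : ∀ z, ‖f z‖ ≤ A * Real.exp (A * ‖z‖)) (hre : ∀ x : ℝ, ‖f x‖ ≤ C)
    (him : ∀ x : ℝ, ‖f (x * Complex.I)‖ ≤ C) (z : ℂ) : ‖f z‖ ≤ C := by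
  have hB : ∀ l : Filter ℂ, ∃ c < (2 : ℝ), ∃ B,
      f =O[l] fun z => Real.exp (B * ‖z‖ ^ c) := fun l =>
    ⟨1, by norm_num, A, Asymptotics.isBigO_of_le' (c := A) _ fun z => by
      simpa [abs_of_pos (Real.exp_pos _)] using hexp z⟩
  rcases le_total 0 z.re with h1 | h1 <;> rcases le_total 0 z.im with h2 | h2
  · exact PhragmenLindelof.quadrant_I hf.diffContOnCl (hB _) (fun x _ => hre x)
      (fun x _ => him x) h1 h2
  · exact PhragmenLindelof.quadrant_IV hf.diffContOnCl (hB _) (fun x _ => hre x)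
      (fun x _ => him x) h1 h2
  · exact PhragmenLindelof.quadrant_II hf.diffContOnCl (hB _) (fun x _ => hre x)
      (fun x _ => him x) h1 h2
  · exact PhragmenLindelof.quadrant_III hf.diffContOnCl (hB _) (fun x _ => hre x)
      (fun x _ => him x) h1 h2

theorem norm_dslope_zero_le {E : Type*} [NormedAddCommGroup E] [NormedSpace ℂ E] {f : ℂ → E}
    {z : ℂ} : ‖dslope f 0 z‖ * ‖z‖ ≤ ‖f z‖ + ‖f 0‖ := by
  have := sub_smul_dslope f 0 z
  rw [sub_zero] at this
  rw [mul_comm, ← norm_smul, this]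
  exact norm_sub_le _ _

/-- An entire function of exponential type with polynomial growth on the two diagonals which
tends to `0` along one of the four half-diagonals vanishes identically. -/
theorem eq_zero_of_growth_on_diagonals (N : ℕ) {H : ℂ → ℂ} (hH : Differentiable ℂ H)
    (hexp : ∃ A, ∀ z, ‖H z‖ ≤ A * Real.exp (A * ‖z‖))
    (hray : ∃ C, ∀ z : ℂ, |z.re| = |z.im| → ‖H z‖ ≤ C * (1 + ‖z‖) ^ N)
    (hlim : Tendsto (fun t : ℝ => H (t * (1 - Complex.I))) atTop (𝓝 0)) : ∀ z, H z = 0 := by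
  induction N generalizing H with
  | zero =>
    obtain ⟨A, hA⟩ := hexp
    obtain ⟨C, hC⟩ := hray
    have hA0 : 0 ≤ A := by
      by_contra hneg
      have h0 := (norm_nonneg _).trans (hA 0)
      simp at h0
      exact hneg h0
    have hbd : ∀ z, ‖H ((1 + Complex.I) * z)‖ ≤ C := by
      refine norm_le_of_bounded_on_axes (A := 2 * A)
        (f := fun z => H ((1 + Complex.I) * z)) (hH.comp (by fun_prop)) ?_ ?_ ?_
      · intro z
        refine (hA _).trans ?_
        have h1 : ‖(1 + Complex.I) * z‖ ≤ 2 * ‖z‖ := by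
          rw [norm_mul]
          gcongr
          calc ‖(1 + Complex.I)‖ ≤ ‖(1:ℂ)‖ + ‖Complex.I‖ := norm_add_le _ _
            _ = 2 := by norm_num
        have h2 : A * ‖(1 + Complex.I) * z‖ ≤ 2 * A * ‖z‖ := by nlinarith
        gcongr
        linarith
      · intro x
        simpa using hC ((1 + Complex.I) * x) (by simp)
      · intro x
        simpa using hC ((1 + Complex.I) * (x * Complex.I)) (by simp)
    have hconst : ∀ z w, H z = H w := by
      refine fun z w => hH.apply_eq_apply_of_bounded ?_ z w
      rw [isBounded_iff_forall_norm_le]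
      refine ⟨C, ?_⟩
      rintro _ ⟨z, rfl⟩
      have h1 : (1 + Complex.I) ≠ 0 := by
        intro h
        simpa using congrArg Complex.re h
      have := hbd ((1 + Complex.I)⁻¹ * z)
      rwa [mul_inv_cancel_left₀ h1] at this
    intro z
    have : (fun t : ℝ => H (t * (1 - Complex.I))) = fun _ => H z := funext fun t => hconst _ _
    rw [this] at hlim
    exact tendsto_nhds_unique tendsto_const_nhds hlim
  | succ N ih =>
    obtain ⟨A, hA⟩ := hexp
    obtain ⟨C, hC⟩ := hray
    set D := dslope H 0 with hD
    have hDd : Differentiable ℂ D := by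
      rw [← differentiableOn_univ] at hH ⊢
      exact (Complex.differentiableOn_dslope univ_mem).2 hH
    obtain ⟨M, hM⟩ := (isCompact_closedBall (0 : ℂ) 1).exists_bound_of_continuousOn
      hDd.continuous.continuousOn
    have hM' : ∀ z : ℂ, ‖z‖ < 1 → ‖D z‖ ≤ M := fun z hz => hM z (by simpa using hz.le)
    have hM0 : 0 ≤ M := (norm_nonneg _).trans (hM 0 (by simp))
    have hA0 : 0 ≤ A := by
      have h0 := (norm_nonneg _).trans (hA 0)
      simpa using h0
    have hC0 : 0 ≤ C := by
      have h0 := (norm_nonneg _).trans (hC 0 (by simp))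
      simpa using h0
    have hbig : ∀ z : ℂ, 1 ≤ ‖z‖ → ‖D z‖ ≤ (‖H z‖ + ‖H 0‖) / ‖z‖ := fun z hz => by
      rw [le_div_iff₀ (by linarith)]
      exact norm_dslope_zero_le
    have hDz : ∀ z, D z = 0 := by
      refine ih hDd ⟨max M (2 * A), fun z => ?_⟩ ⟨max M (C * 2 + ‖H 0‖), fun z hz => ?_⟩ ?_
      · have hmax : 0 ≤ max M (2 * A) := hM0.trans (le_max_left _ _)
        rcases lt_or_ge ‖z‖ 1 with h | h
        · calc ‖D z‖ ≤ M * 1 := by simpa using hM' z h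
            _ ≤ _ := by
              gcongr
              · exact le_max_left _ _
              · exact Real.one_le_exp (by positivity)
        · calc ‖D z‖ ≤ (‖H z‖ + ‖H 0‖) / ‖z‖ := hbig z h
            _ ≤ ‖H z‖ + ‖H 0‖ := div_le_self (by positivity) h
            _ ≤ A * Real.exp (A * ‖z‖) + A * Real.exp (A * ‖z‖) := by
              refine add_le_add (hA z) ((hA 0).trans ?_)
              gcongr
              simp
            _ = (2 * A) * Real.exp (A * ‖z‖) := by ring
            _ ≤ _ := by
              gcongr
              · exact le_max_right _ _
              · exact le_trans (by linarith) (le_max_right _ _)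
      · have h1 : 1 ≤ (1 + ‖z‖) ^ N := one_le_pow₀ (by linarith [norm_nonneg z])
        rcases lt_or_ge ‖z‖ 1 with h | h
        · calc ‖D z‖ ≤ M * 1 := by simpa using hM' z h
            _ ≤ _ := by
              gcongr
              exact le_max_left _ _
        · have hzpos : 0 < ‖z‖ := by linarith
          calc ‖D z‖ ≤ (‖H z‖ + ‖H 0‖) / ‖z‖ := hbig z h
            _ ≤ (C * (1 + ‖z‖) ^ (N + 1) + ‖H 0‖) / ‖z‖ := by
              gcongr
              exact hC z hz
            _ = C * (1 + ‖z‖) ^ N * ((1 + ‖z‖) / ‖z‖) + ‖H 0‖ / ‖z‖ := by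
              field_simp
              try ring
            _ ≤ C * (1 + ‖z‖) ^ N * 2 + ‖H 0‖ * (1 + ‖z‖) ^ N := by
              gcongr
              · rw [div_le_iff₀ hzpos]; linarith
              · exact (div_le_self (norm_nonneg _) h).trans
                  (le_mul_of_one_le_right (norm_nonneg _) h1)
            _ = (C * 2 + ‖H 0‖) * (1 + ‖z‖) ^ N := by ring
            _ ≤ _ := by
              gcongr
              exact le_max_right _ _
      · have hnorm : ∀ t : ℝ, 1 ≤ t → t ≤ ‖(t : ℂ) * (1 - Complex.I)‖ := fun t ht => by
          have := Complex.abs_re_le_norm ((t : ℂ) * (1 - Complex.I))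
          simp at this
          rw [norm_mul]
          simp
          exact (le_abs_self t).trans this
        have hlim2 : Tendsto (fun t : ℝ => ‖H (t * (1 - Complex.I))‖ + ‖H 0‖ / t) atTop (𝓝 0) := by
          have := hlim.norm.add (tendsto_const_nhds (x := ‖H 0‖).div_atTop tendsto_id)
          simpa using this
        refine squeeze_zero_norm' ?_ hlim2
        filter_upwards [eventually_ge_atTop 1] with t ht
        have h2 := hnorm t ht
        refine (hbig _ (ht.trans h2)).trans ?_
        rw [add_div]
        gcongr
        exact div_le_self (norm_nonneg _) (ht.trans h2)
    have hconst : ∀ z, H z = H 0 := fun z => by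
      have := sub_smul_dslope H 0 z
      rw [← hD, hDz, smul_zero] at this
      exact (sub_eq_zero.1 this.symm)
    intro z
    have : (fun t : ℝ => H (t * (1 - Complex.I))) = fun _ => H z :=
      funext fun t => (hconst _).trans (hconst z).symm
    rw [this] at hlim
    exact tendsto_nhds_unique tendsto_const_nhds hlim

/-- If the zeros of `D` are, with multiplicity, zeros of `F`, then `F / D` is entire. -/
theorem exists_entire_quotient {F D : ℂ → ℂ} (hD : Differentiable ℂ D) {z₀ : ℂ} (hz₀ : D z₀ ≠ 0)
    (hdiv : ∀ (a : ℂ) (m : ℕ) (h : ℂ → ℂ), ContinuousAt h a →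
      (∀ᶠ z in 𝓝 a, D z = (z - a) ^ m * h z) →
      ∃ k : ℂ → ℂ, Differentiable ℂ k ∧ ∀ z, F z = (z - a) ^ m * k z) :
    ∃ H : ℂ → ℂ, Differentiable ℂ H ∧ ∀ z, F z = H z * D z := by
  have hDA : AnalyticOnNhd ℂ D univ := fun z _ => hD.analyticAt z
  have hF : Differentiable ℂ F := by
    obtain ⟨k, hk, hFk⟩ := hdiv 0 0 D hD.continuous.continuousAt (by simp)
    have : F = k := by ext z; simpa using hFk z
    rwa [this]
  have hloc : ∀ a, ∃ k h : ℂ → ℂ, AnalyticAt ℂ k a ∧ AnalyticAt ℂ h a ∧ h a ≠ 0 ∧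
      ∀ᶠ z in 𝓝 a, ∃ m : ℕ, D z = (z - a) ^ m * h z ∧ F z = (z - a) ^ m * k z := by
    intro a
    have hord : analyticOrderAt D a ≠ ⊤ := by
      intro htop
      rw [analyticOrderAt_eq_top] at htop
      exact hz₀ (hDA.eqOn_zero_of_preconnected_of_eventuallyEq_zero isPreconnected_univ
        (mem_univ a) htop (mem_univ z₀))
    obtain ⟨h, hh, hha, hDh⟩ := (hD.analyticAt a).analyticOrderAt_ne_top.1 hord
    obtain ⟨k, hk, hFk⟩ := hdiv a _ h hh.continuousAt
      (hDh.mono fun z hz => by simpa using hz)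
    refine ⟨k, h, hk.analyticAt a, hh, hha, ?_⟩
    filter_upwards [hDh] with z hz
    exact ⟨_, by simpa using hz, hFk z⟩
  set H : ℂ → ℂ := fun a => limUnder (𝓝[≠] a) fun z => F z / D z with hH
  have hval : ∀ a, D a ≠ 0 → H a = F a / D a := fun a ha => by
    have : ContinuousAt (fun z => F z / D z) a :=
      hF.continuous.continuousAt.div hD.continuous.continuousAt ha
    exact (this.tendsto.mono_left nhdsWithin_le_nhds).limUnder_eq
  have hHk : ∀ a, ∃ k h : ℂ → ℂ, AnalyticAt ℂ k a ∧ AnalyticAt ℂ h a ∧ h a ≠ 0 ∧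
      H =ᶠ[𝓝 a] fun z => k z / h z := by
    intro a
    obtain ⟨k, h, hk, hh, hha, hev⟩ := hloc a
    refine ⟨k, h, hk, hh, hha, ?_⟩
    have hne : ∀ᶠ z in 𝓝 a, z ≠ a → D z ≠ 0 ∧ F z / D z = k z / h z := by
      filter_upwards [hev, hh.continuousAt.eventually_ne hha] with z hz hhz hza
      obtain ⟨m, h1, h2⟩ := hz
      have : (z - a) ^ m ≠ 0 := pow_ne_zero _ (sub_ne_zero.2 hza)
      rw [h1, h2]
      exact ⟨mul_ne_zero this hhz, mul_div_mul_left _ _ this⟩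
    filter_upwards [hne] with z hz
    by_cases hza : z = a
    · subst hza
      have hc : ContinuousAt (fun z => k z / h z) z := hk.continuousAt.div hh.continuousAt hha
      refine Tendsto.limUnder_eq ((hc.tendsto.mono_left nhdsWithin_le_nhds).congr' ?_)
      filter_upwards [nhdsWithin_le_nhds hne, self_mem_nhdsWithin] with w hw hwz
      exact (hw hwz).2.symm
    · rw [hval z (hz hza).1, (hz hza).2]
  have hHd : Differentiable ℂ H := fun a => by
    obtain ⟨k, h, hk, hh, hha, hev⟩ := hHk a
    exact (hk.differentiableAt.div hh.differentiableAt hha).congr_of_eventuallyEq hev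
  refine ⟨H, hHd, ?_⟩
  have hset : D ⁻¹' {0}ᶜ ∈ codiscrete ℂ :=
    AnalyticOnNhd.preimage_zero_mem_codiscrete hDA hz₀
  intro a
  by_cases ha : D a = 0
  · have h1 : F a = 0 := by
      obtain ⟨k, h, hk, hh, hha, hev⟩ := hloc a
      obtain ⟨m, h1, h2⟩ := hev.self_of_nhds
      rcases Nat.eq_zero_or_pos m with rfl | hm
      · rw [ha] at h1; simp at h1; exact absurd h1.symm hha
      · rw [h2, sub_self, zero_pow hm.ne', zero_mul]
    rw [h1, ha, mul_zero]
  · rw [hval a ha, div_mul_cancel₀ _ ha]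

section Chains

variable {X Y : Type*} [NormedAddCommGroup X] [NormedSpace ℂ X] [NormedAddCommGroup Y]
  [NormedSpace ℂ Y]

theorem pencil_dslope {A B : X →L[ℂ] Y} {g : ℂ → X} (hg : Differentiable ℂ g) {p : Y}
    (h : ∀ z, A (g z) = z • B (g z) + p) (a z : ℂ) :
    A (dslope g a z) = z • B (dslope g a z) + B (g a) := by
  have hcont : Continuous (dslope g a) :=
    continuous_iff_continuousAt.2 fun w => by
      rcases eq_or_ne w a with rfl | hw
      · exact continuousAt_dslope_same.2 (hg w)
      · exact (continuousAt_dslope_of_ne hw).2 (hg w).continuousAt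
  have hoff : ∀ w, w ≠ a → A (dslope g a w) = w • B (dslope g a w) + B (g a) := by
    intro w hw
    have hw' : w - a ≠ 0 := sub_ne_zero.2 hw
    have key : (w - a) • A (dslope g a w) = (w - a) • (w • B (dslope g a w) + B (g a)) := by
      rw [smul_add, smul_comm, ← map_smul, ← map_smul, sub_smul_dslope, map_sub, map_sub, h, h,
        smul_sub, sub_smul]
      abel
    exact smul_right_injective Y hw' key
  rcases eq_or_ne z a with rfl | hz
  · have h1 : Continuous fun w => A (dslope g z w) := A.continuous.comp hcont
    have h2 : Continuous fun w => w • B (dslope g z w) + B (g z) :=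
      (continuous_id.smul (B.continuous.comp hcont)).add continuous_const
    exact congr_fun (Continuous.ext_on (dense_compl_singleton z) h1 h2 fun w hw => hoff w hw) z
  · exact hoff z hz

theorem differentiable_dslope [CompleteSpace X] {g : ℂ → X} (hg : Differentiable ℂ g) (a : ℂ) :
    Differentiable ℂ (dslope g a) :=
  differentiableOn_univ.1 ((Complex.differentiableOn_dslope univ_mem).2 hg.differentiableOn)

theorem functional_dslope_eventuallyEq {U : X →L[ℂ] ℂ} {g : ℂ → X} {a : ℂ}
    (hg : DifferentiableAt ℂ g a) {h : ℂ → ℂ} (hh : ContinuousAt h a) {m : ℕ}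
    (hU : ∀ᶠ z in 𝓝 a, U (g z) = (z - a) ^ (m + 1) * h z) :
    ∀ᶠ z in 𝓝 a, U (dslope g a z) = (z - a) ^ m * h z := by
  have h1 : ContinuousAt (fun z => U (dslope g a z)) a :=
    U.continuous.continuousAt.comp (continuousAt_dslope_same.2 hg)
  have h2 : ContinuousAt (fun z => (z - a) ^ m * h z) a := by fun_prop
  refine (h1.eventuallyEq_nhds_iff_eventuallyEq_nhdsNE h2).1 ?_
  have h0 : U (g a) = 0 := by simpa using hU.self_of_nhds
  filter_upwards [hU.filter_mono nhdsWithin_le_nhds, self_mem_nhdsWithin] with z hz hza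
  have hza' : z - a ≠ 0 := sub_ne_zero.2 hza
  have : (z - a) * U (dslope g a z) = (z - a) * ((z - a) ^ m * h z) := by
    rw [← smul_eq_mul, ← map_smul, sub_smul_dslope, map_sub, hz, h0]
    ring
  exact mul_left_cancel₀ hza' this

theorem functional_chain_eq_zero {A B : X →L[ℂ] Y} {U₁ U₂ L : X →L[ℂ] ℂ} {a : ℂ}
    (hL : ∀ (m : ℕ) (u : ℕ → X), u 0 ≠ 0 → (∀ k ≤ m, U₁ (u k) = 0 ∧ U₂ (u k) = 0) →
      A (u 0) = a • B (u 0) → (∀ k, A (u (k + 1)) = a • B (u (k + 1)) + B (u k)) →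
      ∀ k ≤ m, L (u k) = 0) (m : ℕ) : ∀ u : ℕ → X,
    (∀ k < m, U₁ (u k) = 0 ∧ U₂ (u k) = 0) → A (u 0) = a • B (u 0) →
      (∀ k, A (u (k + 1)) = a • B (u (k + 1)) + B (u k)) → ∀ k < m, L (u k) = 0 := by
  induction m with
  | zero => intro u _ _ _ k hk; omega
  | succ m ih =>
    intro u hU h0 hs k hk
    by_cases hu : u 0 = 0
    · cases k with
      | zero => rw [hu, map_zero]
      | succ k =>
        refine ih (fun j => u (j + 1)) (fun j hj => hU _ (by omega)) ?_ (fun j => hs _) k (by omega)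
        rw [hs 0, hu, map_zero, add_zero]
    · exact hL m u hu (fun j hj => hU j (by omega)) h0 hs k (by omega)

theorem exists_eq_pow_mul_functional [CompleteSpace X] {A B : X →L[ℂ] Y} {U₁ U₂ L : X →L[ℂ] ℂ}
    {w : ℂ → X} (hw : Differentiable ℂ w) (hAB : ∀ z, A (w z) = z • B (w z)) {D : ℂ → ℂ}
    {κ₁ κ₂ : ℂ} (hU₁ : ∀ z, U₁ (w z) = κ₁ * D z) (hU₂ : ∀ z, U₂ (w z) = κ₂ * D z)
    (hL : ∀ (a : ℂ) (m : ℕ) (u : ℕ → X), u 0 ≠ 0 → (∀ k ≤ m, U₁ (u k) = 0 ∧ U₂ (u k) = 0) →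
      A (u 0) = a • B (u 0) → (∀ k, A (u (k + 1)) = a • B (u (k + 1)) + B (u k)) →
      ∀ k ≤ m, L (u k) = 0)
    (a : ℂ) (m : ℕ) (h : ℂ → ℂ) (hh : ContinuousAt h a)
    (hD : ∀ᶠ z in 𝓝 a, D z = (z - a) ^ m * h z) :
    ∃ k : ℂ → ℂ, Differentiable ℂ k ∧ ∀ z, L (w z) = (z - a) ^ m * k z := by
  let g : ℕ → ℂ → X := fun k => Nat.rec w (fun _ f => dslope f a) k
  have hg0 : g 0 = w := rfl
  have hgs : ∀ k, g (k + 1) = dslope (g k) a := fun k => rfl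
  have hgd : ∀ k, Differentiable ℂ (g k) := fun k => by
    induction k with
    | zero => exact hw
    | succ k ih => exact differentiable_dslope ih a
  have hchain : ∀ k z, A (g (k + 1) z) = z • B (g (k + 1) z) + B (g k a) := fun k => by
    induction k with
    | zero => exact pencil_dslope hw (p := 0) (by simpa using hAB) a
    | succ k ih => exact pencil_dslope (hgd (k + 1)) ih a
  have hUg : ∀ (U : X →L[ℂ] ℂ) (κ : ℂ), (∀ z, U (w z) = κ * D z) → ∀ k < m, U (g k a) = 0 := by
    intro U κ hU
    have hκ : ContinuousAt (fun z => κ * h z) a := by fun_prop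
    have : ∀ k j, k + j = m → ∀ᶠ z in 𝓝 a, U (g k z) = (z - a) ^ j * (κ * h z) := by
      intro k
      induction k with
      | zero =>
        intro j hj
        filter_upwards [hD] with z hz
        rw [hg0, hU, hz, show j = m by omega]
        ring
      | succ k ih =>
        intro j hj
        exact functional_dslope_eventuallyEq (hgd k a) hκ (ih (j + 1) (by omega))
    intro k hk
    have := (this k (m - k) (by omega)).self_of_nhds
    rwa [sub_self, zero_pow (by omega), zero_mul] at this
  have hLg := functional_chain_eq_zero (hL a) m (fun k => g k a)
    (fun k hk => ⟨hUg U₁ κ₁ hU₁ k hk, hUg U₂ κ₂ hU₂ k hk⟩) (hAB a) (fun k => hchain k a)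
  refine ⟨fun z => L (g m z), L.differentiable.comp (hgd m), ?_⟩
  have : ∀ k ≤ m, ∀ z, L (w z) = (z - a) ^ k * L (g k z) := by
    intro k
    induction k with
    | zero => intro _ z; simp [hg0]
    | succ k ih =>
      intro hk z
      have h1 : g k z = g k a + (z - a) • g (k + 1) z := by
        rw [hgs, sub_smul_dslope]; abel
      rw [ih (by omega), h1, map_add, hLg k (by omega), map_smul, smul_eq_mul]
      ring
  exact this m le_rfl

end Chains

section Pencil

variable {R : Type*} [NormedRing R] [CompleteSpace R]

theorem isUnit_one_sub_of_norm_pow_lt_one {T : R} {N : ℕ} (h : ‖T ^ N‖ < 1) :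
    IsUnit (1 - T) := by
  have hu : IsUnit (1 - T ^ N) := isUnit_one_sub_of_norm_lt_one h
  rw [← mul_neg_geom_sum] at hu
  have hcomm : Commute (1 - T) (∑ i ∈ Finset.range N, T ^ i) :=
    Commute.sum_right _ _ _ fun i _ =>
      ((Commute.one_left _).sub_left (Commute.refl _)).pow_right i
  exact (hcomm.isUnit_mul_iff.1 hu).1

theorem differentiable_inverse_pencil [NormedAlgebra ℂ R] {S T : R}
    (h : ∀ z : ℂ, IsUnit (1 - (S + z • T))) :
    Differentiable ℂ fun z : ℂ => Ring.inverse (1 - (S + z • T)) := fun z => by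
  have h1 : DifferentiableAt ℂ (fun z : ℂ => 1 - (S + z • T)) z := by fun_prop
  exact (differentiableAt_inverse (𝕜 := ℂ) (h z)).comp z h1

end Pencil

section Volterra

variable {V : Type*} [NormedAddCommGroup V]

/-- Constant extension of a continuous function on `[0,1]` to the real line. -/
def extendIcc (y : C(unitInterval, V)) (t : ℝ) : V := y (projIcc 0 1 zero_le_one t)

theorem continuous_extendIcc (y : C(unitInterval, V)) : Continuous (extendIcc y) :=
  y.continuous.comp continuous_projIcc

theorem norm_extendIcc_le (y : C(unitInterval, V)) (t : ℝ) : ‖extendIcc y t‖ ≤ ‖y‖ :=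
  y.norm_coe_le_norm _

theorem extendIcc_of_mem (y : C(unitInterval, V)) {t : ℝ} (ht : t ∈ Icc (0 : ℝ) 1) :
    extendIcc y t = y ⟨t, ht⟩ := by
  rw [extendIcc, projIcc_of_mem]

variable [NormedSpace ℂ V]

theorem continuous_volterra_integrand (a : C(ℝ, V →L[ℂ] V)) (y : C(unitInterval, V)) :
    Continuous fun t => a t (extendIcc y t) :=
  a.continuous.clm_apply (continuous_extendIcc y)

/-- The continuous functions on `[0,1]` with constant values, as a linear map. -/
def constMap (V : Type*) [NormedAddCommGroup V] [NormedSpace ℂ V] :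
    V →L[ℂ] C(unitInterval, V) :=
  LinearMap.mkContinuous
    { toFun := ContinuousMap.const _
      map_add' := fun _ _ => rfl
      map_smul' := fun _ _ => rfl } 1 fun v => by
    rw [one_mul]
    exact (ContinuousMap.norm_le _ (norm_nonneg _)).2 fun _ => le_rfl

@[simp] theorem constMap_apply (v : V) (x : unitInterval) : constMap V v x = v := rfl

variable [CompleteSpace V]

theorem hasDerivAt_volterra_integral (a : C(ℝ, V →L[ℂ] V)) (y : C(unitInterval, V)) (x : ℝ) :
    HasDerivAt (fun x => ∫ t in (0 : ℝ)..x, a t (extendIcc y t)) (a x (extendIcc y x)) x :=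
  (continuous_volterra_integrand a y).integral_hasStrictDerivAt 0 x |>.hasDerivAt

/-- The Volterra operator as a linear map. -/
def volterraLinear (a : C(ℝ, V →L[ℂ] V)) : C(unitInterval, V) →ₗ[ℂ] C(unitInterval, V) where
  toFun y := ⟨fun x => ∫ t in (0 : ℝ)..x, a t (extendIcc y t),
    (continuous_iff_continuousAt.2 fun x =>
      (hasDerivAt_volterra_integral a y x).continuousAt).comp continuous_subtype_val⟩
  map_add' y z := by
    ext x
    simp only [ContinuousMap.coe_mk, ContinuousMap.add_apply]
    rw [← intervalIntegral.integral_add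
      ((continuous_volterra_integrand a y).intervalIntegrable _ _)
      ((continuous_volterra_integrand a z).intervalIntegrable _ _)]
    exact intervalIntegral.integral_congr fun t _ => by simp [extendIcc]
  map_smul' c y := by
    ext x
    simp only [ContinuousMap.coe_mk, ContinuousMap.smul_apply, RingHom.id_apply]
    rw [← intervalIntegral.integral_smul]
    exact intervalIntegral.integral_congr fun t _ => by simp [extendIcc]

theorem exists_norm_le_on_unitInterval {E : Type*} [SeminormedAddCommGroup E] {f : ℝ → E}
    (hf : ContinuousOn f (Icc 0 1)) : ∃ C, 0 ≤ C ∧ ∀ t ∈ Icc (0 : ℝ) 1, ‖f t‖ ≤ C := by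
  obtain ⟨C, hC⟩ := isCompact_Icc.exists_bound_of_continuousOn hf
  exact ⟨C, (norm_nonneg _).trans (hC 0 (by simp)), hC⟩

theorem norm_volterraLinear_iterate_le (a : C(ℝ, V →L[ℂ] V)) {C : ℝ}
    (hC : ∀ t ∈ Icc (0 : ℝ) 1, ‖a t‖ ≤ C) (y : C(unitInterval, V)) (n : ℕ) :
    ∀ x : unitInterval, ‖((volterraLinear a)^[n] y) x‖ ≤ (C * x) ^ n / n.factorial * ‖y‖ := by
  have hC0 : 0 ≤ C := (norm_nonneg _).trans (hC 0 (by simp))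
  induction n with
  | zero => intro x; simpa using y.norm_coe_le_norm x
  | succ n ih =>
    intro x
    rw [Function.iterate_succ_apply']
    have hi : IntervalIntegrable (fun t : ℝ => C * ((C * t) ^ n / n.factorial * ‖y‖)) volume 0 x :=
      Continuous.intervalIntegrable (by fun_prop) _ _
    have h1 := intervalIntegral.norm_integral_le_of_norm_le
      (f := fun t => a t (extendIcc ((volterraLinear a)^[n] y) t)) x.2.1
      (Eventually.of_forall fun t ht => ?_) hi
    · refine h1.trans (le_of_eq ?_)
      have : ∀ t : ℝ, C * ((C * t) ^ n / n.factorial * ‖y‖)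
          = (C ^ (n + 1) / n.factorial * ‖y‖) * t ^ n := fun t => by
        rw [mul_pow]; ring
      simp only [this]
      rw [intervalIntegral.integral_const_mul, integral_pow, Nat.factorial_succ, mul_pow]
      push_cast
      field_simp
      simp
    · have ht' : t ∈ Icc (0 : ℝ) 1 := ⟨ht.1.le, ht.2.trans x.2.2⟩
      rw [extendIcc_of_mem _ ht']
      refine ((a t).le_opNorm _).trans (mul_le_mul (hC t ht') (ih ⟨t, ht'⟩) (norm_nonneg _) hC0)

/-- The Volterra operator `y ↦ ∫₀ˣ a(t) y(t) dt`. -/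
def volterra (a : C(ℝ, V →L[ℂ] V)) : C(unitInterval, V) →L[ℂ] C(unitInterval, V) :=
  (volterraLinear a).mkContinuousOfExistsBound <| by
    obtain ⟨C, hC0, hC⟩ := exists_norm_le_on_unitInterval a.continuous.continuousOn
    refine ⟨C, fun y => (ContinuousMap.norm_le _ (by positivity)).2 fun x => ?_⟩
    refine (norm_volterraLinear_iterate_le a hC y 1 x).trans ?_
    simp only [pow_one, Nat.factorial_one, Nat.cast_one, div_one]
    gcongr
    exact mul_le_of_le_one_right hC0 x.2.2

theorem volterra_apply (a : C(ℝ, V →L[ℂ] V)) (y : C(unitInterval, V)) (x : unitInterval) :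
    volterra a y x = ∫ t in (0 : ℝ)..x, a t (extendIcc y t) := rfl

theorem volterra_add_smul (a b : C(ℝ, V →L[ℂ] V)) (z : ℂ) :
    volterra (a + z • b) = volterra a + z • volterra b := by
  ext1 y
  ext1 x
  simp only [add_apply, smul_apply, ContinuousMap.add_apply, ContinuousMap.smul_apply,
    volterra_apply]
  rw [← intervalIntegral.integral_smul]
  exact intervalIntegral.integral_add
    ((continuous_volterra_integrand a y).intervalIntegrable _ _)
    (((continuous_volterra_integrand b y).const_smul z).intervalIntegrable _ _)

theorem isUnit_one_sub_volterra (a : C(ℝ, V →L[ℂ] V)) : IsUnit (1 - volterra a) := by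
  obtain ⟨C, hC0, hC⟩ := exists_norm_le_on_unitInterval a.continuous.continuousOn
  have hn : ∀ n, ‖volterra a ^ n‖ ≤ C ^ n / n.factorial := fun n => by
    refine ContinuousLinearMap.opNorm_le_bound _ (by positivity) fun y =>
      (ContinuousMap.norm_le _ (by positivity)).2 fun x => ?_
    rw [pow_apply_eq_iterate]
    refine (norm_volterraLinear_iterate_le a hC y n x).trans ?_
    gcongr
    · exact mul_nonneg hC0 x.2.1
    · exact mul_le_of_le_one_right hC0 x.2.2
  obtain ⟨N, hN⟩ := ((FloorSemiring.tendsto_pow_div_factorial_atTop C).eventually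
    (gt_mem_nhds zero_lt_one)).exists
  exact isUnit_one_sub_of_norm_pow_lt_one
    (R := C(unitInterval, V) →L[ℂ] C(unitInterval, V)) ((hn N).trans_lt hN)

/-- The solution of `y' = (a + z b) y`, `y 0 = c`, as an element of `C([0,1])`. -/
def volterraSolution (a b : C(ℝ, V →L[ℂ] V)) (c : V) (z : ℂ) : C(unitInterval, V) :=
  Ring.inverse (1 - (volterra a + z • volterra b)) (constMap V c)

theorem isUnit_volterra_pencil (a b : C(ℝ, V →L[ℂ] V)) (z : ℂ) :
    IsUnit (1 - (volterra a + z • volterra b)) := by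
  rw [← volterra_add_smul]
  exact isUnit_one_sub_volterra _

theorem differentiable_volterraSolution (a b : C(ℝ, V →L[ℂ] V)) (c : V) :
    Differentiable ℂ (volterraSolution a b c) := by
  have := differentiable_inverse_pencil (R := C(unitInterval, V) →L[ℂ] C(unitInterval, V))
    (isUnit_volterra_pencil a b)
  exact fun z => (this z).clm_apply (differentiableAt_const _)

theorem volterraSolution_eq (a b : C(ℝ, V →L[ℂ] V)) (c : V) (z : ℂ) :
    volterraSolution a b c z
      = constMap V c + volterra (a + z • b) (volterraSolution a b c z) := by
  have := congrArg (fun T => T (constMap V c))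
    (Ring.mul_inverse_cancel _ (isUnit_volterra_pencil a b z))
  rw [← volterra_add_smul] at this
  simp only [mul_apply_eq_comp, sub_apply, one_apply_eq_self] at this
  rw [sub_eq_iff_eq_add] at this
  rw [volterraSolution, ← volterra_add_smul]
  exact this

theorem extendIcc_eq_add_integral {a : C(ℝ, V →L[ℂ] V)} {y : C(unitInterval, V)} {c : V}
    (h : y = constMap V c + volterra a y) {x : ℝ} (hx : x ∈ Icc (0 : ℝ) 1) :
    extendIcc y x = c + ∫ t in (0 : ℝ)..x, a t (extendIcc y t) := by
  rw [extendIcc_of_mem y hx]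
  conv_lhs => rw [h]
  rfl

end Volterra

section Estimates

/-- `(y₁, y₂)` solves `y₁' = p y₁ + u y₂`, `y₂' = q y₂ + v y₁` on `[0,1]`. -/
def IsSol (p q : ℂ) (u v y₁ y₂ : ℝ → ℂ) : Prop :=
  ∀ x ∈ Icc (0 : ℝ) 1, HasDerivAt y₁ (p * y₁ x + u x * y₂ x) x ∧
    HasDerivAt y₂ (q * y₂ x + v x * y₁ x) x

theorem hasDerivAt_exp_mul_ofReal (p : ℂ) (x : ℝ) :
    HasDerivAt (fun x : ℝ => Complex.exp (p * x)) (p * Complex.exp (p * x)) x := by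
  have h := (((hasDerivAt_id (x : ℂ)).const_mul p).cexp).comp_ofReal
  simpa [mul_comm] using h

namespace IsSol

variable {p q : ℂ} {u v y₁ y₂ w₁ w₂ : ℝ → ℂ}

theorem swap (h : IsSol p q u v y₁ y₂) : IsSol q p v u y₂ y₁ := fun x hx => (h x hx).symm

theorem reflect (h : IsSol p q u v y₁ y₂) :
    IsSol (-q) (-p) (fun x => -v (1 - x)) (fun x => -u (1 - x)) (fun x => y₂ (1 - x))
      (fun x => y₁ (1 - x)) := by
  intro x hx
  have hx' : 1 - x ∈ Icc (0 : ℝ) 1 := ⟨by linarith [hx.2], by linarith [hx.1]⟩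
  have hs : HasDerivAt (fun x : ℝ => 1 - x) (-1) x := (hasDerivAt_id x).const_sub 1
  obtain ⟨h1, h2⟩ := h _ hx'
  constructor
  · refine (h2.scomp x hs).congr_deriv ?_
    rw [neg_one_smul]
    ring
  · refine (h1.scomp x hs).congr_deriv ?_
    rw [neg_one_smul]
    ring

theorem exp_mul (h : IsSol p q u v y₁ y₂) (r : ℂ) :
    IsSol (r + p) (r + q) u v (fun x => Complex.exp (r * x) * y₁ x)
      (fun x => Complex.exp (r * x) * y₂ x) := by
  intro x hx
  obtain ⟨h1, h2⟩ := h x hx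
  have he := hasDerivAt_exp_mul_ofReal r x
  constructor
  · exact (he.mul h1).congr_deriv (by ring)
  · exact (he.mul h2).congr_deriv (by ring)

theorem add_mul (h : IsSol p q u v y₁ y₂) (h' : IsSol p q u v w₁ w₂) (c d : ℂ) :
    IsSol p q u v (fun x => c * y₁ x + d * w₁ x) (fun x => c * y₂ x + d * w₂ x) := by
  intro x hx
  obtain ⟨h1, h2⟩ := h x hx
  obtain ⟨h3, h4⟩ := h' x hx
  constructor
  · exact ((h1.const_mul c).add (h3.const_mul d)).congr_deriv (by ring)
  · exact ((h2.const_mul c).add (h4.const_mul d)).congr_deriv (by ring)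

theorem wronskian (h : IsSol p q u v y₁ y₂) (h' : IsSol p q u v w₁ w₂) {x : ℝ}
    (hx : x ∈ Icc (0 : ℝ) 1) :
    y₁ x * w₂ x - y₂ x * w₁ x
      = Complex.exp ((p + q) * x) * (y₁ 0 * w₂ 0 - y₂ 0 * w₁ 0) := by
  have hd : ∀ t ∈ Icc (0 : ℝ) 1, HasDerivAt
      (fun t : ℝ => Complex.exp (-(p + q) * t) * (y₁ t * w₂ t - y₂ t * w₁ t)) 0 t := by
    intro t ht
    obtain ⟨h1, h2⟩ := h t ht
    obtain ⟨h3, h4⟩ := h' t ht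
    exact ((hasDerivAt_exp_mul_ofReal (-(p + q)) t).mul ((h1.mul h4).sub (h2.mul h3))).congr_deriv
      (by
      simp only [Pi.sub_apply, Pi.mul_apply]
      ring)
  have hc := constant_of_has_deriv_right_zero
    (fun t ht => (hd t ht).continuousAt.continuousWithinAt)
    (fun t ht => (hd t (Ico_subset_Icc_self ht)).hasDerivWithinAt) x hx
  simp only [Complex.ofReal_zero, mul_zero, Complex.exp_zero, one_mul] at hc
  rw [← hc, ← mul_assoc, ← Complex.exp_add, neg_mul, add_neg_cancel, Complex.exp_zero, one_mul]

end IsSol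

theorem norm_le_of_hasDerivAt_damped {f g : ℝ → ℂ} {κ : ℂ} {G : ℝ} (hκ : 0 < κ.re) (hG : 0 ≤ G)
    (hf : ∀ x ∈ Icc (0 : ℝ) 1, HasDerivAt f (-κ * f x + g x) x)
    (hg : ∀ x ∈ Icc (0 : ℝ) 1, ‖g x‖ ≤ G) {x : ℝ} (hx : x ∈ Icc (0 : ℝ) 1) :
    ‖f x‖ ≤ ‖f 0‖ + G / κ.re := by
  have hd : ∀ t ∈ Icc (0 : ℝ) 1, HasDerivAt (fun t : ℝ => Complex.exp (κ * t) * f t)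
      (Complex.exp (κ * t) * g t) t := by
    intro t ht
    exact ((hasDerivAt_exp_mul_ofReal κ t).mul (hf t ht)).congr_deriv (by ring)
  have hB : ∀ t, HasDerivAt (fun t : ℝ => ‖f 0‖ + G / κ.re * (Real.exp (κ.re * t) - 1))
      (Real.exp (κ.re * t) * G) t := by
    intro t
    have h0 := ((hasDerivAt_id t).const_mul κ.re).exp
    refine (((h0.sub_const 1).const_mul (G / κ.re)).const_add ‖f 0‖).congr_deriv ?_
    simp only [id]
    field_simp
  have hn : ∀ t : ℝ, ‖Complex.exp (κ * t)‖ = Real.exp (κ.re * t) := fun t => by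
    simp [Complex.norm_exp]
  have key := image_norm_le_of_norm_deriv_right_le_deriv_boundary
    (fun t ht => (hd t ht).continuousAt.continuousWithinAt)
    (fun t ht => (hd t (Ico_subset_Icc_self ht)).hasDerivWithinAt) (by simp) hB
    (fun t ht => by
      rw [norm_mul, hn]
      exact mul_le_mul_of_nonneg_left (hg t (Ico_subset_Icc_self ht)) (Real.exp_pos _).le) hx
  rw [norm_mul, hn] at key
  have he : 1 ≤ Real.exp (κ.re * x) := Real.one_le_exp (mul_nonneg hκ.le hx.1)
  refine le_of_mul_le_mul_left (key.trans ?_) (Real.exp_pos (κ.re * x))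
  have h1 : 0 ≤ G / κ.re := by positivity
  nlinarith [norm_nonneg (f 0)]

theorem norm_sub_le_of_hasDerivAt {f g : ℝ → ℂ} {G : ℝ}
    (hf : ∀ x ∈ Icc (0 : ℝ) 1, HasDerivAt f (g x) x)
    (hg : ∀ x ∈ Icc (0 : ℝ) 1, ‖g x‖ ≤ G) {x : ℝ} (hx : x ∈ Icc (0 : ℝ) 1) :
    ‖f x - f 0‖ ≤ G := by
  have hG : 0 ≤ G := (norm_nonneg _).trans (hg 0 (by simp))
  have := norm_image_sub_le_of_norm_deriv_le_segment'
    (fun t ht => (hf t ht).hasDerivWithinAt) (fun t ht => hg t (Ico_subset_Icc_self ht)) x hx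
  refine this.trans ?_
  rw [sub_zero]
  exact mul_le_of_le_one_right hG hx.2

namespace IsSol

variable {p q : ℂ} {u v y₁ y₂ : ℝ → ℂ} {M : ℝ}

theorem bound_of_zero (h : IsSol 0 q u v y₁ y₂) (hu : ∀ x ∈ Icc (0 : ℝ) 1, ‖u x‖ ≤ M)
    (hv : ∀ x ∈ Icc (0 : ℝ) 1, ‖v x‖ ≤ M) (hδ : 2 * M ^ 2 < (-q).re) {x : ℝ}
    (hx : x ∈ Icc (0 : ℝ) 1) :
    ‖y₁ x‖ ≤ 2 * (‖y₁ 0‖ + M * ‖y₂ 0‖) ∧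
      ‖y₂ x‖ ≤ ‖y₂ 0‖ + M * (2 * (‖y₁ 0‖ + M * ‖y₂ 0‖)) / (-q).re ∧
      ‖y₁ x - y₁ 0‖ ≤ M * (‖y₂ 0‖ + M * (2 * (‖y₁ 0‖ + M * ‖y₂ 0‖)) / (-q).re) := by
  have hM : 0 ≤ M := (norm_nonneg _).trans (hu 0 (by simp))
  set δ := (-q).re with hδ'
  have hδ0 : 0 < δ := lt_of_le_of_lt (by positivity) hδ
  obtain ⟨x₀, hx₀, hmax⟩ := isCompact_Icc.exists_isMaxOn (nonempty_Icc.2 zero_le_one)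
    (f := fun x => ‖y₁ x‖) (fun t ht => (h t ht).1.continuousAt.norm.continuousWithinAt)
  set m := ‖y₁ x₀‖ with hm
  have hmax' : ∀ t ∈ Icc (0 : ℝ) 1, ‖y₁ t‖ ≤ m := fun t ht => hmax ht
  have h2 : ∀ t ∈ Icc (0 : ℝ) 1, ‖y₂ t‖ ≤ ‖y₂ 0‖ + M * m / δ := fun t ht =>
    norm_le_of_hasDerivAt_damped (κ := -q) (g := fun s => v s * y₁ s) hδ0 (by positivity)
      (fun s hs => by simpa using (h s hs).2)
      (fun s hs => by
        rw [norm_mul]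
        exact mul_le_mul (hv s hs) (hmax' s hs) (norm_nonneg _) hM) ht
  have h1 : ∀ t ∈ Icc (0 : ℝ) 1, ‖y₁ t - y₁ 0‖ ≤ M * (‖y₂ 0‖ + M * m / δ) := fun t ht =>
    norm_sub_le_of_hasDerivAt (g := fun s => u s * y₂ s)
      (fun s hs => by simpa using (h s hs).1)
      (fun s hs => by
        rw [norm_mul]
        exact mul_le_mul (hu s hs) (h2 s hs) (norm_nonneg _) hM) ht
  have hm2 : m ≤ 2 * (‖y₁ 0‖ + M * ‖y₂ 0‖) := by
    have h3 := h1 x₀ hx₀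
    have h4 := norm_sub_norm_le (y₁ x₀) (y₁ 0)
    have h5 : M * (M * m / δ) ≤ m / 2 := by
      rw [show M * (M * m / δ) = (2 * M ^ 2 / δ) * (m / 2) by ring]
      exact mul_le_of_le_one_left (by positivity) ((div_le_one hδ0).2 hδ.le)
    rw [mul_add] at h3
    linarith
  have h6 : M * m / δ ≤ M * (2 * (‖y₁ 0‖ + M * ‖y₂ 0‖)) / δ := by
    gcongr
  refine ⟨(hmax' x hx).trans hm2, (h2 x hx).trans (by gcongr), (h1 x hx).trans (by gcongr)⟩

end IsSol

end Estimates

section Laplace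

theorem integral_pow_mul_exp_neg_Ioi {δ : ℝ} (hδ : 0 < δ) (j : ℕ) :
    ∫ s in Ioi (0 : ℝ), s ^ j * Real.exp (-(δ * s)) = j.factorial / δ ^ (j + 1) := by
  have := Real.integral_rpow_mul_exp_neg_mul_Ioi (a := j + 1) (by positivity) hδ
  simp only [add_sub_cancel_right, Real.rpow_natCast] at this
  rw [this, Real.Gamma_nat_eq_factorial]
  norm_cast
  rw [one_div, inv_pow, div_eq_inv_mul]

theorem integrableOn_pow_mul_exp_neg {δ : ℝ} (hδ : 0 < δ) (j : ℕ) :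
    IntegrableOn (fun s : ℝ => s ^ j * Real.exp (-(δ * s))) (Ioi 0) :=
  .of_integral_ne_zero (by rw [integral_pow_mul_exp_neg_Ioi hδ]; positivity)

theorem norm_cexp_neg_mul_ofReal (κ : ℂ) (s : ℝ) :
    ‖Complex.exp (-(κ * s))‖ = Real.exp (-(κ.re * s)) := by
  simp [Complex.norm_exp]

theorem integrableOn_pow_mul_cexp_neg {κ : ℂ} (hκ : 0 < κ.re) (j : ℕ) :
    IntegrableOn (fun s : ℝ => (s : ℂ) ^ j * Complex.exp (-(κ * s))) (Ioi 0) := by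
  refine (integrableOn_pow_mul_exp_neg hκ j).mono'
    (by fun_prop : Continuous _).aestronglyMeasurable ?_
  filter_upwards [ae_restrict_mem measurableSet_Ioi] with s hs
  rw [norm_mul, norm_cexp_neg_mul_ofReal, norm_pow, Complex.norm_real, Real.norm_of_nonneg hs.le]

theorem integral_pow_mul_cexp_neg_Ioi {κ : ℂ} (hκ : 0 < κ.re) (j : ℕ) :
    ∫ s in Ioi (0 : ℝ), (s : ℂ) ^ j * Complex.exp (-(κ * s)) = j.factorial / κ ^ (j + 1) := by
  have hκ0 : κ ≠ 0 := by rintro rfl; simp at hκ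
  induction j with
  | zero =>
    have := integral_exp_mul_complex_Ioi (a := -κ) (by simpa using hκ) 0
    simpa using this
  | succ j ih =>
    have hd : ∀ s ∈ Ioi (0 : ℝ), HasDerivAt (fun s : ℝ => (s : ℂ) ^ (j + 1) * Complex.exp (-κ * s))
        ((j + 1) * ((s : ℂ) ^ j * Complex.exp (-(κ * s)))
          - κ * ((s : ℂ) ^ (j + 1) * Complex.exp (-(κ * s)))) s := by
      intro s _
      have h1 : HasDerivAt (fun s : ℝ => (s : ℂ) ^ (j + 1)) ((j + 1) * (s : ℂ) ^ j) s := by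
        simpa using ((hasDerivAt_id (s : ℂ)).pow (j + 1)).comp_ofReal
      refine (h1.mul (hasDerivAt_exp_mul_ofReal (-κ) s)).congr_deriv ?_
      rw [neg_mul]
      ring
    have hi1 := (integrableOn_pow_mul_cexp_neg hκ j).const_mul ((j : ℂ) + 1)
    have hi2 := (integrableOn_pow_mul_cexp_neg hκ (j + 1)).const_mul κ
    have hlim : Tendsto (fun s : ℝ => (s : ℂ) ^ (j + 1) * Complex.exp (-κ * s)) atTop (𝓝 0) := by
      rw [tendsto_zero_iff_norm_tendsto_zero]
      have h := tendsto_rpow_mul_exp_neg_mul_atTop_nhds_zero ((j + 1 : ℕ) : ℝ) κ.re hκ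
      simp only [Real.rpow_natCast] at h
      refine h.congr' ?_
      filter_upwards [eventually_ge_atTop 0] with s hs
      rw [norm_mul, neg_mul κ, norm_cexp_neg_mul_ofReal, norm_pow, Complex.norm_real,
        Real.norm_of_nonneg hs, neg_mul]
    have hcont : ContinuousWithinAt (fun s : ℝ => (s : ℂ) ^ (j + 1) * Complex.exp (-κ * s))
        (Ici 0) 0 := (by fun_prop : Continuous _).continuousWithinAt
    have key := integral_Ioi_of_hasDerivAt_of_tendsto hcont hd (hi1.sub hi2) hlim
    rw [integral_sub hi1 hi2, integral_const_mul, integral_const_mul, ih] at key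
    simp only [Complex.ofReal_zero, ne_eq, Nat.add_eq_zero_iff, one_ne_zero, and_false,
      not_false_eq_true, zero_pow, zero_mul, sub_zero] at key
    rw [sub_eq_zero] at key
    rw [eq_div_iff (pow_ne_zero _ hκ0), pow_succ κ (j + 1), Nat.factorial_succ]
    push_cast
    have h2 : κ * (∫ s in Ioi (0 : ℝ), (s : ℂ) ^ (j + 1) * Complex.exp (-(κ * s))) * κ ^ (j + 1)
        = (j + 1) * j.factorial := by
      rw [← key]
      field_simp
    rw [← h2]
    ring

theorem norm_sub_monomial_le {v : ℝ → ℂ} (hv : Continuous v) {ω : ℂ} {j : ℕ}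
    (h : (fun s : ℝ => v s - ω * s ^ j) =o[𝓝[>] 0] fun s : ℝ => s ^ j) {ε : ℝ}
    (hε : 0 < ε) :
    ∃ C, 0 ≤ C ∧ ∀ s ∈ Ioc (0 : ℝ) 1, ‖v s - ω * s ^ j‖ ≤ ε * s ^ j + C * s ^ (j + 1) := by
  have h1 := h.def hε
  rw [eventually_nhdsWithin_iff, Metric.eventually_nhds_iff] at h1
  obtain ⟨r, hr, h1⟩ := h1
  obtain ⟨K, hK0, hK⟩ := exists_norm_le_on_unitInterval
    (f := fun s : ℝ => v s - ω * s ^ j) (by fun_prop : Continuous _).continuousOn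
  refine ⟨K / r ^ (j + 1), by positivity, fun s hs => ?_⟩
  have hs0 : 0 < s := hs.1
  rcases lt_or_ge s r with hsr | hsr
  · have := h1 (y := s) (by rwa [dist_zero_right, Real.norm_of_nonneg hs0.le]) hs0
    rw [norm_pow, Real.norm_of_nonneg hs0.le] at this
    have h3 : 0 ≤ K / r ^ (j + 1) * s ^ (j + 1) := by positivity
    linarith
  · have h2 := hK s ⟨hs0.le, hs.2⟩
    have h3 : K ≤ K / r ^ (j + 1) * s ^ (j + 1) := by
      rw [div_mul_eq_mul_div, le_div_iff₀ (by positivity)]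
      gcongr
    have h4 : 0 ≤ ε * s ^ j := by positivity
    linarith

/-- Duhamel's formula for the second component, read from the right end point. -/
theorem IsSol.apply_one_eq_integral {q : ℂ} {u v y₁ y₂ : ℝ → ℂ} (h : IsSol 0 q u v y₁ y₂)
    (hv : Continuous v) (h0 : y₂ 0 = 0) :
    IntegrableOn (fun s : ℝ => Complex.exp (q * s) * (v (1 - s) * y₁ (1 - s))) (Ioc 0 1) ∧
      y₂ 1 = ∫ s in Ioc (0 : ℝ) 1, Complex.exp (q * s) * (v (1 - s) * y₁ (1 - s)) := by
  have hd : ∀ t ∈ uIcc (0 : ℝ) 1, HasDerivAt (fun t : ℝ => -(Complex.exp (q * t) * y₂ (1 - t)))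
      (Complex.exp (q * t) * (v (1 - t) * y₁ (1 - t))) t := by
    intro t ht
    rw [uIcc_of_le zero_le_one] at ht
    have hr := (h.reflect t ht).1
    refine ((hasDerivAt_exp_mul_ofReal q t).mul hr).neg.congr_deriv ?_
    ring
  have hc : ContinuousOn (fun s : ℝ => Complex.exp (q * s) * (v (1 - s) * y₁ (1 - s)))
      (uIcc 0 1) := by
    intro t ht
    rw [uIcc_of_le zero_le_one] at ht
    have h1 : ContinuousAt (fun s => y₁ (1 - s)) t := (h.reflect t ht).2.continuousAt
    have h2 : ContinuousAt (fun s : ℝ => Complex.exp (q * s)) t := by fun_prop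
    have h3 : ContinuousAt (fun s => v (1 - s)) t := by fun_prop
    exact (h2.mul (h3.mul h1)).continuousWithinAt
  have hi := hc.intervalIntegrable (μ := volume)
  refine ⟨(intervalIntegrable_iff_integrableOn_Ioc_of_le zero_le_one).1 hi, ?_⟩
  have := intervalIntegral.integral_eq_sub_of_hasDerivAt hd hi
  rw [intervalIntegral.integral_of_le zero_le_one] at this
  rw [this]
  simp [h0]

theorem IsSol.exists_lower_bound {u v : ℝ → ℂ} {M : ℝ} (hu : ∀ x ∈ Icc (0 : ℝ) 1, ‖u x‖ ≤ M)
    (hv : ∀ x ∈ Icc (0 : ℝ) 1, ‖v x‖ ≤ M) (hvc : Continuous v) {ω : ℂ} (hω : ω ≠ 0) {j : ℕ}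
    (h : (fun s : ℝ => v (1 - s) - ω * s ^ j) =o[𝓝[>] 0] fun s : ℝ => s ^ j) :
    ∃ c > 0, ∃ δ₀, ∀ (q : ℂ) (y₁ y₂ : ℝ → ℂ), IsSol 0 q u v y₁ y₂ → y₁ 0 = 1 → y₂ 0 = 0 →
      δ₀ ≤ (-q).re → ‖q‖ ≤ 2 * (-q).re → c / (-q).re ^ (j + 1) ≤ ‖y₂ 1‖ := by
  have hM : 0 ≤ M := (norm_nonneg _).trans (hu 0 (by simp))
  have hω' : 0 < ‖ω‖ := norm_pos_iff.2 hω
  set c : ℝ := ‖ω‖ * j.factorial / 2 ^ (j + 1) with hc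
  have hc0 : 0 < c := by positivity
  set ε : ℝ := ‖ω‖ / 2 ^ (j + 1) / 8 with hε
  obtain ⟨C, hC0, hC⟩ := norm_sub_monomial_le (v := fun s => v (1 - s)) (by fun_prop) h
    (ε := ε) (by positivity)
  set A : ℝ := 2 * ‖ω‖ * M ^ 2 * j.factorial + (2 * C + ‖ω‖) * (j + 1).factorial with hA
  refine ⟨c / 2, by positivity, max (max (2 * M ^ 2 + 1) 1) (4 * A / c),
    fun q y₁ y₂ hy h1 h0 hδ hq => ?_⟩
  set κ := -q with hκ
  set δ := κ.re with hδ'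
  have hδ1 : 2 * M ^ 2 < δ := by
    have := (le_max_left _ _).trans ((le_max_left _ _).trans hδ)
    linarith
  have hδ0 : 0 < δ := lt_of_le_of_lt (by positivity) hδ1
  have hδA : 4 * A / c ≤ δ := (le_max_right _ _).trans hδ
  obtain ⟨hgInt, hy2⟩ := hy.apply_one_eq_integral hvc h0
  have hclose : ∀ x ∈ Icc (0 : ℝ) 1, ‖y₁ x - 1‖ ≤ 2 * M ^ 2 / δ := by
    intro x hx
    have := (hy.bound_of_zero hu hv hδ1 hx).2.2
    rw [h1, h0] at this
    refine this.trans (le_of_eq ?_)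
    rw [norm_zero, norm_one, ← hκ, ← hδ']
    ring
  set g : ℝ → ℂ := fun s => ω * ((s : ℂ) ^ j * Complex.exp (-(κ * s)))
    - (Ioc (0 : ℝ) 1).indicator (fun s => Complex.exp (q * s) * (v (1 - s) * y₁ (1 - s))) s with hg
  have hi1 := (integrableOn_pow_mul_cexp_neg hδ0 j).const_mul ω
  have hi2 : IntegrableOn ((Ioc (0 : ℝ) 1).indicator
      fun s => Complex.exp (q * s) * (v (1 - s) * y₁ (1 - s))) (Ioi 0) :=
    ((integrable_indicator_iff measurableSet_Ioc).2 hgInt).integrableOn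
  have hgint : ∫ s in Ioi (0 : ℝ), g s = ω * (j.factorial / κ ^ (j + 1)) - y₂ 1 := by
    rw [hg, integral_sub hi1 hi2, integral_const_mul, integral_pow_mul_cexp_neg_Ioi hδ0,
      setIntegral_indicator measurableSet_Ioc,
      inter_eq_self_of_subset_right Ioc_subset_Ioi_self, ← hy2]
  have hgle : ∀ s ∈ Ioi (0 : ℝ), ‖g s‖ ≤ (2 * ε + 2 * ‖ω‖ * M ^ 2 / δ)
      * (s ^ j * Real.exp (-(δ * s))) + (2 * C + ‖ω‖) * (s ^ (j + 1) * Real.exp (-(δ * s))) := by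
    intro s hs
    have hs0 : (0 : ℝ) < s := hs
    rcases le_or_gt s 1 with hs1 | hs1
    · have e1 : g s = Complex.exp (-(κ * s)) *
          -((v (1 - s) - ω * (s : ℂ) ^ j) * y₁ (1 - s) + ω * (s : ℂ) ^ j * (y₁ (1 - s) - 1)) := by
        simp only [hg]
        rw [indicator_of_mem (show s ∈ Ioc (0 : ℝ) 1 from ⟨hs0, hs1⟩), hκ, neg_mul, neg_neg]
        ring
      have hx : 1 - s ∈ Icc (0 : ℝ) 1 := ⟨by linarith, by linarith⟩
      have e2 := hclose _ hx
      have e3 : ‖y₁ (1 - s)‖ ≤ 2 := by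
        have := (hy.bound_of_zero hu hv hδ1 hx).1
        rw [h1, h0] at this
        simpa using this
      rw [e1, norm_mul, norm_cexp_neg_mul_ofReal, norm_neg]
      have e4 : ‖(v (1 - s) - ω * (s : ℂ) ^ j) * y₁ (1 - s) + ω * (s : ℂ) ^ j * (y₁ (1 - s) - 1)‖
          ≤ (ε * s ^ j + C * s ^ (j + 1)) * 2 + ‖ω‖ * s ^ j * (2 * M ^ 2 / δ) := by
        refine (norm_add_le _ _).trans (add_le_add ?_ ?_)
        · rw [norm_mul]
          exact mul_le_mul (hC s ⟨hs0, hs1⟩) e3 (norm_nonneg _) (by positivity)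
        · rw [norm_mul, norm_mul, norm_pow, Complex.norm_real, Real.norm_of_nonneg hs0.le]
          gcongr
      refine (mul_le_mul_of_nonneg_left e4 (Real.exp_pos _).le).trans ?_
      have : 0 ≤ ‖ω‖ * (s ^ (j + 1) * Real.exp (-(δ * s))) := by positivity
      refine (le_add_of_nonneg_right this).trans (le_of_eq ?_)
      ring
    · have e1 : g s = ω * ((s : ℂ) ^ j * Complex.exp (-(κ * s))) := by
        simp only [hg]
        rw [indicator_of_notMem (fun hmem => not_le.2 hs1 hmem.2), sub_zero]
      rw [e1, norm_mul, norm_mul, norm_cexp_neg_mul_ofReal, norm_pow, Complex.norm_real,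
        Real.norm_of_nonneg hs0.le]
      have e2 : s ^ j ≤ s ^ (j + 1) := pow_le_pow_right₀ hs1.le (Nat.le_succ j)
      have e3 : ‖ω‖ * (s ^ j * Real.exp (-(δ * s)))
          ≤ ‖ω‖ * (s ^ (j + 1) * Real.exp (-(δ * s))) := by
        gcongr
      have e4 : 0 ≤ (2 * ε + 2 * ‖ω‖ * M ^ 2 / δ) * (s ^ j * Real.exp (-(δ * s))) := by positivity
      have e5 : 0 ≤ 2 * C * (s ^ (j + 1) * Real.exp (-(δ * s))) := by positivity
      linarith
  have hb1 := (integrableOn_pow_mul_exp_neg hδ0 j).const_mul (2 * ε + 2 * ‖ω‖ * M ^ 2 / δ)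
  have hb2 := (integrableOn_pow_mul_exp_neg hδ0 (j + 1)).const_mul (2 * C + ‖ω‖)
  have hgn : ‖∫ s in Ioi (0 : ℝ), g s‖ ≤ (2 * ε + 2 * ‖ω‖ * M ^ 2 / δ) * (j.factorial / δ ^ (j + 1))
      + (2 * C + ‖ω‖) * ((j + 1).factorial / δ ^ (j + 1 + 1)) := by
    refine (norm_integral_le_of_norm_le (hb1.add hb2)
      ((ae_restrict_mem measurableSet_Ioi).mono hgle)).trans (le_of_eq ?_)
    rw [← integral_pow_mul_exp_neg_Ioi hδ0, ← integral_pow_mul_exp_neg_Ioi hδ0,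
      ← integral_const_mul, ← integral_const_mul, ← integral_add hb1 hb2]
    rfl
  rw [hgint] at hgn
  have hmain : c / δ ^ (j + 1) ≤ ‖ω * (j.factorial / κ ^ (j + 1))‖ := by
    rw [norm_mul, norm_div, norm_pow, hκ, norm_neg, Complex.norm_natCast, hc, div_div,
      ← mul_pow, mul_div_assoc]
    have hq0 : 0 < ‖q‖ := by
      have := Complex.re_le_norm (-q)
      rw [norm_neg] at this
      exact hδ0.trans_le this
    gcongr
  have htri : ‖ω * (j.factorial / κ ^ (j + 1))‖
      ≤ ‖ω * (j.factorial / κ ^ (j + 1)) - y₂ 1‖ + ‖y₂ 1‖ := by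
    simpa using norm_add_le (ω * (j.factorial / κ ^ (j + 1)) - y₂ 1) (y₂ 1)
  have hrest : (2 * ε + 2 * ‖ω‖ * M ^ 2 / δ) * (j.factorial / δ ^ (j + 1))
      + (2 * C + ‖ω‖) * ((j + 1).factorial / δ ^ (j + 1 + 1))
      = (c / 4 + A / δ) / δ ^ (j + 1) := by
    rw [hε, hc, hA]
    field_simp
    ring
  have hAδ : A / δ ≤ c / 4 := by
    rw [div_le_iff₀ hc0] at hδA
    rw [div_le_iff₀ hδ0]
    linarith
  have hfin : (c / 4 + A / δ) / δ ^ (j + 1) ≤ (c / 2) / δ ^ (j + 1) := by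
    gcongr
    linarith
  have hhalf : c / δ ^ (j + 1) = (c / 2) / δ ^ (j + 1) + (c / 2) / δ ^ (j + 1) := by ring
  linarith

end Laplace

/-- The columns `(f, g)` and `(h, k)` form the fundamental system, normalised at `0`, of
`y₁' = p y₁ + u y₂`, `y₂' = q y₂ + v y₁` on `[0,1]`. -/
structure IsFundamental (p q : ℂ) (u v f g h k : ℝ → ℂ) : Prop where
  fst : IsSol p q u v f g
  snd : IsSol p q u v h k
  f_zero : f 0 = 1
  g_zero : g 0 = 0
  h_zero : h 0 = 0
  k_zero : k 0 = 1

namespace IsFundamental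

variable {p q : ℂ} {u v f g h k : ℝ → ℂ} {M : ℝ}

theorem swap (s : IsFundamental p q u v f g h k) : IsFundamental q p v u k h g f :=
  ⟨s.snd.swap, s.fst.swap, s.k_zero, s.h_zero, s.g_zero, s.f_zero⟩

theorem det (s : IsFundamental p q u v f g h k) {x : ℝ} (hx : x ∈ Icc (0 : ℝ) 1) :
    f x * k x - g x * h x = Complex.exp ((p + q) * x) := by
  rw [s.fst.wronskian s.snd hx, s.f_zero, s.g_zero, s.k_zero, s.h_zero]
  ring

theorem det_one (s : IsFundamental p q u v f g h k) :
    f 1 * k 1 - g 1 * h 1 = Complex.exp (p + q) := by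
  simpa using s.det (right_mem_Icc.2 zero_le_one)

theorem reflect (s : IsFundamental p q u v f g h k) :
    IsFundamental (-q) (-p) (fun x => -v (1 - x)) (fun x => -u (1 - x))
      (fun x => (Complex.exp (p + q))⁻¹ * (f 1 * k (1 - x) - h 1 * g (1 - x)))
      (fun x => (Complex.exp (p + q))⁻¹ * (f 1 * h (1 - x) - h 1 * f (1 - x)))
      (fun x => (Complex.exp (p + q))⁻¹ * (k 1 * g (1 - x) - g 1 * k (1 - x)))
      (fun x => (Complex.exp (p + q))⁻¹ * (k 1 * f (1 - x) - g 1 * h (1 - x))) := by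
  have hE := s.det_one
  have hE0 := Complex.exp_ne_zero (p + q)
  set E := Complex.exp (p + q)
  refine ⟨?_, ?_, ?_, ?_, ?_, ?_⟩
  · convert (s.snd.reflect.add_mul s.fst.reflect (E⁻¹ * f 1) (-(E⁻¹ * h 1))) using 2 <;> ring
  · convert (s.fst.reflect.add_mul s.snd.reflect (E⁻¹ * k 1) (-(E⁻¹ * g 1))) using 2 <;> ring
  · simp only [sub_zero]
    field_simp
    linear_combination hE
  · simp only [sub_zero]
    ring
  · simp only [sub_zero]
    ring
  · simp only [sub_zero]
    field_simp
    linear_combination hE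

theorem norm_cexp_neg_mul (p : ℂ) (x : ℝ) :
    ‖Complex.exp (-p * x)‖ = (Real.exp (p.re * x))⁻¹ := by
  simp [Complex.norm_exp, ← Real.exp_neg]

/-- Bounds for the fundamental system when the first exponential dominates. -/
theorem bounds (s : IsFundamental p q u v f g h k) (hu : ∀ x ∈ Icc (0 : ℝ) 1, ‖u x‖ ≤ M)
    (hv : ∀ x ∈ Icc (0 : ℝ) 1, ‖v x‖ ≤ M) (hδ : 8 * (M + 1) ^ 2 ≤ (p - q).re) {x : ℝ}
    (hx : x ∈ Icc (0 : ℝ) 1) :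
    (‖Complex.exp (-p * x) * f x - 1‖ ≤ 1 / 4 ∧ ‖Complex.exp (-p * x) * g x‖ ≤ 1 / 4) ∧
      ‖f x‖ ≤ 4 * (M + 1) * Real.exp (p.re * x) ∧ ‖g x‖ ≤ 4 * (M + 1) * Real.exp (p.re * x) ∧
      ‖h x‖ ≤ 4 * (M + 1) * Real.exp (p.re * x) ∧ ‖k x‖ ≤ 4 * (M + 1) * Real.exp (p.re * x) := by
  have hM : 0 ≤ M := (norm_nonneg _).trans (hu 0 (by simp))
  have e1 : -p + p = 0 := by ring
  have e2 : (-(-p + q)).re = (p - q).re := by simp; ring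
  set δ := (p - q).re with hδdef
  have hδ0 : 0 < δ := lt_of_lt_of_le (by positivity) hδ
  have hδ2 : 2 * M ^ 2 < δ := by nlinarith
  have s1 := s.fst.exp_mul (-p)
  have s2 := s.snd.exp_mul (-p)
  rw [e1] at s1 s2
  obtain ⟨a1, a2, a3⟩ := s1.bound_of_zero hu hv (by rwa [e2]) hx
  obtain ⟨b1, b2, -⟩ := s2.bound_of_zero hu hv (by rwa [e2]) hx
  rw [e2] at a2 a3 b2
  simp only [Complex.ofReal_zero, mul_zero, Complex.exp_zero, s.f_zero, s.g_zero,
    s.h_zero, s.k_zero, norm_zero, norm_one, add_zero, zero_add, mul_one] at a1 a2 a3 b1 b2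
  have d1 : M * 2 / δ ≤ 1 / 4 := by
    rw [div_le_iff₀ hδ0]; nlinarith
  have d2 : M * (M * 2 / δ) ≤ 1 / 4 := by
    rw [← mul_div_assoc, div_le_iff₀ hδ0]; nlinarith
  have d3 : M * (2 * M) / δ ≤ 1 / 4 := by
    rw [div_le_iff₀ hδ0]; nlinarith
  have key : ∀ {w : ℂ} {c : ℝ}, ‖Complex.exp (-p * x) * w‖ ≤ c → c ≤ 4 * (M + 1) →
      ‖w‖ ≤ 4 * (M + 1) * Real.exp (p.re * x) := by
    intro w c hw hc
    rw [norm_mul, norm_cexp_neg_mul, inv_mul_le_iff₀ (Real.exp_pos _)] at hw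
    nlinarith [Real.exp_pos (p.re * x)]
  refine ⟨⟨a3.trans d2, a2.trans d1⟩, key a1 (by linarith), key a2 (by linarith),
    key b1 (by linarith), key b2 (by linarith)⟩

theorem bounds_reflect (s : IsFundamental p q u v f g h k)
    (hu : ∀ x ∈ Icc (0 : ℝ) 1, ‖u x‖ ≤ M)
    (hv : ∀ x ∈ Icc (0 : ℝ) 1, ‖v x‖ ≤ M) (hδ : 8 * (M + 1) ^ 2 ≤ (p - q).re) {x : ℝ}
    (hx : x ∈ Icc (0 : ℝ) 1) :
    (‖Complex.exp (-p - q * x) * (f 1 * k x - h 1 * g x) - 1‖ ≤ 1 / 4 ∧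
      ‖Complex.exp (-p - q * x) * (f 1 * h x - h 1 * f x)‖ ≤ 1 / 4) ∧
      ‖f 1 * k x - h 1 * g x‖ ≤ 4 * (M + 1) * Real.exp (p.re + q.re * x) ∧
      ‖f 1 * h x - h 1 * f x‖ ≤ 4 * (M + 1) * Real.exp (p.re + q.re * x) ∧
      ‖k 1 * g x - g 1 * k x‖ ≤ 4 * (M + 1) * Real.exp (p.re + q.re * x) ∧
      ‖k 1 * f x - g 1 * h x‖ ≤ 4 * (M + 1) * Real.exp (p.re + q.re * x) := by
  have mem : ∀ {y : ℝ}, y ∈ Icc (0 : ℝ) 1 → 1 - y ∈ Icc (0 : ℝ) 1 := fun hy =>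
    ⟨by linarith [hy.2], by linarith [hy.1]⟩
  obtain ⟨⟨a1, a2⟩, a3, a4, a5, a6⟩ := s.reflect.bounds (M := M)
    (fun y hy => by simpa using hv _ (mem hy)) (fun y hy => by simpa using hu _ (mem hy))
    (by simpa [neg_add_eq_sub] using hδ) (mem hx)
  have e : ∀ w : ℂ, Complex.exp (-(-q) * ((1 - x : ℝ) : ℂ)) * ((Complex.exp (p + q))⁻¹ * w)
      = Complex.exp (-p - q * x) * w := by
    intro w
    rw [← Complex.exp_neg, ← mul_assoc, ← Complex.exp_add]
    congr 2
    push_cast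
    ring
  rw [e] at a1 a2
  have key : ∀ {w : ℂ}, ‖(Complex.exp (p + q))⁻¹ * w‖ ≤ 4 * (M + 1) * Real.exp ((-q).re * (1 - x)) →
      ‖w‖ ≤ 4 * (M + 1) * Real.exp (p.re + q.re * x) := by
    intro w hw
    rw [norm_mul, norm_inv, Complex.norm_exp, inv_mul_le_iff₀ (Real.exp_pos _)] at hw
    refine hw.trans_eq ?_
    rw [mul_left_comm, ← Real.exp_add]
    congr 2
    simp
    ring
  simp only [sub_sub_cancel] at a1 a2 a3 a4 a5 a6
  exact ⟨⟨a1, a2⟩, key a3, key a4, key a5, key a6⟩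

end IsFundamental

theorem eventually_mul_pow_le_exp (C : ℝ) (K : ℕ) {b : ℝ} (hb : 0 < b) :
    ∀ᶠ x : ℝ in atTop, C * x ^ K ≤ Real.exp (b * x) := by
  have h := (isLittleO_pow_exp_pos_mul_atTop (b := b) K hb).const_mul_left C
  filter_upwards [h.bound one_pos] with x hx
  rw [one_mul, Real.norm_of_nonneg (Real.exp_pos _).le] at hx
  exact (le_abs_self _).trans hx

namespace IsFundamental

variable {u v : ℝ → ℂ} {M : ℝ}

theorem exists_le_norm_h_one (hu : ∀ x ∈ Icc (0 : ℝ) 1, ‖u x‖ ≤ M)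
    (hv : ∀ x ∈ Icc (0 : ℝ) 1, ‖v x‖ ≤ M) (huc : Continuous u) {ω : ℂ} (hω : ω ≠ 0) {j : ℕ}
    (h : (fun s : ℝ => u s - ω * s ^ j) =o[𝓝[>] 0] fun s : ℝ => s ^ j) :
    ∃ c > 0, ∃ δ₀, ∀ p q f g h k, IsFundamental p q u v f g h k → δ₀ ≤ (p - q).re →
      ‖p - q‖ ≤ 2 * (p - q).re →
      c / (p - q).re ^ (j + 1) * Real.exp p.re ≤ ‖h 1‖ := by
  have mem : ∀ {y : ℝ}, y ∈ Icc (0 : ℝ) 1 → 1 - y ∈ Icc (0 : ℝ) 1 := fun hy =>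
    ⟨by linarith [hy.2], by linarith [hy.1]⟩
  have h' : (fun s : ℝ => (fun x => -u (1 - x)) (1 - s) - -ω * s ^ j) =o[𝓝[>] 0]
      fun s : ℝ => s ^ j := by
    refine h.neg_left.congr_left fun s => ?_
    simp only [sub_sub_cancel]
    ring
  obtain ⟨c, hc, δ₀, H⟩ := IsSol.exists_lower_bound (u := fun x => -v (1 - x))
    (v := fun x => -u (1 - x)) (M := M)
    (fun y hy => by simpa using hv _ (mem hy)) (fun y hy => by simpa using hu _ (mem hy))
    (by fun_prop) (neg_ne_zero.2 hω) h'
  refine ⟨c, hc, δ₀, fun p q f g h k s hδ hn => ?_⟩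
  have e1 : q + -q = 0 := by ring
  have e2 : (-(q + -p)) = p - q := by ring
  have s1 := s.reflect.fst.exp_mul q
  rw [e1] at s1
  have := H (q + -p) _ _ s1 (by simpa using s.reflect.f_zero)
    (by simpa using s.reflect.g_zero) (by rwa [e2]) (by rwa [e2, ← norm_neg, e2])
  rw [e2] at this
  simp only [sub_self, s.h_zero, s.f_zero, Complex.ofReal_one, mul_one, mul_zero, zero_sub,
    norm_mul, norm_inv, norm_neg, Complex.norm_exp, Complex.add_re, Real.exp_add] at this
  rw [← le_div_iff₀ (Real.exp_pos _)]
  refine this.trans_eq ?_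
  have := (Real.exp_pos p.re).ne'
  have := (Real.exp_pos q.re).ne'
  field_simp

theorem exists_le_norm_g_one (hu : ∀ x ∈ Icc (0 : ℝ) 1, ‖u x‖ ≤ M)
    (hv : ∀ x ∈ Icc (0 : ℝ) 1, ‖v x‖ ≤ M) (hvc : Continuous v) {ω : ℂ} (hω : ω ≠ 0) {j : ℕ}
    (h : (fun s : ℝ => v (1 - s) - ω * s ^ j) =o[𝓝[>] 0] fun s : ℝ => s ^ j) :
    ∃ c > 0, ∃ δ₀, ∀ p q f g h k, IsFundamental p q u v f g h k → δ₀ ≤ (p - q).re →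
      ‖p - q‖ ≤ 2 * (p - q).re →
      c / (p - q).re ^ (j + 1) * Real.exp p.re ≤ ‖g 1‖ := by
  obtain ⟨c, hc, δ₀, H⟩ := IsSol.exists_lower_bound hu hv hvc hω h
  refine ⟨c, hc, δ₀, fun p q f g h k s hδ hn => ?_⟩
  have e1 : -p + p = 0 := by ring
  have e2 : (-(-p + q)) = p - q := by ring
  have s1 := s.fst.exp_mul (-p)
  rw [e1] at s1
  have := H (-p + q) _ _ s1 (by simpa using s.f_zero)
    (by simpa using s.g_zero) (by rwa [e2]) (by rwa [e2, ← norm_neg, e2])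
  rw [e2, norm_mul, norm_cexp_neg_mul, mul_one] at this
  rwa [le_inv_mul_iff₀ (Real.exp_pos _), mul_comm] at this

/-- Polynomial loss in the lower bound for the small diagonal entry of the monodromy matrix. -/
theorem exists_le_norm_k_one (hu : ∀ x ∈ Icc (0 : ℝ) 1, ‖u x‖ ≤ M)
    (hv : ∀ x ∈ Icc (0 : ℝ) 1, ‖v x‖ ≤ M) (huc : Continuous u) (hvc : Continuous v)
    {ω ω' : ℂ} (hω : ω ≠ 0) (hω' : ω' ≠ 0) {j j' : ℕ}
    (hju : (fun s : ℝ => u s - ω * s ^ j) =o[𝓝[>] 0] fun s : ℝ => s ^ j)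
    (hjv : (fun s : ℝ => v (1 - s) - ω' * s ^ j') =o[𝓝[>] 0] fun s : ℝ => s ^ j') :
    ∃ c > 0, ∃ K : ℕ, ∃ δ₀, ∀ p q f g h k, IsFundamental p q u v f g h k → δ₀ ≤ (p - q).re →
      ‖p - q‖ ≤ 2 * (p - q).re → c / (p - q).re ^ K * Real.exp p.re ≤ ‖k 1‖ := by
  obtain ⟨c₁, hc₁, δ₁, H₁⟩ := exists_le_norm_h_one hu hv huc hω hju
  obtain ⟨c₂, hc₂, δ₂, H₂⟩ := exists_le_norm_g_one hu hv hvc hω' hjv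
  have hM : 0 ≤ M := (norm_nonneg _).trans (hu 0 (by simp))
  obtain ⟨δ₃, H₃⟩ := eventually_atTop.1
    (eventually_mul_pow_le_exp (2 / (c₁ * c₂)) (j + 1 + (j' + 1)) one_pos)
  refine ⟨c₁ * c₂ / 2 / (4 * (M + 1)), by positivity, j + 1 + (j' + 1),
    max (max δ₁ δ₂) (max δ₃ (8 * (M + 1) ^ 2)), fun p q f g h k s hδ hn => ?_⟩
  simp only [max_le_iff] at hδ
  obtain ⟨⟨d1, d2⟩, d3, d4⟩ := hδ
  have a1 := H₁ p q f g h k s d1 hn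
  have a2 := H₂ p q f g h k s d2 hn
  have a3 := H₃ _ d3
  obtain ⟨-, a4, -⟩ := s.bounds hu hv d4 (right_mem_Icc.2 zero_le_one)
  rw [mul_one] at a4
  have hδ0 : 0 < (p - q).re := lt_of_lt_of_le (by positivity) d4
  have ep : Real.exp (p + q).re = Real.exp p.re * Real.exp p.re / Real.exp ((p - q).re) := by
    rw [← Real.exp_add, ← Real.exp_sub]
    congr 1
    simp
  have hE : ‖Complex.exp (p + q)‖ ≤ c₁ * c₂ / 2 / (p - q).re ^ (j + 1 + (j' + 1)) *
      (Real.exp p.re * Real.exp p.re) := by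
    rw [Complex.norm_exp, ep, div_eq_mul_inv, mul_comm]
    refine mul_le_mul_of_nonneg_right ?_ (by positivity)
    rw [inv_le_comm₀ (Real.exp_pos _) (by positivity)]
    rw [one_mul] at a3
    refine le_trans (le_of_eq ?_) a3
    field_simp
  have hgh : c₁ * c₂ / (p - q).re ^ (j + 1 + (j' + 1)) * (Real.exp p.re * Real.exp p.re)
      ≤ ‖g 1 * h 1‖ := by
    rw [norm_mul, mul_comm ‖g 1‖]
    refine le_trans (le_of_eq ?_) (mul_le_mul a1 a2 (by positivity) (norm_nonneg _))
    rw [pow_add]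
    field_simp
  have hfk : ‖g 1 * h 1‖ ≤ ‖f 1‖ * ‖k 1‖ + ‖Complex.exp (p + q)‖ := by
    rw [← norm_mul, ← s.det_one]
    have := norm_sub_le (f 1 * k 1) (f 1 * k 1 - g 1 * h 1)
    rwa [sub_sub_cancel] at this
  have hf := mul_le_mul_of_nonneg_right a4 (norm_nonneg (k 1))
  have he := Real.exp_pos p.re
  have fin : c₁ * c₂ / 2 / (p - q).re ^ (j + 1 + (j' + 1)) * (Real.exp p.re * Real.exp p.re) ≤
      4 * (M + 1) * Real.exp p.re * ‖k 1‖ := by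
    have : c₁ * c₂ / (p - q).re ^ (j + 1 + (j' + 1)) =
      2 * (c₁ * c₂ / 2 / (p - q).re ^ (j + 1 + (j' + 1))) := by ring
    rw [this] at hgh
    linarith
  have : c₁ * c₂ / 2 / (4 * (M + 1)) / (p - q).re ^ (j + 1 + (j' + 1)) * Real.exp p.re
      = (c₁ * c₂ / 2 / (p - q).re ^ (j + 1 + (j' + 1)) * (Real.exp p.re * Real.exp p.re))
        / (4 * (M + 1) * Real.exp p.re) := by
    field_simp
  rw [this, div_le_iff₀ (by positivity)]
  linarith

end IsFundamental

/-- The leading Taylor monomial at a point where some derivative does not vanish. -/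
theorem exists_leading_monomial {f : ℝ → ℂ} {s : Set ℝ} (hs : Convex ℝ s) {x₀ : ℝ} (hx₀ : x₀ ∈ s)
    {N : ℕ} (hf : ContDiffOn ℝ N f s) {j₀ : ℕ} (hj₀ : j₀ ≤ N)
    (h : iteratedDerivWithin j₀ f s x₀ ≠ 0) :
    ∃ ω : ℂ, ω ≠ 0 ∧ ∃ j : ℕ,
      (fun x : ℝ => f x - ω * ((x - x₀ : ℝ) : ℂ) ^ j) =o[𝓝[s] x₀] fun x : ℝ => (x - x₀) ^ j := by
  classical
  have hex : ∃ j, iteratedDerivWithin j f s x₀ ≠ 0 := ⟨j₀, h⟩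
  set j := Nat.find hex
  have hj : j ≤ N := (Nat.find_min' hex h).trans hj₀
  refine ⟨(j.factorial : ℂ)⁻¹ * iteratedDerivWithin j f s x₀,
    mul_ne_zero (inv_ne_zero (Nat.cast_ne_zero.2 (Nat.factorial_ne_zero _))) (Nat.find_spec hex),
    j, ?_⟩
  have ht := taylor_isLittleO hs hx₀ (hf.of_le (by exact_mod_cast hj) : ContDiffOn ℝ j f s)
  refine ht.congr_left fun x => ?_
  rw [taylor_within_apply, Finset.sum_range_succ, Finset.sum_eq_zero, zero_add]
  · rw [Complex.real_smul]
    push_cast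
    ring
  · intro i hi
    rw [not_not.1 (Nat.find_min hex (Finset.mem_range.1 hi)), smul_zero]

theorem exists_leading_monomial_left {f : ℝ → ℂ} {N : ℕ} (hf : ContDiffOn ℝ N f (Icc 0 1)) {j₀ : ℕ}
    (hj₀ : j₀ ≤ N) (h : iteratedDerivWithin j₀ f (Icc 0 1) 0 ≠ 0) :
    ∃ ω : ℂ, ω ≠ 0 ∧ ∃ j : ℕ,
      (fun s : ℝ => f s - ω * s ^ j) =o[𝓝[>] 0] fun s : ℝ => s ^ j := by
  obtain ⟨ω, hω, j, hj⟩ := exists_leading_monomial (convex_Icc 0 1) (by simp) hf hj₀ h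
  refine ⟨ω, hω, j, ?_⟩
  rw [← nhdsWithin_Ioc_eq_nhdsGT (zero_lt_one (α := ℝ))]
  simpa using hj.mono (nhdsWithin_mono _ Ioc_subset_Icc_self)

theorem exists_leading_monomial_right {f : ℝ → ℂ} {N : ℕ} (hf : ContDiffOn ℝ N f (Icc 0 1))
    {j₀ : ℕ} (hj₀ : j₀ ≤ N) (h : iteratedDerivWithin j₀ f (Icc 0 1) 1 ≠ 0) :
    ∃ ω : ℂ, ω ≠ 0 ∧ ∃ j : ℕ,
      (fun s : ℝ => f (1 - s) - ω * s ^ j) =o[𝓝[>] 0] fun s : ℝ => s ^ j := by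
  obtain ⟨ω, hω, j, hj⟩ := exists_leading_monomial (convex_Icc 0 1) (by simp) hf hj₀ h
  refine ⟨ω * (-1) ^ j, mul_ne_zero hω (pow_ne_zero _ (by simp)), j, ?_⟩
  have ht : Tendsto (fun s : ℝ => 1 - s) (𝓝[>] 0) (𝓝[Icc 0 1] 1) := by
    rw [← nhdsWithin_Ioc_eq_nhdsGT (zero_lt_one (α := ℝ))]
    refine tendsto_nhdsWithin_iff.2 ⟨?_, ?_⟩
    · have : Continuous fun s : ℝ => 1 - s := by fun_prop
      simpa using (this.tendsto 0).mono_left nhdsWithin_le_nhds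
    · filter_upwards [self_mem_nhdsWithin] with s hs
      exact ⟨by linarith [hs.2], by linarith [hs.1]⟩
  have := hj.comp_tendsto ht
  refine (this.congr_left fun s => ?_).trans_isBigO ?_
  · simp only [Function.comp]
    rw [mul_assoc, ← mul_pow]
    congr 3
    push_cast
    ring
  · refine Asymptotics.IsBigO.of_bound 1 (Eventually.of_forall fun s => ?_)
    simp

/-- An integrable function integrated against a kernel concentrating at a point. -/
theorem tendsto_integral_exp_kernel {F : ℝ → ℝ} (hF : IntervalIntegrable F volume 0 1) (x : ℝ) :
    Tendsto (fun τ : ℝ => ∫ t in (0 : ℝ)..1, Real.exp (-(τ * |x - t|)) * F t) atTop (𝓝 0) := by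
  have h := intervalIntegral.tendsto_integral_filter_of_dominated_convergence (μ := volume)
    (a := 0) (b := 1) (l := (atTop : Filter ℝ))
    (F := fun τ t => Real.exp (-(τ * |x - t|)) * F t) (f := fun _ => 0) (fun t => ‖F t‖) ?_ ?_
    hF.norm ?_
  · simpa using h
  · refine Eventually.of_forall fun τ => ?_
    have hc : Continuous fun t => Real.exp (-(τ * |x - t|)) := by fun_prop
    exact hc.aestronglyMeasurable.mul hF.def'.aestronglyMeasurable
  · filter_upwards [eventually_ge_atTop 0] with τ hτ
    refine Eventually.of_forall fun t _ => ?_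
    rw [norm_mul, Real.norm_of_nonneg (Real.exp_pos _).le]
    refine mul_le_of_le_one_left (norm_nonneg _) (Real.exp_le_one_iff.2 ?_)
    have := mul_nonneg hτ (abs_nonneg (x - t))
    linarith
  · have hne : ∀ᵐ t : ℝ, t ≠ x := by simp [ae_iff]
    filter_upwards [hne] with t ht _
    have hpos : 0 < |x - t| := abs_pos.2 (sub_ne_zero.2 ht.symm)
    have : Tendsto (fun τ : ℝ => Real.exp (-(τ * |x - t|))) atTop (𝓝 0) :=
      Real.tendsto_exp_neg_atTop_nhds_zero.comp (tendsto_id.atTop_mul_const hpos)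
    simpa using this.mul_const (F t)

theorem IntervalIntegrable.exp_kernel_mul {F : ℝ → ℝ} (hF : IntervalIntegrable F volume 0 1)
    (τ x : ℝ) : IntervalIntegrable (fun t => Real.exp (-(τ * |x - t|)) * F t) volume 0 1 := by
  have hc : Continuous fun t => Real.exp (-(τ * |x - t|)) := by fun_prop
  exact hF.continuousOn_mul hc.continuousOn

theorem norm_add_norm_le_of_near_identity {X Y a b c d A B : ℂ} (h₁ : X * a + Y * b = A)
    (h₂ : X * c + Y * d = B) (ha : ‖a - 1‖ ≤ 1 / 4) (hb : ‖b‖ ≤ 1 / 4) (hc : ‖c‖ ≤ 1 / 4)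
    (hd : ‖d - 1‖ ≤ 1 / 4) : ‖X‖ + ‖Y‖ ≤ 2 * (‖A‖ + ‖B‖) := by
  have h3 : ‖X‖ ≤ ‖A‖ + ‖X‖ * ‖a - 1‖ + ‖Y‖ * ‖b‖ := by
    have : X = A - X * (a - 1) - Y * b := by linear_combination h₁
    calc ‖X‖ = ‖A - X * (a - 1) - Y * b‖ := by rw [← this]
      _ ≤ ‖A - X * (a - 1)‖ + ‖Y * b‖ := norm_sub_le _ _
      _ ≤ ‖A‖ + ‖X * (a - 1)‖ + ‖Y * b‖ := by gcongr; exact norm_sub_le _ _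
      _ = _ := by rw [norm_mul, norm_mul]
  have h4 : ‖Y‖ ≤ ‖B‖ + ‖X‖ * ‖c‖ + ‖Y‖ * ‖d - 1‖ := by
    have : Y = B - X * c - Y * (d - 1) := by linear_combination h₂
    calc ‖Y‖ = ‖B - X * c - Y * (d - 1)‖ := by rw [← this]
      _ ≤ ‖B - X * c‖ + ‖Y * (d - 1)‖ := norm_sub_le _ _
      _ ≤ ‖B‖ + ‖X * c‖ + ‖Y * (d - 1)‖ := by gcongr; exact norm_sub_le _ _
      _ = _ := by rw [norm_mul, norm_mul]
  have := mul_le_mul_of_nonneg_left ha (norm_nonneg X)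
  have := mul_le_mul_of_nonneg_left hb (norm_nonneg Y)
  have := mul_le_mul_of_nonneg_left hc (norm_nonneg X)
  have := mul_le_mul_of_nonneg_left hd (norm_nonneg Y)
  linarith

theorem norm_integral_le_integral_unit {φ : ℝ → ℂ} {G : ℝ → ℝ}
    (hG : IntervalIntegrable G volume 0 1)
    (hG0 : ∀ t, 0 ≤ G t) {a b : ℝ} (ha : 0 ≤ a) (hab : a ≤ b) (hb : b ≤ 1)
    (h : ∀ t ∈ Icc a b, ‖φ t‖ ≤ G t) : ‖∫ t in a..b, φ t‖ ≤ ∫ t in (0 : ℝ)..1, G t := by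
  refine (intervalIntegral.norm_integral_le_of_norm_le hab
    (Eventually.of_forall fun t ht => h t (Ioc_subset_Icc_self ht)) (hG.mono_set ?_)).trans ?_
  · rw [uIcc_of_le hab, uIcc_of_le zero_le_one]
    exact Icc_subset_Icc ha hb
  · exact intervalIntegral.integral_mono_interval ha hab hb (Eventually.of_forall hG0) hG

theorem norm_add_mul_le {a b c d : ℂ} {K : ℝ} (ha : ‖a‖ ≤ K) (hb : ‖b‖ ≤ K) :
    ‖a * c + b * d‖ ≤ K * (‖c‖ + ‖d‖) := by
  refine (norm_add_le _ _).trans ?_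
  rw [norm_mul, norm_mul, mul_add]
  gcongr

theorem IsSol.continuousOn_fst {p q : ℂ} {u v y₁ y₂ : ℝ → ℂ} (h : IsSol p q u v y₁ y₂) :
    ContinuousOn y₁ (uIcc 0 1) := by
  rw [uIcc_of_le zero_le_one]
  exact fun t ht => (h t ht).1.continuousAt.continuousWithinAt

theorem IsSol.intervalIntegrable_mul_add {p q : ℂ} {u v y₁ y₂ f₁ f₂ : ℝ → ℂ}
    (h : IsSol p q u v y₁ y₂) (hf₁ : IntervalIntegrable f₁ volume 0 1)
    (hf₂ : IntervalIntegrable f₂ volume 0 1) :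
    IntervalIntegrable (fun t => y₁ t * f₁ t + y₂ t * f₂ t) volume 0 1 :=
  (hf₁.continuousOn_mul h.continuousOn_fst).add (hf₂.continuousOn_mul h.swap.continuousOn_fst)

namespace IsFundamental

variable {p q : ℂ} {u v f g h k : ℝ → ℂ} {M : ℝ}

/-- The coordinates, in the basis of solutions at `x`, of a truncated functional annihilating
all solutions. -/
theorem norm_coordinates_le (s : IsFundamental p q u v f g h k)
    (hu : ∀ x ∈ Icc (0 : ℝ) 1, ‖u x‖ ≤ M) (hv : ∀ x ∈ Icc (0 : ℝ) 1, ‖v x‖ ≤ M)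
    (hδ : 8 * (M + 1) ^ 2 ≤ (p - q).re) {τ : ℝ} (hp : τ ≤ p.re) (hq : τ ≤ -q.re)
    {f₁ f₂ : ℝ → ℂ} (hf₁ : IntervalIntegrable f₁ volume 0 1)
    (hf₂ : IntervalIntegrable f₂ volume 0 1)
    (h₁ : ∫ t in (0 : ℝ)..1, (f t * f₁ t + g t * f₂ t) = 0)
    (h₂ : ∫ t in (0 : ℝ)..1, (h t * f₁ t + k t * f₂ t) = 0) {x : ℝ} (hx : x ∈ Icc (0 : ℝ) 1) :
    ‖Complex.exp (-(p + q) * x) * ((∫ t in (0 : ℝ)..x, (f t * f₁ t + g t * f₂ t)) * k x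
        - (∫ t in (0 : ℝ)..x, (h t * f₁ t + k t * f₂ t)) * g x)‖ +
      ‖Complex.exp (-(p + q) * x) * ((∫ t in (0 : ℝ)..x, (h t * f₁ t + k t * f₂ t)) * f x
        - (∫ t in (0 : ℝ)..x, (f t * f₁ t + g t * f₂ t)) * h x)‖ ≤
      16 * (M + 1) * ∫ t in (0 : ℝ)..1, Real.exp (-(τ * |x - t|)) * (‖f₁ t‖ + ‖f₂ t‖) := by
  have hM : 0 ≤ M := (norm_nonneg _).trans (hu 0 (by simp))
  have i1 := s.fst.intervalIntegrable_mul_add hf₁ hf₂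
  have i2 := s.snd.intervalIntegrable_mul_add hf₁ hf₂
  have hF : IntervalIntegrable (fun t => 4 * (M + 1) * (Real.exp (-(τ * |x - t|)) *
      (‖f₁ t‖ + ‖f₂ t‖))) volume 0 1 :=
    ((hf₁.norm.add hf₂.norm).exp_kernel_mul τ x).const_mul _
  have hF0 : ∀ t, 0 ≤ 4 * (M + 1) * (Real.exp (-(τ * |x - t|)) * (‖f₁ t‖ + ‖f₂ t‖)) :=
    fun t => by positivity
  have sub1 : uIcc 0 x ⊆ uIcc (0 : ℝ) 1 := by
    rw [uIcc_of_le hx.1, uIcc_of_le zero_le_one]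
    exact Icc_subset_Icc le_rfl hx.2
  have sub2 : uIcc x 1 ⊆ uIcc (0 : ℝ) 1 := by
    rw [uIcc_of_le hx.2, uIcc_of_le zero_le_one]
    exact Icc_subset_Icc hx.1 le_rfl
  set P₁ := fun t => f t * f₁ t + g t * f₂ t with hP₁
  set P₂ := fun t => h t * f₁ t + k t * f₂ t with hP₂
  set M₁ := ∫ t in (0 : ℝ)..x, P₁ t with hM₁
  set M₂ := ∫ t in (0 : ℝ)..x, P₂ t with hM₂
  have r1 : M₁ + ∫ t in x..1, P₁ t = 0 := by
    rw [← h₁]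
    exact intervalIntegral.integral_add_adjacent_intervals (i1.mono_set sub1)
      (i1.mono_set sub2)
  have r2 : M₂ + ∫ t in x..1, P₂ t = 0 := by
    rw [← h₂]
    exact intervalIntegral.integral_add_adjacent_intervals (i2.mono_set sub1)
      (i2.mono_set sub2)
  have hA : ‖Complex.exp (-p * x) * M₁‖ ≤ ∫ t in (0 : ℝ)..1, 4 * (M + 1) *
      (Real.exp (-(τ * |x - t|)) * (‖f₁ t‖ + ‖f₂ t‖)) := by
    rw [hM₁, ← intervalIntegral.integral_const_mul]
    refine norm_integral_le_integral_unit hF hF0 le_rfl hx.1 hx.2 fun t ht => ?_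
    obtain ⟨-, b1, b2, -⟩ := s.bounds hu hv hδ ⟨ht.1, ht.2.trans hx.2⟩
    rw [norm_mul, norm_cexp_neg_mul, ← Real.exp_neg]
    refine (mul_le_mul_of_nonneg_left (norm_add_mul_le b1 b2) (Real.exp_pos _).le).trans ?_
    have e : Real.exp (-(p.re * x)) * (4 * (M + 1) * Real.exp (p.re * t) * (‖f₁ t‖ + ‖f₂ t‖))
        = 4 * (M + 1) * (Real.exp (-(p.re * x) + p.re * t) * (‖f₁ t‖ + ‖f₂ t‖)) := by
      rw [Real.exp_add]; ring
    rw [e]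
    gcongr
    rw [abs_of_nonneg (sub_nonneg.2 ht.2)]
    nlinarith [ht.2]
  have hB : ‖Complex.exp (-p - q * x) * (f 1 * M₂ - h 1 * M₁)‖ ≤ ∫ t in (0 : ℝ)..1, 4 * (M + 1) *
      (Real.exp (-(τ * |x - t|)) * (‖f₁ t‖ + ‖f₂ t‖)) := by
    have e : Complex.exp (-p - q * x) * (f 1 * M₂ - h 1 * M₁) =
        ∫ t in x..1, -(Complex.exp (-p - q * x) * ((f 1 * h t - h 1 * f t) * f₁ t
          + (f 1 * k t - h 1 * g t) * f₂ t)) := by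
      have e' : ∀ t, -(Complex.exp (-p - q * x) * ((f 1 * h t - h 1 * f t) * f₁ t
          + (f 1 * k t - h 1 * g t) * f₂ t))
          = -Complex.exp (-p - q * x) * f 1 * P₂ t + Complex.exp (-p - q * x) * h 1 * P₁ t := by
        intro t
        simp only [hP₁, hP₂]
        ring
      simp only [e']
      rw [intervalIntegral.integral_add ((i2.mono_set sub2).const_mul _)
        ((i1.mono_set sub2).const_mul _), intervalIntegral.integral_const_mul,
        intervalIntegral.integral_const_mul]
      linear_combination Complex.exp (-p - q * x) * f 1 * r2 - Complex.exp (-p - q * x) * h 1 * r1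
    rw [e]
    refine norm_integral_le_integral_unit hF hF0 hx.1 hx.2 le_rfl fun t ht => ?_
    obtain ⟨-, b1, b2, -⟩ := s.bounds_reflect hu hv hδ ⟨hx.1.trans ht.1, ht.2⟩
    rw [norm_neg, norm_mul, Complex.norm_exp]
    refine (mul_le_mul_of_nonneg_left (norm_add_mul_le b2 b1) (Real.exp_pos _).le).trans ?_
    have e : Real.exp (-p - q * x).re * (4 * (M + 1) * Real.exp (p.re + q.re * t)
        * (‖f₁ t‖ + ‖f₂ t‖))
        = 4 * (M + 1) * (Real.exp ((-p - q * x).re + (p.re + q.re * t)) * (‖f₁ t‖ + ‖f₂ t‖)) := by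
      rw [Real.exp_add (-p - q * x).re]; ring
    rw [e]
    gcongr
    rw [abs_of_nonpos (sub_nonpos.2 ht.1)]
    simp
    nlinarith [ht.1]
  obtain ⟨⟨c1, c2⟩, -⟩ := s.bounds hu hv hδ hx
  obtain ⟨⟨c3, c4⟩, -⟩ := s.bounds_reflect hu hv hδ hx
  have hdet : Complex.exp (-(p + q) * x) * (f x * k x - g x * h x) = 1 := by
    rw [s.det hx, ← Complex.exp_add, neg_mul, neg_add_cancel, Complex.exp_zero]
  refine (norm_add_norm_le_of_near_identity (A := Complex.exp (-p * x) * M₁)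
    (B := Complex.exp (-p - q * x) * (f 1 * M₂ - h 1 * M₁)) ?_ ?_ c1 c2 c4 c3).trans ?_
  · linear_combination (Complex.exp (-p * x) * M₁) * hdet
  · linear_combination (Complex.exp (-p - q * x) * (f 1 * M₂ - h 1 * M₁)) * hdet
  · rw [intervalIntegral.integral_const_mul] at hA hB
    linarith

/-- Bounds for solutions satisfying one of the two boundary conditions. -/
theorem norm_combination_le (s : IsFundamental p q u v f g h k)
    (hu : ∀ x ∈ Icc (0 : ℝ) 1, ‖u x‖ ≤ M) (hv : ∀ x ∈ Icc (0 : ℝ) 1, ‖v x‖ ≤ M)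
    (hδ : 8 * (M + 1) ^ 2 ≤ (p - q).re) {τ : ℝ} (hp : τ ≤ p.re) (hq : τ ≤ -q.re)
    (α β : ℂ) {x : ℝ} (hx : x ∈ Icc (0 : ℝ) 1) {w : ℂ}
    (hw : w = α * f x + β * (k 1 * f x - g 1 * h x) ∨ w = α * g x + β * (k 1 * g x - g 1 * k x) ∨
      w = α * h x + β * (f 1 * h x - h 1 * f x) ∨ w = α * k x + β * (f 1 * k x - h 1 * g x)) :
    ‖w‖ ≤ 4 * (M + 1) * (‖α‖ + ‖β‖) * Real.exp p.re *
      (Real.exp (-(τ * |1 - x|)) + Real.exp (-(τ * |0 - x|))) := by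
  have hM : 0 ≤ M := (norm_nonneg _).trans (hu 0 (by simp))
  obtain ⟨-, a1, a2, a3, a4⟩ := s.bounds hu hv hδ hx
  obtain ⟨-, b1, b2, b3, b4⟩ := s.bounds_reflect hu hv hδ hx
  have key : ∀ {y z : ℂ}, ‖y‖ ≤ 4 * (M + 1) * Real.exp (p.re * x) →
      ‖z‖ ≤ 4 * (M + 1) * Real.exp (p.re + q.re * x) → ‖α * y + β * z‖ ≤
      4 * (M + 1) * (‖α‖ + ‖β‖) * Real.exp p.re *
      (Real.exp (-(τ * |1 - x|)) + Real.exp (-(τ * |0 - x|))) := by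
    intro y z hy hz
    have e1 : Real.exp (p.re * x) ≤ Real.exp p.re * Real.exp (-(τ * |1 - x|)) := by
      rw [← Real.exp_add, Real.exp_le_exp, abs_of_nonneg (sub_nonneg.2 hx.2)]
      nlinarith [hx.2]
    have e2 : Real.exp (p.re + q.re * x) ≤ Real.exp p.re * Real.exp (-(τ * |0 - x|)) := by
      rw [← Real.exp_add, Real.exp_le_exp, abs_of_nonpos (by linarith [hx.1])]
      nlinarith [hx.1]
    set X := Real.exp p.re * Real.exp (-(τ * |1 - x|))
    set Y := Real.exp p.re * Real.exp (-(τ * |0 - x|))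
    have hX : 0 ≤ X := by positivity
    have hY : 0 ≤ Y := by positivity
    have hy' : ‖y‖ ≤ 4 * (M + 1) * (X + Y) :=
      hy.trans (mul_le_mul_of_nonneg_left (by linarith) (by positivity))
    have hz' : ‖z‖ ≤ 4 * (M + 1) * (X + Y) :=
      hz.trans (mul_le_mul_of_nonneg_left (by linarith) (by positivity))
    rw [mul_comm α, mul_comm β]
    refine (norm_add_mul_le hy' hz').trans_eq ?_
    simp only [X, Y]
    ring
  rcases hw with rfl | rfl | rfl | rfl
  · exact key a1 b4
  · exact key a2 b3
  · exact key a3 b2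
  · exact key a4 b1

end IsFundamental

namespace IsFundamental

variable {p q : ℂ} {u v f g h k : ℝ → ℂ} {M : ℝ}

theorem norm_pairing_le (s : IsFundamental p q u v f g h k)
    (hu : ∀ x ∈ Icc (0 : ℝ) 1, ‖u x‖ ≤ M) (hv : ∀ x ∈ Icc (0 : ℝ) 1, ‖v x‖ ≤ M)
    (hδ : 8 * (M + 1) ^ 2 ≤ (p - q).re) {τ : ℝ} (hp : τ ≤ p.re) (hq : τ ≤ -q.re)
    {f₁ f₂ : ℝ → ℂ} (hf₁ : IntervalIntegrable f₁ volume 0 1)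
    (hf₂ : IntervalIntegrable f₂ volume 0 1) (α β : ℂ) :
    ‖∫ t in (0 : ℝ)..1, ((α * f t + β * (k 1 * f t - g 1 * h t)) * f₁ t
        + (α * g t + β * (k 1 * g t - g 1 * k t)) * f₂ t)‖ ≤
      4 * (M + 1) * (‖α‖ + ‖β‖) * Real.exp p.re *
        ((∫ t in (0 : ℝ)..1, Real.exp (-(τ * |1 - t|)) * (‖f₁ t‖ + ‖f₂ t‖)) +
          ∫ t in (0 : ℝ)..1, Real.exp (-(τ * |0 - t|)) * (‖f₁ t‖ + ‖f₂ t‖)) ∧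
    ‖∫ t in (0 : ℝ)..1, ((α * h t + β * (f 1 * h t - h 1 * f t)) * f₁ t
        + (α * k t + β * (f 1 * k t - h 1 * g t)) * f₂ t)‖ ≤
      4 * (M + 1) * (‖α‖ + ‖β‖) * Real.exp p.re *
        ((∫ t in (0 : ℝ)..1, Real.exp (-(τ * |1 - t|)) * (‖f₁ t‖ + ‖f₂ t‖)) +
          ∫ t in (0 : ℝ)..1, Real.exp (-(τ * |0 - t|)) * (‖f₁ t‖ + ‖f₂ t‖)) := by
  have hM : 0 ≤ M := (norm_nonneg _).trans (hu 0 (by simp))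
  have hF := hf₁.norm.add hf₂.norm
  have hi := ((hF.exp_kernel_mul τ 1).add (hF.exp_kernel_mul τ 0)).const_mul
    (4 * (M + 1) * (‖α‖ + ‖β‖) * Real.exp p.re)
  rw [← intervalIntegral.integral_add (hF.exp_kernel_mul τ 1) (hF.exp_kernel_mul τ 0),
    ← intervalIntegral.integral_const_mul]
  constructor
  all_goals
    refine norm_integral_le_integral_unit hi (fun t => by positivity) le_rfl zero_le_one le_rfl
      fun t ht => ?_
    refine (norm_add_mul_le (s.norm_combination_le hu hv hδ hp hq α β ht (by tauto))
      (s.norm_combination_le hu hv hδ hp hq α β ht (by tauto))).trans_eq ?_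
    ring

/-- The characteristic determinant is dominated by the diagonal entry `k 1`. -/
theorem norm_remainder_le (s : IsFundamental p q u v f g h k) {τ D : ℝ} (h₁ : τ ≤ D)
    (h₂ : p.re + q.re ≤ D - τ) (c d : ℂ) :
    ‖k 1‖ - (‖d‖ + ‖c‖) * Real.exp (D - τ) ≤ ‖d + c * (f 1 * k 1 - g 1 * h 1) + k 1‖ := by
  rw [s.det_one]
  have e : ‖d + c * Complex.exp (p + q)‖ ≤ (‖d‖ + ‖c‖) * Real.exp (D - τ) := by
    refine (norm_add_le _ _).trans ?_
    rw [norm_mul, Complex.norm_exp, add_mul]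
    refine add_le_add (le_mul_of_one_le_right (norm_nonneg _) (Real.one_le_exp (by linarith))) ?_
    gcongr
    simpa using h₂
  have := norm_sub_le (d + c * Complex.exp (p + q) + k 1) (d + c * Complex.exp (p + q))
  rw [add_sub_cancel_left] at this
  linarith

end IsFundamental

/-- An entire function whose quotient by another is entire and small on the diagonals vanishes. -/
theorem eq_zero_of_entire_quotient {F D : ℂ → ℂ} (hD : Differentiable ℂ D) {C : ℝ} (hC : 1 ≤ C)
    (hFb : ∀ z, ‖F z‖ ≤ C * Real.exp (C * ‖z‖)) (hDb : ∀ z, ‖D z‖ ≤ C * Real.exp (C * ‖z‖))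
    (hdiv : ∀ (a : ℂ) (m : ℕ) (h : ℂ → ℂ), ContinuousAt h a →
      (∀ᶠ z in 𝓝 a, D z = (z - a) ^ m * h z) →
        ∃ k : ℂ → ℂ, Differentiable ℂ k ∧ ∀ z, F z = (z - a) ^ m * k z)
    {N : ℕ} {C' R : ℝ} (hC' : 0 ≤ C') (hR : ∀ z : ℂ, |z.re| = |z.im| → R ≤ |z.im| →
      D z ≠ 0 ∧ ‖F z‖ ≤ C' * (1 + ‖z‖) ^ N * ‖D z‖)
    (hlim : Tendsto (fun t : ℝ => F (t * (1 - Complex.I)) / D (t * (1 - Complex.I))) atTop (𝓝 0))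
    (z : ℂ) : F z = 0 := by
  have hz₀ : D (|R| * (1 - Complex.I)) ≠ 0 :=
    (hR _ (by simp) (by simpa using le_abs_self R)).1
  obtain ⟨H, hH, hFH⟩ := exists_entire_quotient hD hz₀ hdiv
  obtain ⟨A, hA⟩ := exists_exponentialType_quotient hH hD hFH hz₀ hC hFb hDb
  have hA0 : 0 ≤ A := by
    have := (norm_nonneg _).trans (hA 0)
    simpa using this
  rw [hFH z, eq_zero_of_growth_on_diagonals N hH ⟨A, hA⟩ ?_ ?_ z, zero_mul]
  · refine ⟨C' + A * Real.exp (A * (2 * |R|)), fun z hz => ?_⟩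
    have h1 : 1 ≤ (1 + ‖z‖) ^ N := one_le_pow₀ (by linarith [norm_nonneg z])
    rcases le_or_gt R |z.im| with hr | hr
    · obtain ⟨h0, hb⟩ := hR z hz hr
      rw [hFH, norm_mul] at hb
      refine (le_of_mul_le_mul_right hb (norm_pos_iff.2 h0)).trans ?_
      gcongr
      have : 0 ≤ A * Real.exp (A * (2 * |R|)) := by positivity
      linarith
    · refine (hA z).trans ?_
      have hn : ‖z‖ ≤ 2 * |R| := by
        refine (Complex.norm_le_abs_re_add_abs_im z).trans ?_
        have := le_abs_self R
        linarith
      have h2 : A * Real.exp (A * ‖z‖) ≤ A * Real.exp (A * (2 * |R|)) := by gcongr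
      have h3 : 0 ≤ A * Real.exp (A * (2 * |R|)) := by positivity
      nlinarith
  · refine hlim.congr' ?_
    filter_upwards [eventually_ge_atTop |R|] with t ht
    have := (hR (t * (1 - Complex.I)) (by simp)
      (by simpa using (le_abs_self R).trans (ht.trans (le_abs_self t)))).1
    rw [hFH, mul_div_cancel_right₀ _ this]

section Pencil

variable {V : Type*} [NormedAddCommGroup V] [NormedSpace ℂ V] [CompleteSpace V]

theorem exists_norm_volterraSolution_le (a b : C(ℝ, V →L[ℂ] V)) (c : V) :
    ∃ C, 0 ≤ C ∧ ∀ z, ‖volterraSolution a b c z‖ ≤ C * Real.exp (C * ‖z‖) := by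
  obtain ⟨A, hA0, hA⟩ := exists_norm_le_on_unitInterval a.continuous.continuousOn
  obtain ⟨B, hB0, hB⟩ := exists_norm_le_on_unitInterval b.continuous.continuousOn
  refine ⟨‖c‖ * Real.exp A + B, by positivity, fun z => ?_⟩
  have key : ‖volterraSolution a b c z‖ ≤ ‖c‖ * Real.exp (A + B * ‖z‖) := by
    refine (ContinuousMap.norm_le _ (by positivity)).2 fun x => ?_
    have hy := volterraSolution_eq a b c z
    set y := volterraSolution a b c z
    have hd : ∀ x, HasDerivAt (fun x => c + ∫ t in (0 : ℝ)..x, (a + z • b) t (extendIcc y t))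
        ((a + z • b) x (extendIcc y x)) x := fun x =>
      (hasDerivAt_volterra_integral (a + z • b) y x).const_add c
    have hg := norm_le_gronwallBound_of_norm_deriv_right_le (δ := ‖c‖) (K := A + B * ‖z‖) (ε := 0)
      (fun t _ => (hd t).continuousAt.continuousWithinAt)
      (fun t _ => (hd t).hasDerivWithinAt) (by simp) (fun t ht => ?_) x x.2
    · rw [← extendIcc_eq_add_integral hy x.2, extendIcc_of_mem y x.2, gronwallBound_ε0] at hg
      refine hg.trans ?_
      gcongr
      rw [sub_zero]
      exact mul_le_of_le_one_right (by positivity) x.2.2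
    · have ht' := Ico_subset_Icc_self ht
      rw [← extendIcc_eq_add_integral hy ht', add_zero]
      refine (ContinuousLinearMap.le_opNorm _ _).trans
        (mul_le_mul_of_nonneg_right ?_ (norm_nonneg _))
      rw [ContinuousMap.add_apply, ContinuousMap.smul_apply]
      refine (norm_add_le _ _).trans (add_le_add (hA t ht') ?_)
      rw [norm_smul, mul_comm]
      exact mul_le_mul_of_nonneg_right (hB t ht') (norm_nonneg _)
  refine key.trans ?_
  rw [Real.exp_add, ← mul_assoc]
  gcongr
  · linarith
  · have : 0 ≤ ‖c‖ * Real.exp A := by positivity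
    linarith

/-- The operator `y ↦ y - y 0 - ∫₀ˣ a y`. -/
def pencilOp (a : C(ℝ, V →L[ℂ] V)) : C(unitInterval, V) →L[ℂ] C(unitInterval, V) :=
  ContinuousLinearMap.id ℂ _ - (constMap V).comp (ContinuousMap.evalCLM ℂ (0 : unitInterval))
    - volterra a

theorem pencilOp_apply (a : C(ℝ, V →L[ℂ] V)) (y : C(unitInterval, V)) :
    pencilOp a y = y - constMap V (y 0) - volterra a y := rfl

theorem volterra_apply_zero (a : C(ℝ, V →L[ℂ] V)) (y : C(unitInterval, V)) :
    volterra a y 0 = 0 := by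
  rw [volterra_apply]
  simp

theorem volterraSolution_apply_zero (a b : C(ℝ, V →L[ℂ] V)) (c : V) (z : ℂ) :
    volterraSolution a b c z 0 = c := by
  rw [volterraSolution_eq, ContinuousMap.add_apply, volterra_apply_zero, add_zero,
    constMap_apply]

theorem pencilOp_volterraSolution (a b : C(ℝ, V →L[ℂ] V)) (c : V) (z : ℂ) :
    pencilOp a (volterraSolution a b c z) = z • volterra b (volterraSolution a b c z) := by
  have h := volterraSolution_eq a b c z
  rw [pencilOp_apply, volterraSolution_apply_zero]
  rw [volterra_add_smul] at h
  conv_lhs => enter [1, 1]; rw [h]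
  rw [add_apply, smul_apply]
  abel

end Pencil

section Dirac

/-- The off-diagonal potential of the system `y₁' = u y₂`, `y₂' = v y₁`. -/
def diracPotential (u v : C(ℝ, ℂ)) : C(ℝ, (ℂ × ℂ) →L[ℂ] (ℂ × ℂ)) where
  toFun t := u t • (ContinuousLinearMap.inl ℂ ℂ ℂ).comp (ContinuousLinearMap.snd ℂ ℂ ℂ)
    + v t • (ContinuousLinearMap.inr ℂ ℂ ℂ).comp (ContinuousLinearMap.fst ℂ ℂ ℂ)
  continuous_toFun := by fun_prop

/-- The constant diagonal matrix with entries `P`, `Q`. -/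
def diracWeight (P Q : ℂ) : C(ℝ, (ℂ × ℂ) →L[ℂ] (ℂ × ℂ)) :=
  ContinuousMap.const _
    (P • (ContinuousLinearMap.inl ℂ ℂ ℂ).comp (ContinuousLinearMap.fst ℂ ℂ ℂ)
      + Q • (ContinuousLinearMap.inr ℂ ℂ ℂ).comp (ContinuousLinearMap.snd ℂ ℂ ℂ))

theorem diracPotential_apply (u v : C(ℝ, ℂ)) (t : ℝ) (y : ℂ × ℂ) :
    diracPotential u v t y = (u t * y.2, v t * y.1) := by
  ext <;> simp [diracPotential]

theorem diracWeight_apply (P Q : ℂ) (t : ℝ) (y : ℂ × ℂ) :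
    diracWeight P Q t y = (P * y.1, Q * y.2) := by
  ext <;> simp [diracWeight]

/-- The solution of the Dirac type system with spectral parameter `z` and initial value `c`. -/
def diracSolution (P Q : ℂ) (u v : C(ℝ, ℂ)) (c : ℂ × ℂ) (z : ℂ) : C(unitInterval, ℂ × ℂ) :=
  volterraSolution (diracPotential u v) (diracWeight P Q) c z

theorem exists_isSol_diracSolution (P Q : ℂ) (u v : C(ℝ, ℂ)) (c : ℂ × ℂ) (z : ℂ) :
    ∃ y₁ y₂ : ℝ → ℂ, IsSol (z * P) (z * Q) u v y₁ y₂ ∧ y₁ 0 = c.1 ∧ y₂ 0 = c.2 ∧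
      ∀ t ∈ Icc (0 : ℝ) 1, extendIcc (diracSolution P Q u v c z) t = (y₁ t, y₂ t) := by
  have hy := volterraSolution_eq (diracPotential u v) (diracWeight P Q) c z
  rw [← diracSolution] at hy
  set y := diracSolution P Q u v c z
  set a := diracPotential u v + z • diracWeight P Q with ha
  set w : ℝ → ℂ × ℂ := fun x => c + ∫ t in (0 : ℝ)..x, a t (extendIcc y t) with hw
  have hyw : ∀ t ∈ Icc (0 : ℝ) 1, extendIcc y t = w t := fun t ht =>
    extendIcc_eq_add_integral hy ht
  refine ⟨fun x => (w x).1, fun x => (w x).2, fun x hx => ?_, by simp [hw], by simp [hw], hyw⟩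
  have hd : HasDerivAt w (a x (extendIcc y x)) x :=
    (hasDerivAt_volterra_integral a y x).const_add c
  rw [hyw x hx, ha, ContinuousMap.add_apply, ContinuousMap.smul_apply, add_apply, smul_apply,
    diracPotential_apply, diracWeight_apply] at hd
  refine ⟨((ContinuousLinearMap.fst ℝ ℂ ℂ).hasFDerivAt.comp_hasDerivAt x hd).congr_deriv ?_,
    ((ContinuousLinearMap.snd ℝ ℂ ℂ).hasFDerivAt.comp_hasDerivAt x hd).congr_deriv ?_⟩
  · simp only [Prod.smul_mk, Prod.mk_add_mk, smul_eq_mul, ContinuousLinearMap.coe_fst']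
    ring
  · simp only [Prod.smul_mk, Prod.mk_add_mk, smul_eq_mul, ContinuousLinearMap.coe_snd']
    ring

theorem exists_isFundamental (P Q : ℂ) (u v : C(ℝ, ℂ)) (z : ℂ) :
    ∃ f g h k : ℝ → ℂ, IsFundamental (z * P) (z * Q) u v f g h k ∧
      (∀ t ∈ Icc (0 : ℝ) 1, extendIcc (diracSolution P Q u v (1, 0) z) t = (f t, g t)) ∧
      ∀ t ∈ Icc (0 : ℝ) 1, extendIcc (diracSolution P Q u v (0, 1) z) t = (h t, k t) := by
  obtain ⟨f, g, h1, h2, h3, h4⟩ := exists_isSol_diracSolution P Q u v (1, 0) z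
  obtain ⟨h, k, h5, h6, h7, h8⟩ := exists_isSol_diracSolution P Q u v (0, 1) z
  exact ⟨f, g, h, k, ⟨h1, h5, h2, h3, h6, h7⟩, h4, h8⟩

theorem solvesDirac_of_pencil {b₁ b₂ : ℝ} (hb₁ : b₁ ≠ 0) (hb₂ : b₂ ≠ 0) {Q12 Q21 : ℝ → ℂ}
    {u v : C(ℝ, ℂ)} (hu : ∀ t ∈ Icc (0 : ℝ) 1, u t = -(Complex.I * b₁) * Q12 t)
    (hv : ∀ t ∈ Icc (0 : ℝ) 1, v t = -(Complex.I * b₂) * Q21 t) {lam : ℂ}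
    {y r : C(unitInterval, ℂ × ℂ)}
    (h : pencilOp (diracPotential u v) y
      = lam • volterra (diracWeight (Complex.I * b₁) (Complex.I * b₂)) y
        + volterra (diracWeight (Complex.I * b₁) (Complex.I * b₂)) r) :
    SolvesDirac b₁ b₂ Q12 Q21 (extendIcc y) (fun x => lam • extendIcc y x + extendIcc r x) := by
  set w := diracWeight (Complex.I * b₁) (Complex.I * b₂) with hw
  have c1 := continuous_volterra_integrand (diracPotential u v) y
  have c2 : Continuous fun t => lam • w t (extendIcc y t) :=
    (continuous_volterra_integrand w y).const_smul lam
  have c3 := continuous_volterra_integrand w r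
  have c4 : Continuous fun t => diracPotential u v t (extendIcc y t) + lam • w t (extendIcc y t) :=
    c1.add c2
  refine ⟨fun t => diracPotential u v t (extendIcc y t) + lam • w t (extendIcc y t)
    + w t (extendIcc r t), (c4.add c3).continuousOn.integrableOn_Icc, fun x hx => ?_, ?_⟩
  · beta_reduce
    rw [intervalIntegral.integral_add (c4.intervalIntegrable _ _)
      (c3.intervalIntegrable _ _), intervalIntegral.integral_add (c1.intervalIntegrable _ _)
      (c2.intervalIntegrable _ _), intervalIntegral.integral_smul]
    have := congrArg (fun F : C(unitInterval, ℂ × ℂ) => F ⟨x, hx⟩) h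
    simp only [pencilOp_apply, ContinuousMap.sub_apply, ContinuousMap.add_apply,
      ContinuousMap.smul_apply, constMap_apply, volterra_apply] at this
    rw [extendIcc_of_mem y hx, extendIcc_of_mem y (left_mem_Icc.2 zero_le_one)]
    rw [sub_sub, sub_eq_iff_eq_add] at this
    rw [this]
    change _ = y 0 + _
    abel
  · refine (ae_restrict_iff' measurableSet_Icc).2 (Eventually.of_forall fun x hx => ?_)
    have e1 : (b₁ : ℂ) ≠ 0 := by exact_mod_cast hb₁
    have e2 : (b₂ : ℂ) ≠ 0 := by exact_mod_cast hb₂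
    simp only [hw, diracPotential_apply, diracWeight_apply, hu x hx, hv x hx, Prod.fst_add,
      Prod.snd_add, Prod.smul_fst, Prod.smul_snd, smul_eq_mul]
    have hI := Complex.I_mul_I
    constructor
    · field_simp
      linear_combination
        (Q12 x * (extendIcc y x).2 - lam * (extendIcc y x).1 - (extendIcc r x).1) * hI
    · field_simp
      linear_combination
        (Q21 x * (extendIcc y x).1 - lam * (extendIcc y x).2 - (extendIcc r x).2) * hI

end Dirac

theorem integral_exp_kernel_le {F : ℝ → ℝ} (hF : IntervalIntegrable F volume 0 1)
    (hF0 : ∀ t, 0 ≤ F t) {τ : ℝ} (hτ : 0 ≤ τ) (x : ℝ) :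
    ∫ t in (0 : ℝ)..1, Real.exp (-(τ * |x - t|)) * F t ≤ ∫ t in (0 : ℝ)..1, F t := by
  refine intervalIntegral.integral_mono_on zero_le_one (hF.exp_kernel_mul τ x) hF fun t _ => ?_
  refine mul_le_of_le_one_left (hF0 t) (Real.exp_le_one_iff.2 ?_)
  have := mul_nonneg hτ (abs_nonneg (x - t))
  linarith

namespace IsFundamental

variable {u v : ℝ → ℂ} {M : ℝ} {b₁ b₂ : ℝ} {f₁ f₂ : ℝ → ℂ}

theorem exists_quotient_bound_upper (hb₁ : b₁ < 0) (hb₂ : 0 < b₂)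
    (hu : ∀ x ∈ Icc (0 : ℝ) 1, ‖u x‖ ≤ M) (hv : ∀ x ∈ Icc (0 : ℝ) 1, ‖v x‖ ≤ M)
    (huc : Continuous u) (hvc : Continuous v) {ω ω' : ℂ} (hω : ω ≠ 0) (hω' : ω' ≠ 0) {j j' : ℕ}
    (hju : (fun s : ℝ => u s - ω * s ^ j) =o[𝓝[>] 0] fun s : ℝ => s ^ j)
    (hjv : (fun s : ℝ => v (1 - s) - ω' * s ^ j') =o[𝓝[>] 0] fun s : ℝ => s ^ j')
    (hf₁ : IntervalIntegrable f₁ volume 0 1) (hf₂ : IntervalIntegrable f₂ volume 0 1) (c d : ℂ) :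
    ∃ C, 0 ≤ C ∧ ∃ K : ℕ, ∃ R, ∀ (z : ℂ) (f g h k : ℝ → ℂ),
      IsFundamental (z * (Complex.I * b₁)) (z * (Complex.I * b₂)) u v f g h k →
      |z.re| = |z.im| → R ≤ z.im →
      d + c * (f 1 * k 1 - g 1 * h 1) + k 1 ≠ 0 ∧
      ‖∫ t in (0 : ℝ)..1, ((d * f t + 1 * (k 1 * f t - g 1 * h t)) * f₁ t
        + (d * g t + 1 * (k 1 * g t - g 1 * k t)) * f₂ t)‖ ≤
        C * (1 + ‖z‖) ^ K * ‖d + c * (f 1 * k 1 - g 1 * h 1) + k 1‖ ∧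
      ‖∫ t in (0 : ℝ)..1, ((1 * h t + c * (f 1 * h t - h 1 * f t)) * f₁ t
        + (1 * k t + c * (f 1 * k t - h 1 * g t)) * f₂ t)‖ ≤
        C * (1 + ‖z‖) ^ K * ‖d + c * (f 1 * k 1 - g 1 * h 1) + k 1‖ := by
  have hM : 0 ≤ M := (norm_nonneg _).trans (hu 0 (by simp))
  have hF := hf₁.norm.add hf₂.norm
  obtain ⟨c₀, hc₀, K, δ₀, H⟩ := exists_le_norm_k_one hu hv huc hvc hω hω' hju hjv
  set β := b₂ - b₁ with hβ
  have hβ0 : 0 < β := by linarith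
  set τ₀ := min (-b₁) b₂ with hτ₀
  have hτ₀0 : 0 < τ₀ := lt_min (by linarith) hb₂
  have hτ1 : τ₀ ≤ -b₁ := min_le_left _ _
  have hτ2 : τ₀ ≤ b₂ := min_le_right _ _
  obtain ⟨R₀, HR⟩ := eventually_atTop.1
    (eventually_mul_pow_le_exp ((‖d‖ + ‖c‖) / (c₀ / 2 / β ^ K)) K hτ₀0)
  set J := ∫ t in (0 : ℝ)..1, (‖f₁ t‖ + ‖f₂ t‖) with hJ
  have hJ0 : 0 ≤ J := intervalIntegral.integral_nonneg zero_le_one fun t _ => by positivity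
  set S := ‖d‖ + ‖c‖ + 1 with hS
  refine ⟨4 * (M + 1) * S * (J + J) / (c₀ / 2 / β ^ K), by positivity, K,
    max (max R₀ 1) (max (δ₀ / β) (8 * (M + 1) ^ 2 / β)), fun z f g h k s hz hR => ?_⟩
  simp only [max_le_iff] at hR
  obtain ⟨⟨r1, r2⟩, r3, r4⟩ := hR
  rw [div_le_iff₀ hβ0] at r3 r4
  set η := z.im with hη
  have hη0 : 0 < η := by linarith
  have ep : (z * (Complex.I * b₁)).re = -b₁ * η := by simp; ring
  have eq : (z * (Complex.I * b₂)).re = -b₂ * η := by simp; ring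
  have ed : (z * (Complex.I * b₁) - z * (Complex.I * b₂)).re = η * β := by
    rw [Complex.sub_re, ep, eq]; ring
  have en : ‖z * (Complex.I * b₁) - z * (Complex.I * b₂)‖ ≤ 2 * (η * β) := by
    have e : z * (Complex.I * b₁) - z * (Complex.I * b₂) = z * (Complex.I * ((-β : ℝ) : ℂ)) := by
      rw [hβ]; push_cast; ring
    have hn := Complex.norm_le_abs_re_add_abs_im z
    rw [hz, ← hη, abs_of_pos hη0] at hn
    rw [e, norm_mul, norm_mul, Complex.norm_I, Complex.norm_real, norm_neg,
      Real.norm_of_nonneg hβ0.le, one_mul]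
    nlinarith
  have hk := H _ _ _ _ _ _ s (by rwa [ed]) (by rwa [ed])
  rw [ed, ep] at hk
  have hτη : 0 ≤ τ₀ * η := by positivity
  have hrem := s.norm_remainder_le (τ := τ₀ * η) (D := -b₁ * η) (by gcongr)
    (by rw [ep, eq]; nlinarith) c d
  set Δ := d + c * (f 1 * k 1 - g 1 * h 1) + k 1
  set X := c₀ / 2 / β ^ K / η ^ K * Real.exp (-b₁ * η) with hX
  have hX0 : 0 < X := by positivity
  have hsmall : (‖d‖ + ‖c‖) * Real.exp (-b₁ * η - τ₀ * η) ≤ X := by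
    have := HR η r1
    rw [Real.exp_sub, hX, mul_div_assoc', div_le_iff₀ (Real.exp_pos _)]
    have e : (‖d‖ + ‖c‖) = c₀ / 2 / β ^ K / η ^ K * ((‖d‖ + ‖c‖) / (c₀ / 2 / β ^ K) * η ^ K) := by
      field_simp
    calc (‖d‖ + ‖c‖) * Real.exp (-b₁ * η)
        = c₀ / 2 / β ^ K / η ^ K * ((‖d‖ + ‖c‖) / (c₀ / 2 / β ^ K) * η ^ K)
          * Real.exp (-b₁ * η) := by rw [← e]
      _ ≤ c₀ / 2 / β ^ K / η ^ K * Real.exp (τ₀ * η) * Real.exp (-b₁ * η) := by gcongr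
      _ = _ := by ring
  have hk' : 2 * X ≤ ‖k 1‖ := by
    refine le_trans (le_of_eq ?_) hk
    rw [hX, mul_pow]
    field_simp
  have hΔ : X ≤ ‖Δ‖ := by linarith
  have hzη : η ^ K ≤ (1 + ‖z‖) ^ K := by
    gcongr
    have := Complex.im_le_norm z
    linarith
  have fin : ∀ {w : ℂ} {α β' : ℂ}, ‖α‖ + ‖β'‖ ≤ S → ‖w‖ ≤ 4 * (M + 1) * (‖α‖ + ‖β'‖) *
      Real.exp (-b₁ * η) *
        ((∫ t in (0 : ℝ)..1, Real.exp (-(τ₀ * η * |1 - t|)) * (‖f₁ t‖ + ‖f₂ t‖)) +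
          ∫ t in (0 : ℝ)..1, Real.exp (-(τ₀ * η * |0 - t|)) * (‖f₁ t‖ + ‖f₂ t‖)) →
      ‖w‖ ≤ 4 * (M + 1) * S * (J + J) / (c₀ / 2 / β ^ K) * (1 + ‖z‖) ^ K * ‖Δ‖ := by
    intro w α β' hα hw
    refine hw.trans ?_
    calc _ ≤ 4 * (M + 1) * S * Real.exp (-b₁ * η) * (J + J) := by
          gcongr
          · exact add_nonneg
              (intervalIntegral.integral_nonneg zero_le_one fun t _ => by positivity)
              (intervalIntegral.integral_nonneg zero_le_one fun t _ => by positivity)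
          · exact integral_exp_kernel_le hF (fun t => by positivity) hτη 1
          · exact integral_exp_kernel_le hF (fun t => by positivity) hτη 0
      _ = 4 * (M + 1) * S * (J + J) / (c₀ / 2 / β ^ K) * η ^ K * X := by
          rw [hX]; field_simp
      _ ≤ _ := by gcongr
  obtain ⟨h1, -⟩ := s.norm_pairing_le hu hv (by rwa [ed]) (τ := τ₀ * η) (by rw [ep]; gcongr)
    (by rw [eq]; nlinarith) hf₁ hf₂ d 1
  obtain ⟨-, h2⟩ := s.norm_pairing_le hu hv (by rwa [ed]) (τ := τ₀ * η) (by rw [ep]; gcongr)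
    (by rw [eq]; nlinarith) hf₁ hf₂ 1 c
  rw [ep] at h1 h2
  refine ⟨norm_pos_iff.1 (hX0.trans_le hΔ), fin ?_ h1, fin ?_ h2⟩
  · rw [norm_one]; linarith [norm_nonneg c]
  · rw [norm_one]; linarith [norm_nonneg d]

theorem exists_quotient_bound_lower (hb₁ : b₁ < 0) (hb₂ : 0 < b₂)
    (hu : ∀ x ∈ Icc (0 : ℝ) 1, ‖u x‖ ≤ M) (hv : ∀ x ∈ Icc (0 : ℝ) 1, ‖v x‖ ≤ M)
    (hf₁ : IntervalIntegrable f₁ volume 0 1) (hf₂ : IntervalIntegrable f₂ volume 0 1) (c d : ℂ) :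
    ∃ C, 0 ≤ C ∧ ∃ R, ∀ (z : ℂ) (f g h k : ℝ → ℂ),
      IsFundamental (z * (Complex.I * b₁)) (z * (Complex.I * b₂)) u v f g h k → R ≤ -z.im →
      d + c * (f 1 * k 1 - g 1 * h 1) + k 1 ≠ 0 ∧
      ‖∫ t in (0 : ℝ)..1, ((d * f t + 1 * (k 1 * f t - g 1 * h t)) * f₁ t
        + (d * g t + 1 * (k 1 * g t - g 1 * k t)) * f₂ t)‖ ≤
        C * ((∫ t in (0 : ℝ)..1, Real.exp (-(min (-b₁) b₂ * -z.im * |1 - t|)) * (‖f₁ t‖ + ‖f₂ t‖)) +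
          ∫ t in (0 : ℝ)..1, Real.exp (-(min (-b₁) b₂ * -z.im * |0 - t|)) * (‖f₁ t‖ + ‖f₂ t‖)) *
            ‖d + c * (f 1 * k 1 - g 1 * h 1) + k 1‖ ∧
      ‖∫ t in (0 : ℝ)..1, ((1 * h t + c * (f 1 * h t - h 1 * f t)) * f₁ t
        + (1 * k t + c * (f 1 * k t - h 1 * g t)) * f₂ t)‖ ≤
        C * ((∫ t in (0 : ℝ)..1, Real.exp (-(min (-b₁) b₂ * -z.im * |1 - t|)) * (‖f₁ t‖ + ‖f₂ t‖)) +
          ∫ t in (0 : ℝ)..1, Real.exp (-(min (-b₁) b₂ * -z.im * |0 - t|)) * (‖f₁ t‖ + ‖f₂ t‖)) *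
            ‖d + c * (f 1 * k 1 - g 1 * h 1) + k 1‖ := by
  have hM : 0 ≤ M := (norm_nonneg _).trans (hu 0 (by simp))
  set β := b₂ - b₁ with hβ
  have hβ0 : 0 < β := by linarith
  set τ₀ := min (-b₁) b₂ with hτ₀
  have hτ₀0 : 0 < τ₀ := lt_min (by linarith) hb₂
  have hτ1 : τ₀ ≤ -b₁ := min_le_left _ _
  have hτ2 : τ₀ ≤ b₂ := min_le_right _ _
  obtain ⟨R₀, HR⟩ := eventually_atTop.1
    (eventually_mul_pow_le_exp (4 * (‖d‖ + ‖c‖)) 0 hτ₀0)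
  set S := ‖d‖ + ‖c‖ + 1 with hS
  refine ⟨4 * (M + 1) * S * 2, by positivity,
    max (max R₀ 1) (8 * (M + 1) ^ 2 / β), fun z f g h k s hR => ?_⟩
  simp only [max_le_iff] at hR
  obtain ⟨⟨r1, r2⟩, r4⟩ := hR
  rw [div_le_iff₀ hβ0] at r4
  set η := -z.im with hη
  have hη0 : 0 < η := by linarith
  have ep : (z * (Complex.I * b₁)).re = b₁ * η := by simp [hη]; ring
  have eq : (z * (Complex.I * b₂)).re = b₂ * η := by simp [hη]; ring
  have ed : (z * (Complex.I * b₂) - z * (Complex.I * b₁)).re = η * β := by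
    rw [Complex.sub_re, ep, eq]; ring
  have hτη : 0 ≤ τ₀ * η := by positivity
  have hrem := s.norm_remainder_le (τ := τ₀ * η) (D := b₂ * η) (by gcongr)
    (by rw [ep, eq]; nlinarith) c d
  obtain ⟨⟨a1, -⟩, -⟩ := s.swap.bounds hv hu (by rwa [ed]) (right_mem_Icc.2 zero_le_one)
  have hk : 3 / 4 * Real.exp (b₂ * η) ≤ ‖k 1‖ := by
    have h1 := norm_sub_norm_le 1 (Complex.exp (-(z * (Complex.I * b₂)) * (1 : ℝ)) * k 1)
    rw [norm_sub_rev, norm_one, norm_mul, norm_cexp_neg_mul, mul_one, eq] at h1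
    have h2 : 3 / 4 ≤ (Real.exp (b₂ * η))⁻¹ * ‖k 1‖ := by linarith
    rwa [le_inv_mul_iff₀ (Real.exp_pos _), mul_comm] at h2
  set Δ := d + c * (f 1 * k 1 - g 1 * h 1) + k 1
  have hsmall : (‖d‖ + ‖c‖) * Real.exp (b₂ * η - τ₀ * η) ≤ Real.exp (b₂ * η) / 4 := by
    have := HR η r1
    rw [pow_zero, mul_one] at this
    rw [Real.exp_sub, mul_div_assoc', div_le_iff₀ (Real.exp_pos _)]
    nlinarith [Real.exp_pos (b₂ * η)]
  have he := Real.exp_pos (b₂ * η)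
  have hΔ : Real.exp (b₂ * η) / 2 ≤ ‖Δ‖ := by linarith
  set T := (∫ t in (0 : ℝ)..1, Real.exp (-(τ₀ * η * |1 - t|)) * (‖f₁ t‖ + ‖f₂ t‖)) +
          ∫ t in (0 : ℝ)..1, Real.exp (-(τ₀ * η * |0 - t|)) * (‖f₁ t‖ + ‖f₂ t‖) with hT
  have hT0 : 0 ≤ T := add_nonneg
    (intervalIntegral.integral_nonneg zero_le_one fun t _ => by positivity)
    (intervalIntegral.integral_nonneg zero_le_one fun t _ => by positivity)
  have hT' : T = (∫ t in (0 : ℝ)..1, Real.exp (-(τ₀ * η * |1 - t|)) * (‖f₂ t‖ + ‖f₁ t‖)) +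
          ∫ t in (0 : ℝ)..1, Real.exp (-(τ₀ * η * |0 - t|)) * (‖f₂ t‖ + ‖f₁ t‖) := by
    simp only [hT, add_comm ‖f₁ _‖]
  have fin : ∀ {w : ℂ} {α β' : ℂ}, ‖α‖ + ‖β'‖ ≤ S → ‖w‖ ≤ 4 * (M + 1) * (‖α‖ + ‖β'‖) *
      Real.exp (b₂ * η) * T → ‖w‖ ≤ 4 * (M + 1) * S * 2 * T * ‖Δ‖ := by
    intro w α β' hα hw
    refine hw.trans ?_
    calc _ ≤ 4 * (M + 1) * S * Real.exp (b₂ * η) * T := by gcongr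
      _ = 4 * (M + 1) * S * 2 * T * (Real.exp (b₂ * η) / 2) := by ring
      _ ≤ _ := by gcongr
  obtain ⟨-, h1⟩ := s.swap.norm_pairing_le hv hu (by rwa [ed]) (τ := τ₀ * η)
    (by rw [eq]; gcongr) (by rw [ep]; nlinarith) hf₂ hf₁ d 1
  obtain ⟨h2, -⟩ := s.swap.norm_pairing_le hv hu (by rwa [ed]) (τ := τ₀ * η)
    (by rw [eq]; gcongr) (by rw [ep]; nlinarith) hf₂ hf₁ 1 c
  rw [eq, ← hT'] at h1 h2
  refine ⟨norm_pos_iff.1 (by linarith), fin (α := d) (β' := 1) ?_ ?_,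
    fin (α := 1) (β' := c) ?_ ?_⟩
  · rw [norm_one]; linarith [norm_nonneg c]
  · convert h1 using 4
    ring
  · rw [norm_one]; linarith [norm_nonneg d]
  · convert h2 using 4
    ring

end IsFundamental

section ExpType

variable {E F : Type*} [NormedAddCommGroup E] [NormedAddCommGroup F]

/-- A function of at most exponential growth on the plane. -/
def HasExpGrowth (φ : ℂ → E) : Prop := ∃ C, 1 ≤ C ∧ ∀ z, ‖φ z‖ ≤ C * Real.exp (C * ‖z‖)

theorem HasExpGrowth.of_le {φ : ℂ → E} {C : ℝ} (hC : ∀ z, ‖φ z‖ ≤ C * Real.exp (C * ‖z‖)) :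
    HasExpGrowth φ := by
  refine ⟨max 1 C, le_max_left _ _, fun z => (hC z).trans ?_⟩
  gcongr <;> exact le_max_right _ _

theorem HasExpGrowth.const (c : E) : HasExpGrowth fun _ => c := by
  refine .of_le (C := ‖c‖) fun z => le_mul_of_one_le_right (norm_nonneg _) (Real.one_le_exp ?_)
  positivity

theorem HasExpGrowth.add {φ ψ : ℂ → E} (h₁ : HasExpGrowth φ) (h₂ : HasExpGrowth ψ) :
    HasExpGrowth fun z => φ z + ψ z := by
  obtain ⟨C₁, hC₁, h₁⟩ := h₁
  obtain ⟨C₂, hC₂, h₂⟩ := h₂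
  refine .of_le (C := C₁ + C₂) fun z => (norm_add_le _ _).trans ?_
  rw [add_mul C₁ C₂ (Real.exp _)]
  refine add_le_add ((h₁ z).trans ?_) ((h₂ z).trans ?_) <;> gcongr <;> linarith

variable [NormedSpace ℂ E] [NormedSpace ℂ F]

theorem HasExpGrowth.smul {φ : ℂ → ℂ} {ψ : ℂ → E} (h₁ : HasExpGrowth φ) (h₂ : HasExpGrowth ψ) :
    HasExpGrowth fun z => φ z • ψ z := by
  obtain ⟨C₁, hC₁, h₁⟩ := h₁
  obtain ⟨C₂, hC₂, h₂⟩ := h₂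
  refine .of_le (C := C₁ * C₂ + C₁ + C₂) fun z => ?_
  rw [norm_smul]
  refine (mul_le_mul (h₁ z) (h₂ z) (norm_nonneg _) (by positivity)).trans ?_
  rw [mul_mul_mul_comm, ← Real.exp_add, ← add_mul]
  gcongr <;> nlinarith

theorem HasExpGrowth.mul {φ ψ : ℂ → ℂ} (h₁ : HasExpGrowth φ) (h₂ : HasExpGrowth ψ) :
    HasExpGrowth fun z => φ z * ψ z :=
  h₁.smul h₂

theorem HasExpGrowth.sub {φ ψ : ℂ → E} (h₁ : HasExpGrowth φ) (h₂ : HasExpGrowth ψ) :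
    HasExpGrowth fun z => φ z - ψ z := by
  simpa [sub_eq_add_neg] using h₁.add ((HasExpGrowth.const (-1)).smul h₂)

theorem HasExpGrowth.clm {φ : ℂ → E} (h : HasExpGrowth φ) (L : E →L[ℂ] F) :
    HasExpGrowth fun z => L (φ z) := by
  obtain ⟨C, hC, h⟩ := h
  refine .of_le (C := (‖L‖ + 1) * C) fun z => (L.le_opNorm _).trans ?_
  have h1 : C ≤ (‖L‖ + 1) * C := by nlinarith [norm_nonneg L]
  calc ‖L‖ * ‖φ z‖ ≤ (‖L‖ + 1) * (C * Real.exp (C * ‖z‖)) := by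
        gcongr
        · linarith
        · exact h z
    _ ≤ _ := by
      rw [← mul_assoc]
      gcongr

end ExpType

section Pairing

variable {f₁ f₂ : ℝ → ℂ}

theorem intervalIntegrable_pairing (hf₁ : IntervalIntegrable f₁ volume 0 1)
    (hf₂ : IntervalIntegrable f₂ volume 0 1) (y : C(unitInterval, ℂ × ℂ)) {x : ℝ}
    (hx : x ∈ Icc (0 : ℝ) 1) :
    IntervalIntegrable (fun t => (extendIcc y t).1 * f₁ t + (extendIcc y t).2 * f₂ t)
      volume 0 x := by
  have hs : uIcc 0 x ⊆ uIcc (0 : ℝ) 1 := by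
    rw [uIcc_of_le hx.1, uIcc_of_le zero_le_one]
    exact Icc_subset_Icc le_rfl hx.2
  have hc := continuous_extendIcc y
  exact (((hf₁.mono_set hs).continuousOn_mul hc.fst.continuousOn).add
    ((hf₂.mono_set hs).continuousOn_mul hc.snd.continuousOn))

/-- The functional `y ↦ ∫₀ˣ (y₁ f₁ + y₂ f₂)` as a linear map. -/
def pairingLinear (hf₁ : IntervalIntegrable f₁ volume 0 1) (hf₂ : IntervalIntegrable f₂ volume 0 1)
    {x : ℝ} (hx : x ∈ Icc (0 : ℝ) 1) : C(unitInterval, ℂ × ℂ) →ₗ[ℂ] ℂ where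
  toFun y := ∫ t in (0 : ℝ)..x, ((extendIcc y t).1 * f₁ t + (extendIcc y t).2 * f₂ t)
  map_add' y z := by
    rw [← intervalIntegral.integral_add (intervalIntegrable_pairing hf₁ hf₂ y hx)
      (intervalIntegrable_pairing hf₁ hf₂ z hx)]
    congr 1 with t
    simp only [extendIcc, ContinuousMap.add_apply, Prod.fst_add, Prod.snd_add]
    ring
  map_smul' c y := by
    rw [RingHom.id_apply, smul_eq_mul, ← intervalIntegral.integral_const_mul]
    congr 1 with t
    simp only [extendIcc, ContinuousMap.smul_apply, Prod.smul_fst, Prod.smul_snd, smul_eq_mul]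
    ring

/-- The functional `y ↦ ∫₀ˣ (y₁ f₁ + y₂ f₂)`. -/
def pairing (hf₁ : IntervalIntegrable f₁ volume 0 1) (hf₂ : IntervalIntegrable f₂ volume 0 1)
    {x : ℝ} (hx : x ∈ Icc (0 : ℝ) 1) : C(unitInterval, ℂ × ℂ) →L[ℂ] ℂ :=
  (pairingLinear hf₁ hf₂ hx).mkContinuous (∫ t in (0 : ℝ)..x, (‖f₁ t‖ + ‖f₂ t‖)) fun y => by
      have hs : uIcc 0 x ⊆ uIcc (0 : ℝ) 1 := by
        rw [uIcc_of_le hx.1, uIcc_of_le zero_le_one]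
        exact Icc_subset_Icc le_rfl hx.2
      rw [mul_comm, ← intervalIntegral.integral_const_mul]
      change ‖∫ t in (0 : ℝ)..x, ((extendIcc y t).1 * f₁ t + (extendIcc y t).2 * f₂ t)‖ ≤ _
      refine intervalIntegral.norm_integral_le_of_norm_le hx.1
        (Eventually.of_forall fun t _ => ?_)
        (((hf₁.mono_set hs).norm.add (hf₂.mono_set hs).norm).const_mul _)
      have h := norm_extendIcc_le y t
      refine (norm_add_le _ _).trans ?_
      rw [norm_mul, norm_mul, mul_add]
      gcongr
      · exact (norm_fst_le _).trans h
      · exact (norm_snd_le _).trans h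

theorem pairing_apply (hf₁ : IntervalIntegrable f₁ volume 0 1)
    (hf₂ : IntervalIntegrable f₂ volume 0 1) {x : ℝ} (hx : x ∈ Icc (0 : ℝ) 1)
    (y : C(unitInterval, ℂ × ℂ)) :
    pairing hf₁ hf₂ hx y
      = ∫ t in (0 : ℝ)..x, ((extendIcc y t).1 * f₁ t + (extendIcc y t).2 * f₂ t) := rfl

theorem pairing_eq_of_eqOn (hf₁ : IntervalIntegrable f₁ volume 0 1)
    (hf₂ : IntervalIntegrable f₂ volume 0 1) {x : ℝ} (hx : x ∈ Icc (0 : ℝ) 1)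
    {y : C(unitInterval, ℂ × ℂ)} {f g : ℝ → ℂ}
    (h : ∀ t ∈ Icc (0 : ℝ) 1, extendIcc y t = (f t, g t)) :
    pairing hf₁ hf₂ hx y = ∫ t in (0 : ℝ)..x, (f t * f₁ t + g t * f₂ t) := by
  rw [pairing_apply]
  refine intervalIntegral.integral_congr fun t ht => ?_
  rw [uIcc_of_le hx.1] at ht
  simp only [h t ⟨ht.1, ht.2.trans hx.2⟩]

end Pairing

section Dirac

variable (P Q : ℂ) (u v : C(ℝ, ℂ)) (c : ℂ × ℂ)

theorem differentiable_diracSolution : Differentiable ℂ (diracSolution P Q u v c) :=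
  differentiable_volterraSolution _ _ _

theorem hasExpGrowth_diracSolution : HasExpGrowth (diracSolution P Q u v c) := by
  obtain ⟨C, -, hC⟩ := exists_norm_volterraSolution_le (diracPotential u v) (diracWeight P Q) c
  exact .of_le hC

theorem pencilOp_diracSolution (z : ℂ) :
    pencilOp (diracPotential u v) (diracSolution P Q u v c z)
      = z • volterra (diracWeight P Q) (diracSolution P Q u v c z) :=
  pencilOp_volterraSolution _ _ _ _

theorem diracSolution_zero (z : ℂ) : diracSolution P Q u v c z 0 = c :=
  volterraSolution_apply_zero _ _ _ _

end Dirac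

theorem functional_eq_zero_of_bounds {X Y : Type*} [NormedAddCommGroup X] [NormedSpace ℂ X]
    [CompleteSpace X] [NormedAddCommGroup Y] [NormedSpace ℂ Y] {A B : X →L[ℂ] Y}
    {U₁ U₂ L : X →L[ℂ] ℂ} {w : ℂ → X} (hw : Differentiable ℂ w) (hwe : HasExpGrowth w)
    (hAB : ∀ z, A (w z) = z • B (w z)) {D : ℂ → ℂ} (hD : Differentiable ℂ D)
    (hDe : HasExpGrowth D) {κ₁ κ₂ : ℂ} (hU₁ : ∀ z, U₁ (w z) = κ₁ * D z)
    (hU₂ : ∀ z, U₂ (w z) = κ₂ * D z)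
    (hL : ∀ (a : ℂ) (m : ℕ) (u : ℕ → X), u 0 ≠ 0 → (∀ k ≤ m, U₁ (u k) = 0 ∧ U₂ (u k) = 0) →
      A (u 0) = a • B (u 0) → (∀ k, A (u (k + 1)) = a • B (u (k + 1)) + B (u k)) →
      ∀ k ≤ m, L (u k) = 0)
    {C C' R R' J : ℝ} {K : ℕ} {T : ℝ → ℝ} (hC : 0 ≤ C) (hC' : 0 ≤ C')
    (hTJ : ∀ η, 0 ≤ η → T η ≤ J) (hT0 : ∀ η, 0 ≤ T η) (hT : Tendsto T atTop (𝓝 0))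
    (hup : ∀ z : ℂ, |z.re| = |z.im| → R ≤ z.im →
      D z ≠ 0 ∧ ‖L (w z)‖ ≤ C * (1 + ‖z‖) ^ K * ‖D z‖)
    (hlow : ∀ z : ℂ, R' ≤ -z.im → D z ≠ 0 ∧ ‖L (w z)‖ ≤ C' * T (-z.im) * ‖D z‖) (z : ℂ) :
    L (w z) = 0 := by
  obtain ⟨C₁, hC₁, h₁⟩ := hwe.clm L
  obtain ⟨C₂, hC₂, h₂⟩ := hDe
  have hJ : 0 ≤ J := (hT0 0).trans (hTJ 0 le_rfl)
  refine eq_zero_of_entire_quotient (F := fun z => L (w z)) hD (C := max C₁ C₂)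
    (le_max_of_le_left hC₁) (fun z => (h₁ z).trans ?_) (fun z => (h₂ z).trans ?_)
    (exists_eq_pow_mul_functional hw hAB hU₁ hU₂ hL) (N := K) (C' := max C (C' * J))
    (R := max R R') (le_max_of_le_left hC) (fun z hz hR => ?_) ?_ z
  · gcongr <;> exact le_max_left _ _
  · gcongr <;> exact le_max_right _ _
  · rcases le_total 0 z.im with h0 | h0
    · rw [abs_of_nonneg h0] at hR
      obtain ⟨a1, a2⟩ := hup z hz ((le_max_left _ _).trans hR)
      refine ⟨a1, a2.trans ?_⟩
      gcongr
      exact le_max_left _ _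
    · rw [abs_of_nonpos h0] at hR
      obtain ⟨a1, a2⟩ := hlow z ((le_max_right _ _).trans hR)
      refine ⟨a1, a2.trans ?_⟩
      refine mul_le_mul_of_nonneg_right ?_ (norm_nonneg _)
      refine (mul_le_mul_of_nonneg_left (hTJ (-z.im) (by linarith)) hC').trans
        ((le_max_right _ _).trans (le_mul_of_one_le_right (le_max_of_le_left hC) ?_))
      exact one_le_pow₀ (by linarith [norm_nonneg z])
  · refine squeeze_zero_norm' ?_ (by simpa using hT.const_mul C')
    filter_upwards [eventually_ge_atTop R'] with t ht
    have e : -((t : ℂ) * (1 - Complex.I)).im = t := by simp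
    obtain ⟨a1, a2⟩ := hlow (t * (1 - Complex.I)) (by rwa [e])
    rw [norm_div, div_le_iff₀ (norm_pos_iff.2 a1)]
    rwa [e] at a2

section Vanishing

variable {b₁ b₂ : ℝ} {u v : C(ℝ, ℂ)} {f₁ f₂ : ℝ → ℂ}

theorem pairing_diracSolution_eq_zero (hb₁ : b₁ < 0) (hb₂ : 0 < b₂)
    {ω ω' : ℂ} (hω : ω ≠ 0) (hω' : ω' ≠ 0) {j j' : ℕ}
    (hju : (fun s : ℝ => u s - ω * s ^ j) =o[𝓝[>] 0] fun s : ℝ => s ^ j)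
    (hjv : (fun s : ℝ => v (1 - s) - ω' * s ^ j') =o[𝓝[>] 0] fun s : ℝ => s ^ j')
    (hf₁ : IntervalIntegrable f₁ volume 0 1) (hf₂ : IntervalIntegrable f₂ volume 0 1) {c d : ℂ}
    (hcd : c * d = 0)
    (hL : ∀ (a : ℂ) (m : ℕ) (y : ℕ → C(unitInterval, ℂ × ℂ)), y 0 ≠ 0 →
      (∀ k ≤ m, (y k 0).1 + c * (y k 1).1 = 0 ∧ d * (y k 0).2 + (y k 1).2 = 0) →
      pencilOp (diracPotential u v) (y 0)
        = a • volterra (diracWeight (Complex.I * b₁) (Complex.I * b₂)) (y 0) →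
      (∀ k, pencilOp (diracPotential u v) (y (k + 1))
        = a • volterra (diracWeight (Complex.I * b₁) (Complex.I * b₂)) (y (k + 1))
          + volterra (diracWeight (Complex.I * b₁) (Complex.I * b₂)) (y k)) →
      ∀ k ≤ m, pairing hf₁ hf₂ (right_mem_Icc.2 zero_le_one) (y k) = 0) (z : ℂ) :
    pairing hf₁ hf₂ (right_mem_Icc.2 zero_le_one)
        (diracSolution (Complex.I * b₁) (Complex.I * b₂) u v (1, 0) z) = 0 ∧
      pairing hf₁ hf₂ (right_mem_Icc.2 zero_le_one)
        (diracSolution (Complex.I * b₁) (Complex.I * b₂) u v (0, 1) z) = 0 := by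
  obtain ⟨Mu, -, hMu⟩ := exists_norm_le_on_unitInterval u.continuous.continuousOn
  obtain ⟨Mv, -, hMv⟩ := exists_norm_le_on_unitInterval v.continuous.continuousOn
  have hu : ∀ x ∈ Icc (0 : ℝ) 1, ‖u x‖ ≤ max Mu Mv := fun x hx => (hMu x hx).trans (le_max_left _ _)
  have hv : ∀ x ∈ Icc (0 : ℝ) 1, ‖v x‖ ≤ max Mu Mv :=
    fun x hx => (hMv x hx).trans (le_max_right _ _)
  obtain ⟨C, hC, K, R, hup⟩ := IsFundamental.exists_quotient_bound_upper hb₁ hb₂ hu hv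
    u.continuous v.continuous hω hω' hju hjv hf₁ hf₂ c d
  obtain ⟨C', hC', R', hlow⟩ := IsFundamental.exists_quotient_bound_lower hb₁ hb₂ hu hv
    hf₁ hf₂ c d
  set w := diracWeight (Complex.I * b₁) (Complex.I * b₂) with hw
  set L := pairing hf₁ hf₂ (right_mem_Icc.2 zero_le_one) with hLdef
  set Φ := diracSolution (Complex.I * b₁) (Complex.I * b₂) u v (1, 0) with hΦ
  set Ψ := diracSolution (Complex.I * b₁) (Complex.I * b₂) u v (0, 1) with hΨ
  have dΦ : Differentiable ℂ Φ := differentiable_diracSolution _ _ _ _ _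
  have dΨ : Differentiable ℂ Ψ := differentiable_diracSolution _ _ _ _ _
  have eΦ : HasExpGrowth Φ := hasExpGrowth_diracSolution _ _ _ _ _
  have eΨ : HasExpGrowth Ψ := hasExpGrowth_diracSolution _ _ _ _ _
  have pΦ : ∀ z, pencilOp (diracPotential u v) (Φ z) = z • volterra w (Φ z) :=
    pencilOp_diracSolution _ _ _ _ _
  have pΨ : ∀ z, pencilOp (diracPotential u v) (Ψ z) = z • volterra w (Ψ z) :=
    pencilOp_diracSolution _ _ _ _ _
  have zΦ : ∀ z, Φ z 0 = (1, 0) := diracSolution_zero _ _ _ _ _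
  have zΨ : ∀ z, Ψ z 0 = (0, 1) := diracSolution_zero _ _ _ _ _
  let fs (x : unitInterval) : C(unitInterval, ℂ × ℂ) →L[ℂ] ℂ :=
    (ContinuousLinearMap.fst ℂ ℂ ℂ).comp (ContinuousMap.evalCLM ℂ x)
  let sn (x : unitInterval) : C(unitInterval, ℂ × ℂ) →L[ℂ] ℂ :=
    (ContinuousLinearMap.snd ℂ ℂ ℂ).comp (ContinuousMap.evalCLM ℂ x)
  have fs_apply : ∀ x y, fs x y = (y x).1 := fun _ _ => rfl
  have sn_apply : ∀ x y, sn x y = (y x).2 := fun _ _ => rfl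
  set D : ℂ → ℂ := fun z => d + c * (fs 1 (Φ z) * sn 1 (Ψ z) - sn 1 (Φ z) * fs 1 (Ψ z))
    + sn 1 (Ψ z) with hDdef
  have dD : Differentiable ℂ D := by fun_prop
  have eD : HasExpGrowth D :=
    ((HasExpGrowth.const d).add ((HasExpGrowth.const c).mul
      (((eΦ.clm (fs 1)).mul (eΨ.clm (sn 1))).sub ((eΦ.clm (sn 1)).mul (eΨ.clm (fs 1)))))).add
      (eΨ.clm (sn 1))
  set T : ℝ → ℝ := fun η =>
    (∫ t in (0 : ℝ)..1, Real.exp (-(min (-b₁) b₂ * η * |1 - t|)) * (‖f₁ t‖ + ‖f₂ t‖)) +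
      ∫ t in (0 : ℝ)..1, Real.exp (-(min (-b₁) b₂ * η * |0 - t|)) * (‖f₁ t‖ + ‖f₂ t‖) with hTdef
  have hF := hf₁.norm.add hf₂.norm
  have hτ : 0 < min (-b₁) b₂ := lt_min (by linarith) hb₂
  have hT0 : ∀ η, 0 ≤ T η := fun η => add_nonneg
    (intervalIntegral.integral_nonneg zero_le_one fun t _ => by positivity)
    (intervalIntegral.integral_nonneg zero_le_one fun t _ => by positivity)
  have hTJ : ∀ η, 0 ≤ η → T η ≤ (∫ t in (0 : ℝ)..1, (‖f₁ t‖ + ‖f₂ t‖)) +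
      ∫ t in (0 : ℝ)..1, (‖f₁ t‖ + ‖f₂ t‖) := fun η hη => add_le_add
    (integral_exp_kernel_le hF (fun t => by positivity) (by positivity) 1)
    (integral_exp_kernel_le hF (fun t => by positivity) (by positivity) 0)
  have hT : Tendsto T atTop (𝓝 0) := by
    have h := tendsto_id.const_mul_atTop (α := ℝ) hτ
    simpa [hTdef, Function.comp_def] using ((tendsto_integral_exp_kernel hF 1).comp h).add
      ((tendsto_integral_exp_kernel hF 0).comp h)
  have hmem : (1 : ℝ) ∈ Icc (0 : ℝ) 1 := right_mem_Icc.2 zero_le_one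
  have hfund : ∀ z, ∃ f g h k : ℝ → ℂ,
      IsFundamental (z * (Complex.I * b₁)) (z * (Complex.I * b₂)) u v f g h k ∧
      (∀ t ∈ Icc (0 : ℝ) 1, extendIcc (Φ z) t = (f t, g t)) ∧
      (∀ t ∈ Icc (0 : ℝ) 1, extendIcc (Ψ z) t = (h t, k t)) ∧
      fs 1 (Φ z) = f 1 ∧ sn 1 (Φ z) = g 1 ∧ fs 1 (Ψ z) = h 1 ∧ sn 1 (Ψ z) = k 1 ∧
      D z = d + c * (f 1 * k 1 - g 1 * h 1) + k 1 := fun z => by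
    obtain ⟨f, g, h, k, s, h1, h2⟩ := exists_isFundamental (Complex.I * b₁) (Complex.I * b₂) u v z
    have e1 : Φ z 1 = (f 1, g 1) := by rw [← h1 1 hmem, extendIcc_of_mem _ hmem]; rfl
    have e2 : Ψ z 1 = (h 1, k 1) := by rw [← h2 1 hmem, extendIcc_of_mem _ hmem]; rfl
    refine ⟨f, g, h, k, s, h1, h2, ?_, ?_, ?_, ?_, ?_⟩ <;>
      simp only [hDdef, fs_apply, sn_apply, e1, e2]
  set w₁ : ℂ → C(unitInterval, ℂ × ℂ) := fun z =>
    d • Φ z + (sn 1 (Ψ z) • Φ z - sn 1 (Φ z) • Ψ z) with hw₁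
  set w₂ : ℂ → C(unitInterval, ℂ × ℂ) := fun z =>
    Ψ z + c • (fs 1 (Φ z) • Ψ z - fs 1 (Ψ z) • Φ z) with hw₂
  have L₁ : ∀ (z : ℂ) (f g h k : ℝ → ℂ), (∀ t ∈ Icc (0 : ℝ) 1, extendIcc (Φ z) t = (f t, g t)) →
      (∀ t ∈ Icc (0 : ℝ) 1, extendIcc (Ψ z) t = (h t, k t)) →
      sn 1 (Φ z) = g 1 → sn 1 (Ψ z) = k 1 → L (w₁ z) =
        ∫ t in (0 : ℝ)..1, ((d * f t + 1 * (k 1 * f t - g 1 * h t)) * f₁ t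
          + (d * g t + 1 * (k 1 * g t - g 1 * k t)) * f₂ t) := fun z f g h k h1 h2 a1 a2 => by
    refine pairing_eq_of_eqOn (f := fun t => d * f t + 1 * (k 1 * f t - g 1 * h t))
      (g := fun t => d * g t + 1 * (k 1 * g t - g 1 * k t)) _ _ _ fun t ht => ?_
    have e1 := h1 t ht
    have e2 := h2 t ht
    rw [extendIcc_of_mem _ ht] at e1 e2 ⊢
    simp [hw₁, a1, a2, e1, e2]
  have L₂ : ∀ (z : ℂ) (f g h k : ℝ → ℂ), (∀ t ∈ Icc (0 : ℝ) 1, extendIcc (Φ z) t = (f t, g t)) →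
      (∀ t ∈ Icc (0 : ℝ) 1, extendIcc (Ψ z) t = (h t, k t)) →
      fs 1 (Φ z) = f 1 → fs 1 (Ψ z) = h 1 → L (w₂ z) =
        ∫ t in (0 : ℝ)..1, ((1 * h t + c * (f 1 * h t - h 1 * f t)) * f₁ t
          + (1 * k t + c * (f 1 * k t - h 1 * g t)) * f₂ t) := fun z f g h k h1 h2 a1 a2 => by
    refine pairing_eq_of_eqOn (f := fun t => 1 * h t + c * (f 1 * h t - h 1 * f t))
      (g := fun t => 1 * k t + c * (f 1 * k t - h 1 * g t)) _ _ _ fun t ht => ?_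
    have e1 := h1 t ht
    have e2 := h2 t ht
    rw [extendIcc_of_mem _ ht] at e1 e2 ⊢
    simp [hw₂, a1, a2, e1, e2]
  have up : ∀ z : ℂ, |z.re| = |z.im| → R ≤ z.im → D z ≠ 0 ∧
      ‖L (w₁ z)‖ ≤ C * (1 + ‖z‖) ^ K * ‖D z‖ ∧ ‖L (w₂ z)‖ ≤ C * (1 + ‖z‖) ^ K * ‖D z‖ := by
    intro z hz hR
    obtain ⟨f, g, h, k, s, h1, h2, a1, a2, a3, a4, a5⟩ := hfund z
    rw [a5, L₁ z f g h k h1 h2 a2 a4, L₂ z f g h k h1 h2 a1 a3]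
    exact hup z f g h k s hz hR
  have low : ∀ z : ℂ, R' ≤ -z.im → D z ≠ 0 ∧
      ‖L (w₁ z)‖ ≤ C' * T (-z.im) * ‖D z‖ ∧ ‖L (w₂ z)‖ ≤ C' * T (-z.im) * ‖D z‖ := by
    intro z hR
    obtain ⟨f, g, h, k, s, h1, h2, a1, a2, a3, a4, a5⟩ := hfund z
    rw [a5, L₁ z f g h k h1 h2 a2 a4, L₂ z f g h k h1 h2 a1 a3]
    exact hlow z f g h k s hR
  have z₁ : ∀ z, L (w₁ z) = 0 := by
    refine functional_eq_zero_of_bounds (A := pencilOp (diracPotential u v)) (B := volterra w)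
      (U₁ := fs 0 + c • fs 1) (U₂ := d • sn 0 + sn 1) (κ₁ := 1) (κ₂ := 0) (w := w₁)
      (K := K) (R := R) (R' := R')
      (by fun_prop) (((HasExpGrowth.const d).smul eΦ).add
        (((eΨ.clm (sn 1)).smul eΦ).sub ((eΦ.clm (sn 1)).smul eΨ))) (fun z => ?_) dD eD
      (fun z => ?_) (fun z => ?_) hL hC hC' hTJ hT0 hT (fun z hz hR => ?_) (fun z hR => ?_)
    · simp only [hw₁, map_add, map_sub, map_smul, pΦ, pΨ]
      module
    · simp only [hw₁, hDdef, add_apply, smul_apply, map_add, map_sub, map_smul, smul_eq_mul]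
      simp only [fs_apply, sn_apply, zΦ, zΨ]
      linear_combination (Φ z 1).1 * hcd
    · simp only [hw₁, hDdef, add_apply, smul_apply, map_add, map_sub, map_smul, smul_eq_mul]
      simp only [fs_apply, sn_apply, zΦ, zΨ]
      ring
    · exact ⟨(up z hz hR).1, (up z hz hR).2.1⟩
    · exact ⟨(low z hR).1, (low z hR).2.1⟩
  have z₂ : ∀ z, L (w₂ z) = 0 := by
    refine functional_eq_zero_of_bounds (A := pencilOp (diracPotential u v)) (B := volterra w)
      (U₁ := fs 0 + c • fs 1) (U₂ := d • sn 0 + sn 1) (κ₁ := 0) (κ₂ := 1) (w := w₂)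
      (K := K) (R := R) (R' := R')
      (by fun_prop) (eΨ.add ((HasExpGrowth.const c).smul
        (((eΦ.clm (fs 1)).smul eΨ).sub ((eΨ.clm (fs 1)).smul eΦ)))) (fun z => ?_) dD eD
      (fun z => ?_) (fun z => ?_) hL hC hC' hTJ hT0 hT (fun z hz hR => ?_) (fun z hR => ?_)
    · simp only [hw₂, map_add, map_sub, map_smul, pΦ, pΨ]
      module
    · simp only [hw₂, hDdef, add_apply, smul_apply, map_add, map_sub, map_smul, smul_eq_mul]
      simp only [fs_apply, sn_apply, zΦ, zΨ]
      ring
    · simp only [hw₂, hDdef, add_apply, smul_apply, map_add, map_sub, map_smul, smul_eq_mul]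
      simp only [fs_apply, sn_apply, zΦ, zΨ]
      linear_combination (Φ z 1).1 * hcd
    · exact ⟨(up z hz hR).1, (up z hz hR).2.2⟩
    · exact ⟨(low z hR).1, (low z hR).2.2⟩
  have hprod : ∀ z, D z * L (Φ z) = 0 ∧ D z * L (Ψ z) = 0 := fun z => by
    have e1 := z₁ z
    have e2 := z₂ z
    simp only [hw₁, hw₂, map_add, map_sub, map_smul, smul_eq_mul] at e1 e2
    constructor
    · simp only [hDdef]
      linear_combination (1 + c * fs 1 (Φ z)) * e1 + sn 1 (Φ z) * e2 - fs 1 (Φ z) * L (Φ z) * hcd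
    · simp only [hDdef]
      linear_combination (d + sn 1 (Ψ z)) * e2 + c * fs 1 (Ψ z) * e1 - fs 1 (Φ z) * L (Ψ z) * hcd
  have hne : ∃ z, D z ≠ 0 := ⟨_, (low (-R' * Complex.I) (by simp)).1⟩
  have fin : ∀ G : ℂ → ℂ, Differentiable ℂ G → (∀ z, D z * G z = 0) → ∀ z, G z = 0 := by
    intro G hG h
    have h1 : AnalyticOnNhd ℂ D univ := fun z _ => dD.analyticAt z
    have h2 : AnalyticOnNhd ℂ G univ := fun z _ => hG.analyticAt z
    rcases h1.eq_zero_or_eq_zero_of_mul_eq_zero h2 (fun z _ => h z) isPreconnected_univ with h | h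
    · obtain ⟨z, hz⟩ := hne
      exact absurd (h z trivial) hz
    · exact fun z => h z trivial
  exact ⟨fin _ (by fun_prop) (fun z => (hprod z).1) z, fin _ (by fun_prop) (fun z => (hprod z).2) z⟩

end Vanishing

theorem eq_zero_of_hasExpGrowth_of_bounds {G : ℂ → ℂ} (hG : Differentiable ℂ G)
    (hGe : HasExpGrowth G) {R J : ℝ} {T : ℝ → ℝ} (hTJ : ∀ η, 0 ≤ η → T η ≤ J)
    (hT0 : ∀ η, 0 ≤ T η) (hT : Tendsto T atTop (𝓝 0))
    (h : ∀ z : ℂ, R ≤ |z.im| → ‖G z‖ ≤ T |z.im|) (z : ℂ) : G z = 0 := by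
  obtain ⟨C, hC, hGC⟩ := hGe
  have hJ : 0 ≤ J := (hT0 0).trans (hTJ 0 le_rfl)
  refine eq_zero_of_entire_quotient (D := fun _ => 1) (by fun_prop) hC hGC (fun z => ?_)
    (fun a m g _ hg => ?_) (N := 0) (R := R) hJ (fun z _ hR => ⟨one_ne_zero, ?_⟩) ?_ z
  · rw [norm_one]
    exact one_le_mul_of_one_le_of_one_le hC (Real.one_le_exp (by positivity))
  · cases m with
    | zero => exact ⟨G, hG, fun z => by simp⟩
    | succ m => simpa using hg.self_of_nhds
  · simpa using (h z hR).trans (hTJ _ (abs_nonneg _))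
  · simp only [div_one]
    refine squeeze_zero_norm' ?_ hT
    filter_upwards [eventually_ge_atTop R, eventually_ge_atTop 0] with t ht ht0
    have e : |((t : ℂ) * (1 - Complex.I)).im| = t := by simpa using ht0
    have := h (t * (1 - Complex.I)) (by rwa [e])
    rwa [e] at this

theorem ae_eq_zero_of_forall_integral_eq_zero {E : Type*} [NormedAddCommGroup E]
    [NormedSpace ℝ E] [CompleteSpace E] {F : ℝ → E} (hF : IntervalIntegrable F volume 0 1)
    (h : ∀ x ∈ Icc (0 : ℝ) 1, ∫ t in (0 : ℝ)..x, F t = 0) :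
    ∀ᵐ x, x ∈ Ioo (0 : ℝ) 1 → F x = 0 := by
  filter_upwards [hF.ae_hasDerivAt_integral] with x hx hx01
  have hd := hx (Icc_subset_uIcc (Ioo_subset_Icc_self hx01)) 0 left_mem_uIcc
  refine hd.unique ((hasDerivAt_const x (0 : E)).congr_of_eventuallyEq ?_)
  filter_upwards [isOpen_Ioo.mem_nhds hx01] with y hy
  exact h y (Ioo_subset_Icc_self hy)

section Determinacy

variable {b₁ b₂ : ℝ} {u v : C(ℝ, ℂ)} {f₁ f₂ : ℝ → ℂ}

theorem IsFundamental.norm_coordinates_im_le {f g h k : ℝ → ℂ} {z : ℂ}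
    (s : IsFundamental (z * (Complex.I * b₁)) (z * (Complex.I * b₂)) u v f g h k)
    {M : ℝ} (hu : ∀ x ∈ Icc (0 : ℝ) 1, ‖u x‖ ≤ M)
    (hv : ∀ x ∈ Icc (0 : ℝ) 1, ‖v x‖ ≤ M) (hz : 8 * (M + 1) ^ 2 ≤ |z.im| * (b₂ - b₁))
    (hf₁ : IntervalIntegrable f₁ volume 0 1) (hf₂ : IntervalIntegrable f₂ volume 0 1)
    (h₁ : ∫ t in (0 : ℝ)..1, (f t * f₁ t + g t * f₂ t) = 0)
    (h₂ : ∫ t in (0 : ℝ)..1, (h t * f₁ t + k t * f₂ t) = 0) {x : ℝ} (hx : x ∈ Icc (0 : ℝ) 1) :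
    ‖Complex.exp (-(z * (Complex.I * b₁) + z * (Complex.I * b₂)) * x)
        * ((∫ t in (0 : ℝ)..x, (f t * f₁ t + g t * f₂ t)) * k x
          - (∫ t in (0 : ℝ)..x, (h t * f₁ t + k t * f₂ t)) * g x)‖ +
      ‖Complex.exp (-(z * (Complex.I * b₁) + z * (Complex.I * b₂)) * x)
        * ((∫ t in (0 : ℝ)..x, (h t * f₁ t + k t * f₂ t)) * f x
          - (∫ t in (0 : ℝ)..x, (f t * f₁ t + g t * f₂ t)) * h x)‖ ≤
      16 * (M + 1) * ∫ t in (0 : ℝ)..1,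
        Real.exp (-(min (-b₁) b₂ * |z.im| * |x - t|)) * (‖f₁ t‖ + ‖f₂ t‖) := by
  have ep : (z * (Complex.I * b₁)).re = -b₁ * z.im := by simp; ring
  have eq : (z * (Complex.I * b₂)).re = -b₂ * z.im := by simp; ring
  have m1 := mul_le_mul_of_nonneg_right (min_le_left (-b₁) b₂) (abs_nonneg z.im)
  have m2 := mul_le_mul_of_nonneg_right (min_le_right (-b₁) b₂) (abs_nonneg z.im)
  rcases le_total 0 z.im with h0 | h0
  · rw [abs_of_nonneg h0] at hz m1 m2 ⊢
    exact s.norm_coordinates_le hu hv (by rw [Complex.sub_re, ep, eq]; linarith)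
      (by rwa [ep]) (by rw [eq]; linarith) hf₁ hf₂ h₁ h₂ hx
  · rw [abs_of_nonpos h0] at hz m1 m2 ⊢
    have c1 : ∀ y, ∫ t in (0 : ℝ)..y, (f t * f₁ t + g t * f₂ t)
        = ∫ t in (0 : ℝ)..y, (g t * f₂ t + f t * f₁ t) := fun y => by simp only [add_comm]
    have c2 : ∀ y, ∫ t in (0 : ℝ)..y, (h t * f₁ t + k t * f₂ t)
        = ∫ t in (0 : ℝ)..y, (k t * f₂ t + h t * f₁ t) := fun y => by simp only [add_comm]
    rw [c1] at h₁ ⊢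
    rw [c2] at h₂ ⊢
    have := s.swap.norm_coordinates_le hv hu (by rw [Complex.sub_re, ep, eq]; linarith)
      (τ := min (-b₁) b₂ * -z.im) (by rw [eq]; linarith) (by rw [ep]; linarith) hf₂ hf₁ h₂ h₁ hx
    rw [add_comm (z * (Complex.I * b₂)), add_comm] at this
    simpa only [add_comm ‖f₂ _‖] using this

theorem ae_eq_zero_of_pairing_diracSolution (hb₁ : b₁ < 0) (hb₂ : 0 < b₂)
    (hf₁ : IntervalIntegrable f₁ volume 0 1) (hf₂ : IntervalIntegrable f₂ volume 0 1)
    (hL : ∀ z, pairing hf₁ hf₂ (right_mem_Icc.2 zero_le_one)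
        (diracSolution (Complex.I * b₁) (Complex.I * b₂) u v (1, 0) z) = 0 ∧
      pairing hf₁ hf₂ (right_mem_Icc.2 zero_le_one)
        (diracSolution (Complex.I * b₁) (Complex.I * b₂) u v (0, 1) z) = 0) :
    ∀ᵐ x, x ∈ Ioo (0 : ℝ) 1 → f₁ x = 0 ∧ f₂ x = 0 := by
  obtain ⟨Mu, -, hMu⟩ := exists_norm_le_on_unitInterval u.continuous.continuousOn
  obtain ⟨Mv, -, hMv⟩ := exists_norm_le_on_unitInterval v.continuous.continuousOn
  have hu : ∀ x ∈ Icc (0 : ℝ) 1, ‖u x‖ ≤ max Mu Mv := fun x hx => (hMu x hx).trans (le_max_left _ _)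
  have hv : ∀ x ∈ Icc (0 : ℝ) 1, ‖v x‖ ≤ max Mu Mv :=
    fun x hx => (hMv x hx).trans (le_max_right _ _)
  set M := max Mu Mv
  have hM : 0 ≤ M := (norm_nonneg _).trans (hu 0 (by simp))
  have hF := hf₁.norm.add hf₂.norm
  have hτ : 0 < min (-b₁) b₂ := lt_min (by linarith) hb₂
  have hβ : 0 < b₂ - b₁ := by linarith
  have key : ∀ x (hx : x ∈ Icc (0 : ℝ) 1) z,
      pairing hf₁ hf₂ hx (diracSolution (Complex.I * b₁) (Complex.I * b₂) u v (1, 0) z) = 0 ∧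
      pairing hf₁ hf₂ hx (diracSolution (Complex.I * b₁) (Complex.I * b₂) u v (0, 1) z) = 0 := by
    intro x hx
    set Φ := diracSolution (Complex.I * b₁) (Complex.I * b₂) u v (1, 0) with hΦ
    set Ψ := diracSolution (Complex.I * b₁) (Complex.I * b₂) u v (0, 1) with hΨ
    have dΦ : Differentiable ℂ Φ := differentiable_diracSolution _ _ _ _ _
    have dΨ : Differentiable ℂ Ψ := differentiable_diracSolution _ _ _ _ _
    have eΦ : HasExpGrowth Φ := hasExpGrowth_diracSolution _ _ _ _ _
    have eΨ : HasExpGrowth Ψ := hasExpGrowth_diracSolution _ _ _ _ _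
    let fs : C(unitInterval, ℂ × ℂ) →L[ℂ] ℂ :=
      (ContinuousLinearMap.fst ℂ ℂ ℂ).comp (ContinuousMap.evalCLM ℂ ⟨x, hx⟩)
    let sn : C(unitInterval, ℂ × ℂ) →L[ℂ] ℂ :=
      (ContinuousLinearMap.snd ℂ ℂ ℂ).comp (ContinuousMap.evalCLM ℂ ⟨x, hx⟩)
    set L := pairing hf₁ hf₂ hx
    set e : ℂ → ℂ := fun z =>
      Complex.exp (-(z * (Complex.I * b₁) + z * (Complex.I * b₂)) * x) with he
    have de : Differentiable ℂ e := by fun_prop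
    have ee : HasExpGrowth e := by
      refine ⟨max 1 ‖(Complex.I * b₁ + Complex.I * b₂) * x‖, le_max_left _ _, fun z => ?_⟩
      have : ‖e z‖ ≤ 1 * Real.exp (‖(Complex.I * b₁ + Complex.I * b₂) * x‖ * ‖z‖) := by
        rw [one_mul, ← norm_mul, Complex.norm_exp]
        refine Real.exp_le_exp.2 ((Complex.re_le_norm _).trans (le_of_eq ?_))
        rw [← norm_neg]
        congr 1
        ring
      refine this.trans ?_
      gcongr
      · exact le_max_left _ _
      · exact le_max_right _ _
    set G₁ : ℂ → ℂ := fun z => e z * (L (Φ z) * sn (Ψ z) - L (Ψ z) * sn (Φ z)) with hG₁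
    set G₂ : ℂ → ℂ := fun z => e z * (L (Ψ z) * fs (Φ z) - L (Φ z) * fs (Ψ z)) with hG₂
    have eG₁ : HasExpGrowth G₁ := ee.mul (((eΦ.clm L).mul (eΨ.clm sn)).sub
      ((eΨ.clm L).mul (eΦ.clm sn)))
    have eG₂ : HasExpGrowth G₂ := ee.mul (((eΨ.clm L).mul (eΦ.clm fs)).sub
      ((eΦ.clm L).mul (eΨ.clm fs)))
    set T : ℝ → ℝ := fun η => 16 * (M + 1) * ∫ t in (0 : ℝ)..1,
        Real.exp (-(min (-b₁) b₂ * η * |x - t|)) * (‖f₁ t‖ + ‖f₂ t‖) with hTdef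
    have hT0 : ∀ η, 0 ≤ T η := fun η => mul_nonneg (by positivity)
      (intervalIntegral.integral_nonneg zero_le_one fun t _ => by positivity)
    have hTJ : ∀ η, 0 ≤ η → T η ≤ 16 * (M + 1) * ∫ t in (0 : ℝ)..1, (‖f₁ t‖ + ‖f₂ t‖) :=
      fun η hη => mul_le_mul_of_nonneg_left
        (integral_exp_kernel_le hF (fun t => by positivity) (by positivity) x) (by positivity)
    have hT : Tendsto T atTop (𝓝 0) := by
      have h := tendsto_id.const_mul_atTop (α := ℝ) hτ
      simpa [hTdef, Function.comp_def] using
        ((tendsto_integral_exp_kernel hF x).comp h).const_mul (16 * (M + 1))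
    have hfund : ∀ z, ∃ f g h k : ℝ → ℂ,
        IsFundamental (z * (Complex.I * b₁)) (z * (Complex.I * b₂)) u v f g h k ∧
        (∀ y (hy : y ∈ Icc (0 : ℝ) 1), pairing hf₁ hf₂ hy (Φ z)
          = ∫ t in (0 : ℝ)..y, (f t * f₁ t + g t * f₂ t)) ∧
        (∀ y (hy : y ∈ Icc (0 : ℝ) 1), pairing hf₁ hf₂ hy (Ψ z)
          = ∫ t in (0 : ℝ)..y, (h t * f₁ t + k t * f₂ t)) ∧
        fs (Φ z) = f x ∧ sn (Φ z) = g x ∧ fs (Ψ z) = h x ∧ sn (Ψ z) = k x := fun z => by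
      obtain ⟨f, g, h, k, s, h1, h2⟩ := exists_isFundamental (Complex.I * b₁) (Complex.I * b₂) u v z
      have e1 : Φ z ⟨x, hx⟩ = (f x, g x) := by rw [← h1 x hx, extendIcc_of_mem _ hx]
      have e2 : Ψ z ⟨x, hx⟩ = (h x, k x) := by rw [← h2 x hx, extendIcc_of_mem _ hx]
      exact ⟨f, g, h, k, s, fun y hy => pairing_eq_of_eqOn hf₁ hf₂ hy h1,
        fun y hy => pairing_eq_of_eqOn hf₁ hf₂ hy h2, congrArg Prod.fst e1, congrArg Prod.snd e1,
        congrArg Prod.fst e2, congrArg Prod.snd e2⟩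
    have hbound : ∀ z : ℂ, 8 * (M + 1) ^ 2 / (b₂ - b₁) ≤ |z.im| →
        ‖G₁ z‖ + ‖G₂ z‖ ≤ T |z.im| := by
      intro z hz
      rw [div_le_iff₀ hβ] at hz
      obtain ⟨f, g, h, k, s, h1, h2, a1, a2, a3, a4⟩ := hfund z
      simp only [hG₁, hG₂, a1, a2, a3, a4, L, h1, h2]
      refine s.norm_coordinates_im_le hu hv hz hf₁ hf₂ ?_ ?_ hx
      · rw [← h1 1 (right_mem_Icc.2 zero_le_one)]
        exact (hL z).1
      · rw [← h2 1 (right_mem_Icc.2 zero_le_one)]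
        exact (hL z).2
    have g₁ := eq_zero_of_hasExpGrowth_of_bounds (by fun_prop) eG₁ hTJ hT0 hT
      fun z hz => (le_add_of_nonneg_right (norm_nonneg _)).trans (hbound z hz)
    have g₂ := eq_zero_of_hasExpGrowth_of_bounds (by fun_prop) eG₂ hTJ hT0 hT
      fun z hz => (le_add_of_nonneg_left (norm_nonneg _)).trans (hbound z hz)
    intro z
    obtain ⟨f, g, h, k, s, h1, h2, a1, a2, a3, a4⟩ := hfund z
    have c1 := (mul_eq_zero.1 (g₁ z)).resolve_left (Complex.exp_ne_zero _)
    have c2 := (mul_eq_zero.1 (g₂ z)).resolve_left (Complex.exp_ne_zero _)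
    have hdet := s.det hx
    have hE := Complex.exp_ne_zero ((z * (Complex.I * b₁) + z * (Complex.I * b₂)) * x)
    rw [← hdet] at hE
    rw [a1, a2, a3, a4] at *
    refine ⟨(mul_eq_zero.1 ?_).resolve_left hE, (mul_eq_zero.1 ?_).resolve_left hE⟩
    · linear_combination f x * c1 + g x * c2
    · linear_combination h x * c1 + k x * c2
  obtain ⟨f, g, h, k, s, h1, h2⟩ := exists_isFundamental (Complex.I * b₁) (Complex.I * b₂) u v 0
  have n1 := ae_eq_zero_of_forall_integral_eq_zero (s.fst.intervalIntegrable_mul_add hf₁ hf₂)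
    fun x hx => by rw [← pairing_eq_of_eqOn hf₁ hf₂ hx h1]; exact (key x hx 0).1
  have n2 := ae_eq_zero_of_forall_integral_eq_zero (s.snd.intervalIntegrable_mul_add hf₁ hf₂)
    fun x hx => by rw [← pairing_eq_of_eqOn hf₁ hf₂ hx h2]; exact (key x hx 0).2
  filter_upwards [n1, n2] with x c1 c2 hx
  have hdet := s.det (Ioo_subset_Icc_self hx)
  have hE := Complex.exp_ne_zero ((0 * (Complex.I * b₁) + 0 * (Complex.I * b₂)) * x)
  rw [← hdet] at hE
  refine ⟨(mul_eq_zero.1 ?_).resolve_left hE, (mul_eq_zero.1 ?_).resolve_left hE⟩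
  · linear_combination k x * c1 hx - g x * c2 hx
  · linear_combination f x * c2 hx - h x * c1 hx

end Determinacy

theorem span_topologicalClosure_eq_top_of_dual {E : Type*} [NormedAddCommGroup E]
    [NormedSpace ℂ E] {S : Set E} (h : ∀ φ : E →L[ℂ] ℂ, (∀ x ∈ S, φ x = 0) → φ = 0) :
    (Submodule.span ℂ S).topologicalClosure = ⊤ := by
  refine Submodule.eq_top_iff'.2 fun x => ?_
  by_contra hx
  set p := (Submodule.span ℂ S).topologicalClosure
  have : IsClosed (p : Set E) := Submodule.isClosed_topologicalClosure _
  have hx' : p.mkQ x ≠ 0 := by simpa [Submodule.Quotient.mk_eq_zero] using hx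
  obtain ⟨g, -, hg⟩ := exists_dual_vector ℂ (p.mkQ x) (norm_ne_zero_iff.2 hx')
  have hφ := h (g.comp p.mkQL) fun y hy => by
    have : p.mkQ y = 0 := (Submodule.Quotient.mk_eq_zero _).2
      (Submodule.le_topologicalClosure _ (Submodule.subset_span hy))
    change g (p.mkQ y) = 0
    rw [this, map_zero]
  have : g (p.mkQ x) = 0 := by simpa using congrArg (fun ψ : E →L[ℂ] ℂ => ψ x) hφ
  rw [hg] at this
  exact hx' (by simpa using this)

instance : IsFiniteMeasure mu01 := by unfold mu01 I01; infer_instance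

theorem memLp_extendIcc (y : C(unitInterval, ℂ × ℂ)) : MemLp (extendIcc y) 2 mu01 :=
  MemLp.of_bound (continuous_extendIcc y).aestronglyMeasurable ‖y‖
    (Eventually.of_forall fun t => norm_extendIcc_le y t)

theorem intervalIntegrable_of_memLp {f : ℝ → ℂ} (hf : MemLp f 2 mu01) :
    IntervalIntegrable f volume 0 1 := by
  rw [intervalIntegrable_iff_integrableOn_Icc_of_le zero_le_one]
  exact hf.integrable one_le_two

/-- The Riesz representation of a functional on `L²([0,1]; ℂ²)` by a pair of densities. -/
theorem exists_dual_density (φ : Lp (ℂ × ℂ) 2 mu01 →L[ℂ] ℂ) :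
    ∃ f₁ f₂ : ℝ → ℂ, MemLp f₁ 2 mu01 ∧ MemLp f₂ 2 mu01 ∧ ∀ g : Lp (ℂ × ℂ) 2 mu01,
      φ g = ∫ t, ((g t).1 * f₁ t + (g t).2 * f₂ t) ∂mu01 := by
  have key : ∀ ψ : Lp ℂ 2 mu01 →L[ℂ] ℂ, ∃ f : ℝ → ℂ, MemLp f 2 mu01 ∧
      ∀ g : Lp ℂ 2 mu01, ψ g = ∫ t, g t * f t ∂mu01 := fun ψ => by
    set F := (InnerProductSpace.toDual ℂ (Lp ℂ 2 mu01)).symm ψ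
    refine ⟨fun t => starRingEnd ℂ (F t), (Lp.memLp F).star, fun g => ?_⟩
    rw [← InnerProductSpace.toDual_symm_apply (𝕜 := ℂ), L2.inner_def]
    rfl
  obtain ⟨f₁, hf₁, h₁⟩ := key (φ.comp ((ContinuousLinearMap.inl ℂ ℂ ℂ).compLpL 2 mu01))
  obtain ⟨f₂, hf₂, h₂⟩ := key (φ.comp ((ContinuousLinearMap.inr ℂ ℂ ℂ).compLpL 2 mu01))
  refine ⟨f₁, f₂, hf₁, hf₂, fun g => ?_⟩
  set g₁ := (ContinuousLinearMap.fst ℂ ℂ ℂ).compLpL 2 mu01 g with hg₁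
  set g₂ := (ContinuousLinearMap.snd ℂ ℂ ℂ).compLpL 2 mu01 g with hg₂
  have e₁ : g₁ =ᵐ[mu01] fun t => (g t).1 :=
    ContinuousLinearMap.coeFn_compLpL (ContinuousLinearMap.fst ℂ ℂ ℂ) g
  have e₂ : g₂ =ᵐ[mu01] fun t => (g t).2 :=
    ContinuousLinearMap.coeFn_compLpL (ContinuousLinearMap.snd ℂ ℂ ℂ) g
  have hg : g = (ContinuousLinearMap.inl ℂ ℂ ℂ).compLpL 2 mu01 g₁
      + (ContinuousLinearMap.inr ℂ ℂ ℂ).compLpL 2 mu01 g₂ := by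
    refine Lp.ext ?_
    filter_upwards [Lp.coeFn_add ((ContinuousLinearMap.inl ℂ ℂ ℂ).compLpL 2 mu01 g₁)
      ((ContinuousLinearMap.inr ℂ ℂ ℂ).compLpL 2 mu01 g₂), e₁, e₂,
      ContinuousLinearMap.coeFn_compLpL (ContinuousLinearMap.inl ℂ ℂ ℂ) g₁,
      ContinuousLinearMap.coeFn_compLpL (ContinuousLinearMap.inr ℂ ℂ ℂ) g₂] with t h a₁ a₂ b₁ b₂
    rw [h, Pi.add_apply, b₁, b₂, a₁, a₂]
    simp
  have h₁' := h₁ g₁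
  have h₂' := h₂ g₂
  rw [ContinuousLinearMap.comp_apply] at h₁' h₂'
  conv_lhs => rw [hg]
  rw [map_add, h₁', h₂']
  refine (integral_add ((Lp.memLp g₁).integrable_mul hf₁)
    ((Lp.memLp g₂).integrable_mul hf₂)).symm.trans (integral_congr_ae ?_)
  filter_upwards [e₁, e₂] with t a₁ a₂
  rw [Pi.mul_apply, Pi.mul_apply, a₁, a₂]

theorem satisfiesBC_of_separated {a : Fin 2 → Fin 4 → ℂ} (hJ32 : Jdet a 2 1 = 0)
    (hJ13 : Jdet a 0 2 = 0) (hJ42 : Jdet a 3 1 = 0) (hJ14 : Jdet a 0 3 ≠ 0) :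
    ∃ c d : ℂ, c * d = 0 ∧ ∀ y : ℝ → ℂ × ℂ,
      (y 0).1 + c * (y 1).1 = 0 → d * (y 0).2 + (y 1).2 = 0 → SatisfiesBC a y := by
  set D := Jdet a 0 3 with hD
  have h₁ : ∀ i, a i 2 * D = a i 0 * Jdet a 2 3 := by
    unfold Jdet at *
    refine Fin.forall_fin_two.2 ⟨?_, ?_⟩
    · linear_combination a 0 2 * hD + a 0 3 * hJ13
    · linear_combination a 1 2 * hD + a 1 3 * hJ13
  have h₂ : ∀ i, a i 1 * D = a i 3 * Jdet a 0 1 := by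
    unfold Jdet at *
    refine Fin.forall_fin_two.2 ⟨?_, ?_⟩
    · linear_combination a 0 1 * hD - a 0 0 * hJ42
    · linear_combination a 1 1 * hD - a 1 0 * hJ42
  refine ⟨Jdet a 2 3 / D, Jdet a 0 1 / D, ?_, fun y e₁ e₂ i => mul_right_cancel₀ hJ14 ?_⟩
  · have : Jdet a 2 3 * Jdet a 0 1 = 0 := by
      unfold Jdet at *
      linear_combination (a 0 1 * a 1 3 - a 0 3 * a 1 1) * hJ13
        + (a 0 0 * a 1 3 - a 0 3 * a 1 0) * hJ32
    rw [div_mul_div_comm, this, zero_div]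
  · have e₃ := div_mul_cancel₀ (Jdet a 2 3) hJ14
    have e₄ := div_mul_cancel₀ (Jdet a 0 1) hJ14
    linear_combination a i 0 * D * e₁ + a i 3 * D * e₂ + (y 0).2 * h₂ i + (y 1).1 * h₁ i
      - a i 3 * (y 0).2 * e₄ - a i 0 * (y 1).1 * e₃

theorem exists_continuousMap_eqOn {f : ℝ → ℂ} (hf : ContinuousOn f (Icc 0 1)) (κ : ℂ) :
    ∃ u : C(ℝ, ℂ), ∀ t ∈ Icc (0 : ℝ) 1, u t = κ * f t :=
  ⟨⟨_, (continuousOn_iff_continuous_domRestrict.1 (hf.const_smul κ)).Icc_extend'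
    (h := zero_le_one)⟩, fun _ ht =>
      IccExtend_of_mem zero_le_one ((Icc (0 : ℝ) 1).domRestrict (κ • f)) ht⟩

theorem eventually_nhdsGT_mem_Icc : ∀ᶠ s : ℝ in 𝓝[>] 0, s ∈ Icc (0 : ℝ) 1 := by
  filter_upwards [Ioo_mem_nhdsGT (zero_lt_one' ℝ)] with s hs using Ioo_subset_Icc_self hs

theorem isLittleO_const_mul_sub {f u : ℝ → ℂ} {ω κ : ℂ} {j : ℕ}
    (h : (fun s : ℝ => f s - ω * s ^ j) =o[𝓝[>] 0] fun s : ℝ => s ^ j)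
    (hu : ∀ s ∈ Icc (0 : ℝ) 1, u s = κ * f s) :
    (fun s : ℝ => u s - κ * ω * s ^ j) =o[𝓝[>] 0] fun s : ℝ => s ^ j := by
  refine (h.const_mul_left κ).congr' ?_ EventuallyEq.rfl
  filter_upwards [eventually_nhdsGT_mem_Icc] with s hs
  rw [hu s hs]
  ring

theorem isRootFunction_extendIcc {b₁ b₂ : ℝ} (hb₁ : b₁ ≠ 0) (hb₂ : b₂ ≠ 0) {Q12 Q21 : ℝ → ℂ}
    {u v : C(ℝ, ℂ)} (hu : ∀ t ∈ Icc (0 : ℝ) 1, u t = -(Complex.I * b₁) * Q12 t)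
    (hv : ∀ t ∈ Icc (0 : ℝ) 1, v t = -(Complex.I * b₂) * Q21 t) {a : Fin 2 → Fin 4 → ℂ}
    {lam : ℂ} {m : ℕ} {y : ℕ → C(unitInterval, ℂ × ℂ)} (hy : y 0 ≠ 0)
    (hbc : ∀ k ≤ m, SatisfiesBC a (extendIcc (y k)))
    (h₀ : pencilOp (diracPotential u v) (y 0)
      = lam • volterra (diracWeight (Complex.I * b₁) (Complex.I * b₂)) (y 0))
    (hs : ∀ k, pencilOp (diracPotential u v) (y (k + 1))
      = lam • volterra (diracWeight (Complex.I * b₁) (Complex.I * b₂)) (y (k + 1))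
        + volterra (diracWeight (Complex.I * b₁) (Complex.I * b₂)) (y k)) {k : ℕ} (hk : k ≤ m) :
    IsRootFunction b₁ b₂ Q12 Q21 a (extendIcc (y k)) := by
  refine ⟨lam, m, fun k => extendIcc (y k), hbc, ?_, ?_, fun j hj _ => ?_, k, hk, rfl⟩
  · by_contra! h
    exact hy (ContinuousMap.ext fun x => (extendIcc_of_mem (y 0) x.2).symm.trans (h x x.2))
  · have := solvesDirac_of_pencil hb₁ hb₂ hu hv (lam := lam) (y := y 0) (r := 0)
      (by rw [h₀, map_zero, add_zero])
    simpa [extendIcc] using this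
  · obtain ⟨i, rfl⟩ := Nat.exists_eq_add_of_le' hj
    exact solvesDirac_of_pencil hb₁ hb₂ hu hv (hs i)

theorem rootSystemComplete_of_leading_monomials {b₁ b₂ : ℝ} (hb₁ : b₁ < 0) (hb₂ : 0 < b₂)
    {Q12 Q21 : ℝ → ℂ} (hQ12 : ContinuousOn Q12 (Icc 0 1)) (hQ21 : ContinuousOn Q21 (Icc 0 1))
    {a : Fin 2 → Fin 4 → ℂ} {c d : ℂ} (hcd : c * d = 0)
    (hbc : ∀ y : ℝ → ℂ × ℂ,
      (y 0).1 + c * (y 1).1 = 0 → d * (y 0).2 + (y 1).2 = 0 → SatisfiesBC a y)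
    {ω ω' : ℂ} (hω : ω ≠ 0) (hω' : ω' ≠ 0) {j j' : ℕ}
    (hj : (fun s : ℝ => Q12 s - ω * s ^ j) =o[𝓝[>] 0] fun s : ℝ => s ^ j)
    (hj' : (fun s : ℝ => Q21 (1 - s) - ω' * s ^ j') =o[𝓝[>] 0] fun s : ℝ => s ^ j') :
    RootSystemComplete b₁ b₂ Q12 Q21 a := by
  obtain ⟨u, hu⟩ := exists_continuousMap_eqOn hQ12 (-(Complex.I * b₁))
  obtain ⟨v, hv⟩ := exists_continuousMap_eqOn hQ21 (-(Complex.I * b₂))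
  have hκ₁ : -(Complex.I * b₁) ≠ 0 := by simp [hb₁.ne]
  have hκ₂ : -(Complex.I * b₂) ≠ 0 := by simp [hb₂.ne']
  refine span_topologicalClosure_eq_top_of_dual fun φ hφ => ?_
  obtain ⟨f₁, f₂, hf₁, hf₂, hf⟩ := exists_dual_density φ
  have hi₁ := intervalIntegrable_of_memLp hf₁
  have hi₂ := intervalIntegrable_of_memLp hf₂
  have hpair : ∀ y : C(unitInterval, ℂ × ℂ), IsRootFunction b₁ b₂ Q12 Q21 a (extendIcc y) →
      pairing hi₁ hi₂ (right_mem_Icc.2 zero_le_one) y = 0 := fun y hy => by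
    have hae := (memLp_extendIcc y).coeFn_toLp
    rw [← hφ _ ⟨_, hy, hae⟩, hf, pairing_apply, intervalIntegral.integral_of_le zero_le_one,
      ← integral_Icc_eq_integral_Ioc]
    refine (integral_congr_ae ?_).symm
    filter_upwards [hae] with t ht
    rw [ht]
  have hzero := ae_eq_zero_of_pairing_diracSolution hb₁ hb₂ hi₁ hi₂ (u := u) (v := v)
    (pairing_diracSolution_eq_zero hb₁ hb₂ (mul_ne_zero hκ₁ hω) (mul_ne_zero hκ₂ hω')
      (isLittleO_const_mul_sub hj hu)
      (isLittleO_const_mul_sub hj' fun s hs => hv (1 - s) ⟨by linarith [hs.2], by linarith [hs.1]⟩)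
      hi₁ hi₂ hcd fun lam m y hy hb h₀ hs k hk => hpair _ ?_)
  · ext g
    rw [hf, zero_apply]
    refine integral_eq_zero_of_ae ?_
    change _ =ᵐ[volume.restrict (Icc 0 1)] _
    rw [← restrict_Ioo_eq_restrict_Icc, EventuallyEq, ae_restrict_iff' measurableSet_Ioo]
    filter_upwards [hzero] with t ht hmem
    simp [(ht hmem).1, (ht hmem).2]
  · refine isRootFunction_extendIcc hb₁.ne hb₂.ne' hu hv hy (fun i hi => ?_) h₀ hs hk
    obtain ⟨h0, h1⟩ := hb i hi
    refine hbc _ ?_ ?_ <;>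
      rw [extendIcc_of_mem _ (left_mem_Icc.2 zero_le_one),
        extendIcc_of_mem _ (right_mem_Icc.2 zero_le_one)]
    exacts [h0, h1]

/-- Corollary: `J₃₂ = J₁₃ = J₄₂ = 0`, `J₁₄ ≠ 0`. -/
theorem statement_17
    (b₁ b₂ : ℝ) (hb₁ : b₁ < 0) (hb₂ : 0 < b₂)
    (Q12 Q21 : ℝ → ℂ) (a : Fin 2 → Fin 4 → ℂ)
    (n : ℕ) (hn : 2 ≤ n)
    (hQ12 : MemW1 n Q12) (hQ21 : MemW1 n Q21)
    (hJ32 : Jdet a 2 1 = 0) (hJ13 : Jdet a 0 2 = 0) (hJ42 : Jdet a 3 1 = 0)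
    (hJ14 : Jdet a 0 3 ≠ 0)
    (j₀ j₁ : ℕ) (hj₀ : j₀ ≤ n - 2) (hj₁ : j₁ ≤ n - 2) (hj : j₀ + j₁ ≤ n - 2)
    (hQ : iteratedDerivWithin j₀ Q12 I01 0 * iteratedDerivWithin j₁ Q21 I01 1 ≠ 0) :
    RootSystemComplete b₁ b₂ Q12 Q21 a := by
  have hc (f : ℝ → ℂ) (h : MemW1 n f) : ContDiffOn ℝ (n - 1 : ℕ) f (Icc 0 1) := h.1
  obtain ⟨ω, hω, j, hj⟩ := exists_leading_monomial_left (hc _ hQ12) (by omega : j₀ ≤ n - 1)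
    (left_ne_zero_of_mul hQ)
  obtain ⟨ω', hω', j', hj'⟩ := exists_leading_monomial_right (hc _ hQ21) (by omega : j₁ ≤ n - 1)
    (right_ne_zero_of_mul hQ)
  obtain ⟨c, d, hcd, hbc⟩ := satisfiesBC_of_separated hJ32 hJ13 hJ42 hJ14
  exact rootSystemComplete_of_leading_monomials hb₁ hb₂ (hc _ hQ12).continuousOn
    (hc _ hQ21).continuousOn hcd hbc hω hω' hj hj'
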